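/- Let K be a field, n ≥ 2, X the generic n×n matrix over K with entries in S = K[x_{ij}], R = S/(det X), L the cokernel of the R-linear map Rⁿ → Rⁿ given by X̄, and L^∨ the cokernel of the R-linear map given by X̄ᵀ (bars denote reduction modulo det X). Fix indices 1 ≤ r < s ≤ n. Then Ext¹_R(L, L^∨) is isomorphic, as an S-module, to the ideal of S/I_{n−1}(X) generated by the images of the (n−2)×(n−2) minors of X obtained by deleting rows r, s and columns k, l of X, for all 1 ≤ k < l ≤ n (that is, the ideal generated by the maximal minors of the n−2 rows of X complementary to {r, s}). -/

import Mathlib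

open Matrix CategoryTheory

noncomputable section

/-- The generic `n × n` matrix, whose `(i,j)` entry is the indeterminate `x_{ij}` of the
polynomial ring `S = K[x_{ij}]`. -/
def genericMatrix (K : Type*) [Field K] (n : ℕ) :
    Matrix (Fin n) (Fin n) (MvPolynomial (Fin n × Fin n) K) :=
  Matrix.of fun i j => MvPolynomial.X (i, j)

/-- The generic determinantal hypersurface ring `R = S/(det X)`. -/
abbrev genericDetRing (K : Type*) [Field K] (n : ℕ) :=
  MvPolynomial (Fin n × Fin n) K ⧸ Ideal.span {(genericMatrix K n).det}

/-- Reduction of a matrix over `S` modulo `det X`. -/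
def matBar {K : Type*} [Field K] {n : ℕ}
    (A : Matrix (Fin n) (Fin n) (MvPolynomial (Fin n × Fin n) K)) :
    Matrix (Fin n) (Fin n) (genericDetRing K n) :=
  A.map (Ideal.Quotient.mk _)

/-- The ideal `I_{n-1}(X) ⊆ S` generated by the `(n-1) × (n-1)` minors of the generic matrix. -/
def minorsIdeal (K : Type*) [Field K] (n : ℕ) :
    Ideal (MvPolynomial (Fin n × Fin n) K) :=
  Ideal.span { d | ∃ f g : Fin (n - 1) → Fin n, StrictMono f ∧ StrictMono g ∧
    d = ((genericMatrix K n).submatrix f g).det }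

/-- The `(n-2) × (n-2)` minors of the generic matrix obtained by deleting rows `r, s` (and
some pair of columns `k < l`): the submatrices are encoded by strictly monotone maps whose
ranges are the complements of `{r, s}` and `{k, l}`. -/
def rowMinorsSet (K : Type*) [Field K] (n : ℕ) (r s : Fin n) :
    Set (MvPolynomial (Fin n × Fin n) K) :=
  { d | ∃ k l : Fin n, k < l ∧ ∃ f g : Fin (n - 2) → Fin n,
      StrictMono f ∧ StrictMono g ∧
      Set.range f = ({r, s} : Set (Fin n))ᶜ ∧ Set.range g = ({k, l} : Set (Fin n))ᶜ ∧
      d = ((genericMatrix K n).submatrix f g).det }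

/-! ### Elements regular modulo an ideal -/

/-- `a` is a nonzerodivisor modulo the ideal `I`. -/
def IsRegularModulo {S : Type*} [CommRing S] (I : Ideal S) (a : S) : Prop :=
  ∀ c, c * a ∈ I → c ∈ I

namespace IsRegularModulo

variable {S : Type*} [CommRing S]

theorem one (I : Ideal S) : IsRegularModulo I 1 := fun c hc => by simpa using hc

theorem swap {I : Ideal S} {a b : S} (hb : IsRegularModulo I b)
    (ha : IsRegularModulo (I ⊔ Ideal.span {b}) a) :
    IsRegularModulo (I ⊔ Ideal.span {a}) b := by
  intro c hc
  obtain ⟨i, hi, y, hy, h⟩ := Submodule.mem_sup.1 hc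
  obtain ⟨d, rfl⟩ := Ideal.mem_span_singleton'.1 hy
  have hd : d * a ∈ I ⊔ Ideal.span {b} := by
    have : d * a = (-i) + c * b := by rw [← h]; ring
    rw [this]
    exact Submodule.add_mem_sup (I.neg_mem hi) (Ideal.mem_span_singleton'.2 ⟨c, rfl⟩)
  obtain ⟨i', hi', y, hy, h'⟩ := Submodule.mem_sup.1 (ha d hd)
  obtain ⟨e, rfl⟩ := Ideal.mem_span_singleton'.1 hy
  have hce : c - e * a ∈ I := hb _ (by
    have : (c - e * a) * b = i + a * i' := by
      rw [sub_mul, ← h, ← h']; ring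
    rw [this]
    exact I.add_mem hi (I.mul_mem_left _ hi'))
  have : c = (c - e * a) + e * a := by ring
  rw [this]
  exact Submodule.add_mem_sup hce (Ideal.mem_span_singleton'.2 ⟨e, rfl⟩)

theorem congr {I : Ideal S} {a b : S} (ha : IsRegularModulo I a) (h : a - b ∈ I) :
    IsRegularModulo I b := fun c hc => ha c (by
  have : c * a = c * b + c * (a - b) := by ring
  rw [this]
  exact I.add_mem hc (I.mul_mem_left _ h))

theorem of_mul_left {I : Ideal S} {a b : S} (h : IsRegularModulo I (a * b)) :
    IsRegularModulo I a := fun c hc => h c (by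
  rw [← mul_assoc]; exact I.mul_mem_right _ hc)

theorem mul {I : Ideal S} {a b : S} (ha : IsRegularModulo I a) (hb : IsRegularModulo I b) :
    IsRegularModulo I (a * b) := fun c hc => ha c (hb _ (by rwa [mul_assoc]))

theorem neg {I : Ideal S} {a : S} (ha : IsRegularModulo I a) : IsRegularModulo I (-a) :=
  fun c hc => ha c (by simpa using I.neg_mem hc)

theorem bot_iff {a : S} : IsRegularModulo (⊥ : Ideal S) a ↔ ∀ c, c * a = 0 → c = 0 := by
  simp [IsRegularModulo]

theorem map_equiv {S' : Type*} [CommRing S'] (e : S ≃+* S') {I : Ideal S} {a : S}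
    (ha : IsRegularModulo I a) : IsRegularModulo (I.map e) (e a) := by
  intro c hc
  have key : ∀ y : S', y ∈ I.map e ↔ e.symm y ∈ I := by
    intro y
    rw [Ideal.mem_map_of_equiv]
    constructor
    · rintro ⟨x, hx, rfl⟩; simpa using hx
    · intro h; exact ⟨_, h, by simp⟩
  rw [key] at hc ⊢
  exact ha _ (by simpa using hc)

open Polynomial in
theorem polynomial_linear {I : Ideal S} {a : S} (ha : IsRegularModulo I a) (b : S) :
    IsRegularModulo (I.map (C : S →+* S[X])) (C a * X + C b) := by
  intro c hc
  rw [Ideal.mem_map_C_iff] at hc ⊢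
  have key : ∀ m n, c.natDegree < n + m → c.coeff n ∈ I := by
    intro m
    induction m with
    | zero => intro n hn; rw [coeff_eq_zero_of_natDegree_lt (by simpa using hn)]; exact I.zero_mem
    | succ m ih =>
      intro n hn
      have h1 := ih (n + 1) (by omega)
      have h2 := hc (n + 1)
      rw [mul_add, ← mul_assoc, coeff_add, coeff_mul_X, coeff_mul_C, coeff_mul_C] at h2
      exact ha _ ((I.add_mem_iff_left (I.mul_mem_right _ h1)).1 h2)
  exact fun n => key (c.natDegree + 1) n (by omega)

open Polynomial in
theorem polynomial_C {I : Ideal S} {a : S} (ha : IsRegularModulo I a) :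
    IsRegularModulo (I.map (C : S →+* S[X])) (C a) := by
  intro c hc
  rw [Ideal.mem_map_C_iff] at hc ⊢
  exact fun n => ha _ (by simpa using hc n)

open MvPolynomial in
theorem mvPolynomial_C {σ : Type*} {I : Ideal S} {a : S} (ha : IsRegularModulo I a) :
    IsRegularModulo (I.map (C : S →+* MvPolynomial σ S)) (C a) := by
  intro c hc
  rw [mem_map_C_iff] at hc ⊢
  exact fun n => ha _ (by simpa only [mul_comm c, coeff_C_mul, mul_comm a] using hc n)

open MvPolynomial in
theorem mvPolynomial_linear {σ : Type*} [Fintype σ] {I : Ideal S} {a : σ → S} {j : σ}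
    (ha : IsRegularModulo I (a j)) :
    IsRegularModulo (I.map (C : S →+* MvPolynomial σ S)) (∑ i, C (a i) * X i) := by
  classical
  intro c hc
  rw [mem_map_C_iff] at hc ⊢
  by_contra! hcon
  obtain ⟨d₀, hd₀⟩ := hcon
  obtain ⟨d, hd, hmax⟩ := Finset.exists_max_image
    (c.support.filter fun d => coeff d c ∉ I) (fun d => d j)
    ⟨d₀, by
      simp only [Finset.mem_filter, mem_support_iff]
      exact ⟨fun h => hd₀ (h ▸ I.zero_mem), hd₀⟩⟩
  simp only [Finset.mem_filter] at hd hmax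
  refine hd.2 (ha _ ?_)
  have h := hc (d + Finsupp.single j 1)
  have hmem : ∀ d' : σ →₀ ℕ, d j < d' j → coeff d' c ∈ I := by
    intro d' hd'
    by_contra hn
    have := hmax d' ⟨by rw [mem_support_iff]; exact fun h => hn (h ▸ I.zero_mem), hn⟩
    omega
  rw [Finset.mul_sum, coeff_sum, ← Finset.add_sum_erase _ _ (Finset.mem_univ j)] at h
  have h2 : ∑ i ∈ Finset.univ.erase j, coeff (d + Finsupp.single j 1) (c * (C (a i) * X i)) ∈ I := by
    refine I.sum_mem fun i hi => ?_
    rw [← mul_assoc, coeff_mul_X']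
    split_ifs
    · rw [mul_comm, coeff_C_mul]
      refine I.mul_mem_left _ (hmem _ ?_)
      have : i ≠ j := (Finset.mem_erase.1 hi).1
      simp [this]
    · exact I.zero_mem
  have h3 := (I.add_mem_iff_left h2).1 h
  rwa [← mul_assoc, coeff_mul_X, mul_comm c, coeff_C_mul, mul_comm] at h3

end IsRegularModulo

/-! ### Identities for adjugates -/

section Adjugate

variable {S : Type*} [CommRing S] {ι : Type*} [Fintype ι] [DecidableEq ι]

theorem adjugate_updateCol_self (X : Matrix ι ι S) (k : ι) (b : ι → S) (s : ι) :
    (X.updateCol k b).adjugate k s = X.adjugate k s := by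
  have h (Z : Matrix ι ι S) : Z.adjugate k s = (Z.updateCol k (Pi.single s 1)).det := by
    rw [← cramer_apply, cramer_eq_adjugate_mulVec, mulVec_single_one, col_apply]
  rw [h, h, updateCol_idem]

theorem det_updateCol_eq (X : Matrix ι ι S) (k : ι) (b : ι → S) :
    (X.updateCol k b).det = (X.adjugate *ᵥ b) k := by
  rw [← cramer_apply, cramer_eq_adjugate_mulVec]

/-- The `2 × 2` minors of the adjugate are multiples of the determinant. -/
theorem adjugate_mul_adjugate_sub (X : Matrix ι ι S) {k l : ι} (hkl : k ≠ l) (r s : ι) :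
    X.adjugate k r * X.adjugate l s - X.adjugate l r * X.adjugate k s =
      X.det * (X.updateCol k (Pi.single r 1)).adjugate l s := by
  set X₁ := X.updateCol k (Pi.single r 1) with hX₁
  have hdet : X₁.det = X.adjugate k r := by
    rw [hX₁, det_updateCol_eq, mulVec_single_one, col_apply]
  have hA : ∀ m, (X.adjugate * X₁) l m = if m = k then X.adjugate l r else
      X.det * (1 : Matrix ι ι S) l m := by
    intro m
    split_ifs with h
    · subst h
      simp [mul_apply, hX₁, Pi.single_apply]
    · have := congrFun (congrFun (adjugate_mul X) l) m
      rw [Matrix.smul_apply, smul_eq_mul] at this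
      rw [← this]
      simp [mul_apply, hX₁, h]
  have h1 : (X.adjugate * X₁ * X₁.adjugate) l s = X.adjugate k r * X.adjugate l s := by
    rw [Matrix.mul_assoc, mul_adjugate, hdet]
    simp
  rw [← h1, mul_apply, ← adjugate_updateCol_self X k (Pi.single r 1) s, ← hX₁]
  rw [← Finset.add_sum_erase _ _ (Finset.mem_univ k),
    ← Finset.add_sum_erase _ _ (Finset.mem_erase.2 ⟨hkl.symm, Finset.mem_univ l⟩),
    Finset.sum_eq_zero]
  · rw [hA, hA, if_pos rfl, if_neg hkl.symm]
    simp
  · intro m hm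
    simp only [Finset.mem_erase, Finset.mem_univ, and_true] at hm
    rw [hA, if_neg hm.2, one_apply_ne hm.1.symm]
    simp

theorem adjugate_rank_one (X : Matrix ι ι S) (k l r s : ι) :
    ∃ c, X.adjugate k r * X.adjugate l s - X.adjugate l r * X.adjugate k s = X.det * c := by
  by_cases hkl : k = l
  · exact ⟨0, by subst hkl; ring⟩
  · exact ⟨_, adjugate_mul_adjugate_sub X hkl r s⟩

variable {X : Matrix ι ι S} (hX : ∀ c, c * X.det = 0 → c = 0)
include hX

theorem det_smul_cancel {κ : Type*} {v w : κ → S} (h : X.det • v = X.det • w) : v = w := by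
  funext i
  have := congrFun h i
  simp only [Pi.smul_apply, smul_eq_mul] at this
  exact sub_eq_zero.1 (hX _ (by linear_combination this))

theorem det_smul_cancel_matrix {κ μ : Type*} {v w : Matrix κ μ S}
    (h : X.det • v = X.det • w) : v = w := by
  ext i j
  have := congrFun (congrFun h i) j
  simp only [Matrix.smul_apply, smul_eq_mul] at this
  exact sub_eq_zero.1 (hX _ (by linear_combination this))

theorem eq_adjugate_mulVec {v w : ι → S} (h : X *ᵥ v = X.det • w) : v = X.adjugate *ᵥ w := by
  refine det_smul_cancel hX ?_
  rw [← mulVec_smul, ← h, mulVec_mulVec, adjugate_mul, smul_mulVec, one_mulVec]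

theorem eq_mulVec_of_adjugate {v w : ι → S} (h : X.adjugate *ᵥ v = X.det • w) :
    v = X *ᵥ w := by
  refine det_smul_cancel hX ?_
  rw [← mulVec_smul, ← h, mulVec_mulVec, mul_adjugate, smul_mulVec, one_mulVec]

theorem eq_adjugate_mul {κ : Type*} {v w : Matrix ι κ S} (h : X * v = X.det • w) :
    v = X.adjugate * w := by
  refine det_smul_cancel_matrix hX ?_
  rw [← Matrix.mul_smul, ← h, ← Matrix.mul_assoc, adjugate_mul, Matrix.smul_mul, Matrix.one_mul]

theorem eq_mul_of_adjugate {κ : Type*} {v w : Matrix ι κ S} (h : X.adjugate * v = X.det • w) :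
    v = X * w := by
  refine det_smul_cancel_matrix hX ?_
  rw [← Matrix.mul_smul, ← h, ← Matrix.mul_assoc, mul_adjugate, Matrix.smul_mul, Matrix.one_mul]

end Adjugate

/-! ### Bordered matrices -/

section Border

variable {S : Type*} {ι : Type*}

/-- The matrix `Y` bordered by the column `z`, the row `x` and the corner entry `t`. -/
def border (Y : Matrix ι ι S) (z x : ι → S) (t : S) : Matrix (ι ⊕ Unit) (ι ⊕ Unit) S :=
  fromBlocks Y (of fun i _ => z i) (of fun _ j => x j) (of fun _ _ => t)

@[simp] theorem border_inl_inl (Y : Matrix ι ι S) (z x : ι → S) (t : S) (i j : ι) :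
    border Y z x t (Sum.inl i) (Sum.inl j) = Y i j := rfl

@[simp] theorem border_inl_inr (Y : Matrix ι ι S) (z x : ι → S) (t : S) (i : ι) (j : Unit) :
    border Y z x t (Sum.inl i) (Sum.inr j) = z i := rfl

@[simp] theorem border_inr_inl (Y : Matrix ι ι S) (z x : ι → S) (t : S) (i : Unit) (j : ι) :
    border Y z x t (Sum.inr i) (Sum.inl j) = x j := rfl

@[simp] theorem border_inr_inr (Y : Matrix ι ι S) (z x : ι → S) (t : S) (i j : Unit) :
    border Y z x t (Sum.inr i) (Sum.inr j) = t := rfl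

theorem border_transpose (Y : Matrix ι ι S) (z x : ι → S) (t : S) :
    (border Y z x t)ᵀ = border Yᵀ x z t := by
  ext (i | i) (j | j) <;> rfl

theorem border_map {S S' : Type*} [CommRing S] [CommRing S'] (f : S →+* S') (Y : Matrix ι ι S) (z x : ι → S)
    (t : S) : (border Y z x t).map f = border (Y.map f) (f ∘ z) (f ∘ x) (f t) := by
  ext (i | i) (j | j) <;> rfl

variable [CommRing S] [Fintype ι]

theorem border_mulVec (Y : Matrix ι ι S) (z x : ι → S) (t : S) (v : ι → S) (c : S) :
    border Y z x t *ᵥ Sum.elim v (fun _ => c) =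
      Sum.elim (Y *ᵥ v + c • z) (fun _ => x ⬝ᵥ v + t * c) := by
  funext i
  rcases i with i | i <;> simp [mulVec, dotProduct, mul_comm]

variable [DecidableEq ι]

theorem det_border_eq_add (Y : Matrix ι ι S) (z x : ι → S) (t : S) :
    (border Y z x t).det = t * Y.det + (border Y z x 0).det := by
  have h1 : border Y z x t = (border Y z x 0).updateRow (Sum.inr ())
      (t • Pi.single (Sum.inr ()) 1 + border Y z x 0 (Sum.inr ())) := by
    ext (i | i) (j | j) <;> simp [updateRow_apply]
  have h2 : (border Y z x 0).updateRow (Sum.inr ()) (Pi.single (Sum.inr ()) 1) =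
      fromBlocks Y (of fun i _ => z i) 0 1 := by
    ext (i | i) (j | j) <;> simp [updateRow_apply, border]
  conv_lhs => rw [h1, det_updateRow_add, det_updateRow_smul, updateRow_eq_self, h2,
    det_fromBlocks_zero₂₁, det_one, mul_one]

theorem adjugate_border_inl_inl (Y : Matrix ι ι S) (z x : ι → S) (t : S) (p q : ι) :
    (border Y z x t).adjugate (Sum.inl p) (Sum.inl q) = t * Y.adjugate p q +
      (border (Y.updateRow q (Pi.single p 1)) (Function.update z q 0) x 0).det := by
  rw [adjugate_apply, adjugate_apply, ← det_border_eq_add]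
  congr 1
  ext (i | i) (j | j) <;> simp [updateRow_apply, Function.update_apply, Pi.single_apply]

section Regular

variable {Y : Matrix ι ι S} (hY : ∀ c, c * Y.det = 0 → c = 0)
include hY

theorem det_border (z x : ι → S) (t : S) :
    (border Y z x t).det = t * Y.det - x ⬝ᵥ (Y.adjugate *ᵥ z) := by
  have h1 : border Y z x t * fromBlocks 1 (of fun i _ => -(Y.adjugate *ᵥ z) i) 0
      (of fun _ _ => Y.det) = fromBlocks Y 0 (of fun _ j => x j)
      (of fun _ _ => t * Y.det - x ⬝ᵥ (Y.adjugate *ᵥ z)) := by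
    rw [border, fromBlocks_multiply]
    congr 1
    · simp
    · ext i j
      have : (Y *ᵥ (Y.adjugate *ᵥ z)) i = Y.det * z i := by
        rw [mulVec_mulVec, mul_adjugate, smul_mulVec, one_mulVec]; rfl
      simp only [Matrix.add_apply, mul_apply, of_apply, mul_neg, Finset.sum_neg_distrib, Matrix.zero_apply,
        Finset.univ_unique, Finset.sum_const, Finset.card_singleton, one_smul]
      simp only [mulVec, dotProduct] at this ⊢
      rw [this]; ring
    · simp
    · ext i j
      simp [mul_apply, dotProduct]; ring
  have h2 := congrArg det h1
  rw [det_mul, det_fromBlocks_zero₁₂, det_fromBlocks_zero₂₁] at h2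
  simp only [det_one, one_mul, det_unique, of_apply] at h2
  exact sub_eq_zero.1 (hY _ (by linear_combination h2))

variable {z x : ι → S} {t : S} (hX : ∀ c, c * (border Y z x t).det = 0 → c = 0)

/-- The last column of the adjugate of a bordered matrix. -/
def lastCol (Y : Matrix ι ι S) (z : ι → S) : ι ⊕ Unit → S :=
  Sum.elim (-(Y.adjugate *ᵥ z)) (fun _ => Y.det)

theorem border_mulVec_lastCol : border Y z x t *ᵥ lastCol Y z =
    (border Y z x t).det • Pi.single (Sum.inr ()) 1 := by
  rw [lastCol, border_mulVec, det_border hY]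
  funext i
  rcases i with i | i
  · simp [mulVec_neg, mulVec_mulVec, mul_adjugate, smul_mulVec]
  · simp; ring

include hX

theorem adjugate_border_inr (i : ι ⊕ Unit) :
    (border Y z x t).adjugate i (Sum.inr ()) = lastCol Y z i := by
  have := eq_adjugate_mulVec hX (border_mulVec_lastCol hY)
  rw [mulVec_single_one] at this
  rw [this]; rfl

theorem adjugate_border_inr_left (i : ι ⊕ Unit) :
    (border Y z x t).adjugate (Sum.inr ()) i = lastCol Yᵀ x i := by
  have h1 : ∀ c, c * Yᵀ.det = 0 → c = 0 := by rwa [det_transpose]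
  have h2 : ∀ c, c * (border Yᵀ x z t).det = 0 → c = 0 := by
    rwa [← border_transpose, det_transpose]
  rw [← adjugate_border_inr h1 h2, ← border_transpose, ← adjugate_transpose]; rfl

end Regular

end Border

section Predicates

variable {S : Type*} [CommRing S] {ι : Type*}

/-- A matrix is alternating if it is skew-symmetric with zero diagonal. -/
def IsAlternating (D : Matrix ι ι S) : Prop :=
  Dᵀ = -D ∧ ∀ i, D i i = 0

theorem isAlternating_sub_transpose (U : Matrix ι ι S) : IsAlternating (U - Uᵀ) :=
  ⟨by simp, fun i => by simp⟩

theorem IsAlternating.exists_eq_sub [Finite ι] {D : Matrix ι ι S} (h : IsAlternating D) :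
    ∃ U : Matrix ι ι S, D = U - Uᵀ := by
  have := Fintype.ofFinite ι
  let e := Fintype.equivFin ι
  refine ⟨of fun i j => if e i < e j then D i j else 0, ?_⟩
  ext i j
  have h1 : D j i = - D i j := congrFun (congrFun h.1 i) j
  rcases lt_trichotomy (e i) (e j) with hij | hij | hij
  · simp [hij, hij.not_gt]
  · obtain rfl := e.injective hij
    simp [h.2]
  · simp [hij, hij.not_gt, h1]

variable [Fintype ι]

/-- The matrices `Xᵀ M + M' X`. -/
def IsBoundary (X B : Matrix ι ι S) : Prop :=
  ∃ M M', B = Xᵀ * M + M' * X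

theorem IsAlternating.dotProduct_mulVec {D : Matrix ι ι S} (h : IsAlternating D) (z : ι → S) :
    z ⬝ᵥ (D *ᵥ z) = 0 := by
  obtain ⟨U, rfl⟩ := h.exists_eq_sub
  rw [sub_mulVec, dotProduct_sub, mulVec_transpose, Matrix.dotProduct_mulVec, dotProduct_comm,
    dotProduct_comm z, sub_self]

variable [DecidableEq ι]

/-- Every `R`-linear map `L → L^∨` factors through a free module. -/
def HomFactorsThroughFree (X : Matrix ι ι S) : Prop :=
  ∀ M M', Xᵀ * M = M' * X → ∃ P Q, M = X.adjugateᵀ * P + Q * X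

/-- Every class in `Ext¹(L, L^∨)` is represented by an alternating matrix. -/
def HasAlternatingRepresentatives (X : Matrix ι ι S) : Prop :=
  ∀ B C, B * X.adjugate = Xᵀ * C → ∃ D, IsAlternating D ∧ IsBoundary X (B - D)

omit [DecidableEq ι] in
theorem transpose_mul_sub_transpose_mul_apply (A U : Matrix ι ι S) (r s : ι) :
    (Aᵀ * (U - Uᵀ) * A) r s = ∑ k, ∑ l, U k l * (A k r * A l s - A l r * A k s) := by
  have h1 : ∀ V : Matrix ι ι S, (Aᵀ * V * A) r s = ∑ k, ∑ l, V k l * (A k r * A l s) := by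
    intro V
    rw [mul_apply, Finset.sum_comm]
    refine Finset.sum_congr rfl fun l _ => ?_
    rw [mul_apply, Finset.sum_mul]
    refine Finset.sum_congr rfl fun k _ => ?_
    rw [transpose_apply]; ring
  rw [Matrix.mul_sub, Matrix.sub_mul, Matrix.sub_apply, h1, h1,
    Finset.sum_comm (f := fun k l => Uᵀ k l * (A k r * A l s)), ← Finset.sum_sub_distrib]
  refine Finset.sum_congr rfl fun k _ => ?_
  rw [← Finset.sum_sub_distrib]
  refine Finset.sum_congr rfl fun l _ => ?_
  rw [transpose_apply]; ring

theorem IsAlternating.exists_mul_adjugate {X D : Matrix ι ι S}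
    (hX : ∀ c, c * X.det = 0 → c = 0) (h : IsAlternating D) :
    ∃ C, IsAlternating C ∧ D * X.adjugate = Xᵀ * C := by
  obtain ⟨U, rfl⟩ := h.exists_eq_sub
  have key : ∀ r s, ∃ c, (X.adjugateᵀ * (U - Uᵀ) * X.adjugate) r s = X.det * c := by
    intro r s
    choose c hc using fun k l => adjugate_rank_one X k l r s
    refine ⟨∑ k, ∑ l, U k l * c k l, ?_⟩
    rw [transpose_mul_sub_transpose_mul_apply, Finset.mul_sum]
    refine Finset.sum_congr rfl fun k _ => ?_
    rw [Finset.mul_sum]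
    refine Finset.sum_congr rfl fun l _ => ?_
    linear_combination U k l * hc k l
  choose C hC using key
  have hC' : X.adjugateᵀ * (U - Uᵀ) * X.adjugate = X.det • of C := by
    ext r s; rw [hC]; rfl
  have halt : IsAlternating (X.adjugateᵀ * (U - Uᵀ) * X.adjugate) := by
    have : X.adjugateᵀ * (U - Uᵀ) * X.adjugate =
        X.adjugateᵀ * U * X.adjugate - (X.adjugateᵀ * U * X.adjugate)ᵀ := by
      simp only [transpose_mul, transpose_transpose, Matrix.mul_sub, Matrix.sub_mul,
        Matrix.mul_assoc]
    rw [this]; exact isAlternating_sub_transpose _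
  refine ⟨of C, ⟨?_, fun i => ?_⟩, ?_⟩
  · refine det_smul_cancel_matrix hX ?_
    rw [smul_neg, ← hC', ← halt.1, hC']
    rfl
  · have := halt.2 i
    rw [hC] at this
    exact hX _ (by rw [mul_comm]; exact this)
  · have hXt : ∀ c, c * Xᵀ.det = 0 → c = 0 := by rwa [det_transpose]
    refine eq_mul_of_adjugate hXt ?_
    rw [det_transpose, ← adjugate_transpose, ← hC', Matrix.mul_assoc]

end Predicates

section RankOne

variable {S : Type*} [CommRing S] {ι : Type*} [Fintype ι] [DecidableEq ι]

theorem adjugate_mul_mulVec_sub_mem (Y : Matrix ι ι S) (z : ι → S) (i j l : ι) :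
    Y.adjugate i j * (Y.adjugate *ᵥ z) l - Y.adjugate l j * (Y.adjugate *ᵥ z) i ∈
      Ideal.span {Y.det} := by
  simp only [mulVec, dotProduct, Finset.mul_sum]
  rw [← Finset.sum_sub_distrib]
  refine Ideal.sum_mem _ fun k _ => ?_
  obtain ⟨c, hc⟩ := adjugate_rank_one Y i l j k
  exact Ideal.mem_span_singleton'.2 ⟨c * z k, by linear_combination (- z k) * hc⟩

variable {Y : Matrix ι ι S} {z : ι → S}

theorem vecMul_adjugate_mem {l : ι}
    (hl : IsRegularModulo (Ideal.span {Y.det}) ((Y.adjugate *ᵥ z) l)) {p : ι → S}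
    (hp : p ⬝ᵥ (Y.adjugate *ᵥ z) ∈ Ideal.span {Y.det}) (j : ι) :
    (p ᵥ* Y.adjugate) j ∈ Ideal.span {Y.det} := by
  refine hl _ ?_
  have h1 : (p ᵥ* Y.adjugate) j * (Y.adjugate *ᵥ z) l =
      ∑ i, p i * (Y.adjugate i j * (Y.adjugate *ᵥ z) l - Y.adjugate l j * (Y.adjugate *ᵥ z) i) +
        Y.adjugate l j * (p ⬝ᵥ (Y.adjugate *ᵥ z)) := by
    simp only [vecMul, dotProduct, Finset.sum_mul, Finset.mul_sum]
    rw [← Finset.sum_add_distrib]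
    refine Finset.sum_congr rfl fun i _ => ?_
    ring
  rw [h1]
  exact Ideal.add_mem _ (Ideal.sum_mem _ fun i _ => Ideal.mul_mem_left _ _
    (adjugate_mul_mulVec_sub_mem Y z i j l)) (Ideal.mul_mem_left _ _ hp)

theorem exists_mul_adjugate_eq_smul {κ : Type*} {l : ι}
    (hl : IsRegularModulo (Ideal.span {Y.det}) ((Y.adjugate *ᵥ z) l)) {K : Matrix κ ι S}
    (hK : ∀ i, (K *ᵥ (Y.adjugate *ᵥ z)) i ∈ Ideal.span {Y.det}) :
    ∃ M : Matrix κ ι S, K * Y.adjugate = Y.det • M := by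
  choose M hM using fun i j => Ideal.mem_span_singleton'.1 (vecMul_adjugate_mem hl (hK i) j)
  refine ⟨of M, ?_⟩
  ext i j
  rw [Matrix.smul_apply, smul_eq_mul, mul_comm, of_apply, hM]
  rfl

theorem mem_span_lastCol_iff {a : S} : a ∈ Ideal.span (Set.range (lastCol Y z)) ↔
    ∃ k h, a = k ⬝ᵥ (Y.adjugate *ᵥ z) + Y.det * h := by
  rw [Ideal.mem_span_range_iff_exists_fun]
  constructor
  · rintro ⟨c, rfl⟩
    refine ⟨fun i => - c (Sum.inl i), c (Sum.inr ()), ?_⟩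
    simp [lastCol, dotProduct, mul_comm]
  · rintro ⟨k, h, rfl⟩
    refine ⟨Sum.elim (-k) fun _ => h, ?_⟩
    simp [lastCol, dotProduct, mul_comm]

theorem det_mem_span_lastCol : Y.det ∈ Ideal.span (Set.range (lastCol Y z)) :=
  Ideal.subset_span ⟨Sum.inr (), rfl⟩

theorem adjugate_mulVec_mem_span_lastCol (i : ι) :
    (Y.adjugate *ᵥ z) i ∈ Ideal.span (Set.range (lastCol Y z)) := by
  have : -(Y.adjugate *ᵥ z) i ∈ Ideal.span (Set.range (lastCol Y z)) :=
    Ideal.subset_span ⟨Sum.inl i, rfl⟩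
  simpa using Submodule.neg_mem _ this

theorem mulVec_lastCol_mem {κ : Type*} (K : Matrix κ (ι ⊕ Unit) S) (i : κ) :
    (K *ᵥ lastCol Y z) i ∈ Ideal.span (Set.range (lastCol Y z)) :=
  Ideal.sum_mem _ fun j _ => Ideal.mul_mem_left _ _ (Ideal.subset_span ⟨j, rfl⟩)

theorem mulVec_adjugate_mulVec_mem {κ : Type*} (K : Matrix κ ι S) (i : κ) :
    (K *ᵥ (Y.adjugate *ᵥ z)) i ∈ Ideal.span (Set.range (lastCol Y z)) :=
  Ideal.sum_mem _ fun j _ => Ideal.mul_mem_left _ _ (adjugate_mulVec_mem_span_lastCol j)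

theorem mulVec_mem {κ μ : Type*} [Fintype μ] {I : Ideal S} (K : Matrix κ μ S) {v : μ → S}
    (hv : ∀ i, v i ∈ I) (i : κ) : (K *ᵥ v) i ∈ I :=
  I.sum_mem fun j _ => I.mul_mem_left _ (hv j)

theorem exists_eq_mulVec_lastCol {κ : Type*} {v : κ → S}
    (hv : ∀ i, v i ∈ Ideal.span (Set.range (lastCol Y z))) :
    ∃ P : Matrix κ (ι ⊕ Unit) S, v = P *ᵥ lastCol Y z := by
  choose P hP using fun i => Ideal.mem_span_range_iff_exists_fun.1 (hv i)
  exact ⟨of P, funext fun i => (hP i).symm⟩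

theorem exists_eq_mulVec_add_smul {κ : Type*} {v : κ → S}
    (hv : ∀ i, v i ∈ Ideal.span (Set.range (lastCol Y z))) :
    ∃ (K : Matrix κ ι S) (h : κ → S), v = K *ᵥ (Y.adjugate *ᵥ z) + Y.det • h := by
  choose K h hK using fun i => mem_span_lastCol_iff.1 (hv i)
  exact ⟨of K, h, funext hK⟩

/-- If `X̄ᵀ`-stable homs factor, then `Aᵀ p ≡ 0` modulo `(det Y, adj Y z)` forces
`p` into the row space of `Y`. -/
theorem exists_sub_transpose_mulVec_mem (hY : ∀ c, c * Y.det = 0 → c = 0) {l : ι}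
    (hl : IsRegularModulo (Ideal.span {Y.det}) ((Y.adjugate *ᵥ z) l))
    (hH : HomFactorsThroughFree Y) {p : ι → S}
    (hp : ∀ i, (Y.adjugateᵀ *ᵥ p) i ∈ Ideal.span (Set.range (lastCol Y z))) :
    ∃ w, ∀ i, (p - Yᵀ *ᵥ w) i ∈ Ideal.span (Set.range (lastCol Y z)) := by
  have hYt : ∀ c, c * Yᵀ.det = 0 → c = 0 := by rwa [det_transpose]
  obtain ⟨K, h, hK⟩ := exists_eq_mulVec_add_smul hp
  have h1 : ∀ i, ((Yᵀ * K) *ᵥ (Y.adjugate *ᵥ z)) i ∈ Ideal.span {Y.det} := by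
    intro i
    have := congrArg (Yᵀ *ᵥ ·) hK
    simp only [mulVec_mulVec, adjugate_transpose, mul_adjugate, mulVec_add, mulVec_smul,
      det_transpose, smul_mulVec, one_mulVec] at this
    have h2 : ((Yᵀ * K) *ᵥ (Y.adjugate *ᵥ z)) i = (p i - (Yᵀ *ᵥ h) i) * Y.det := by
      have := congrFun this i
      simp only [Pi.add_apply, Pi.smul_apply, smul_eq_mul] at this
      rw [mulVec_mulVec, Matrix.mul_assoc]
      linear_combination -this
    rw [h2]
    exact Ideal.mem_span_singleton'.2 ⟨_, rfl⟩
  obtain ⟨M, hM⟩ := exists_mul_adjugate_eq_smul hl h1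
  have h2 : Yᵀ * K = M * Y := by
    refine det_smul_cancel_matrix hY ?_
    rw [← Matrix.smul_mul _ M, ← hM, Matrix.mul_assoc _ _ Y, adjugate_mul, Matrix.mul_smul,
      Matrix.mul_one]
  obtain ⟨P, Q, rfl⟩ := hH _ _ h2
  obtain ⟨w, hw⟩ : ∃ w, p - P *ᵥ (Y.adjugate *ᵥ z) = Yᵀ *ᵥ w := by
    refine ⟨Q *ᵥ z + h, eq_mulVec_of_adjugate hYt ?_⟩
    rw [← adjugate_transpose, mulVec_sub, hK, det_transpose]
    simp only [add_mulVec, mulVec_mulVec, Matrix.mul_assoc, mul_adjugate, Matrix.mul_smul,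
      Matrix.mul_one, smul_mulVec, smul_add, Matrix.add_mul]
    abel
  refine ⟨w, fun i => ?_⟩
  rw [← hw, sub_sub_cancel]
  exact mulVec_adjugate_mulVec_mem _ _

end RankOne

section BorderStep

variable {S : Type*} [CommRing S] {ι : Type*} [Fintype ι] [DecidableEq ι]
  {Y : Matrix ι ι S} {z x : ι → S} {t : S}

/-- Solvability of `p = Xᵀ w + P u`, where `X` is a bordered matrix and `u` is the last column of
its adjugate. -/
def BorderSolvable (Y : Matrix ι ι S) (z x : ι → S) (t : S) : Prop :=
  ∀ p : ι ⊕ Unit → S, (∀ i, ((border Y z x t).adjugateᵀ *ᵥ p) (Sum.inl i) ∈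
    Ideal.span (Set.range (lastCol Y z))) →
    ∃ w, ∀ i, (p - (border Y z x t)ᵀ *ᵥ w) i ∈ Ideal.span (Set.range (lastCol Y z))

theorem exists_eq_mul_border (hY : ∀ c, c * Y.det = 0 → c = 0) {l : ι}
    (hl : IsRegularModulo (Ideal.span {Y.det}) ((Y.adjugate *ᵥ z) l))
    {κ : Type*} {G : Matrix κ (ι ⊕ Unit) S} (hG : G *ᵥ lastCol Y z = 0) :
    ∃ Q : Matrix κ (ι ⊕ Unit) S, G = Q * border Y z x t := by
  have hYt : ∀ c, c * Yᵀ.det = 0 → c = 0 := by rwa [det_transpose]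
  have hp : ∀ i, (fun j => G i (Sum.inl j)) ⬝ᵥ (Y.adjugate *ᵥ z) =
      Y.det * G i (Sum.inr ()) := by
    intro i
    have := congrFun hG i
    simp only [mulVec, dotProduct, lastCol, Fintype.sum_sum_type, Sum.elim_inl, Sum.elim_inr,
      Pi.neg_apply, mul_neg, Finset.sum_neg_distrib, Finset.univ_unique,
      Finset.sum_singleton, PUnit.default_eq_unit, Pi.zero_apply] at this ⊢
    linear_combination -this
  choose w hw using fun i => fun j => Ideal.mem_span_singleton'.1 (vecMul_adjugate_mem hl
    (p := fun j => G i (Sum.inl j))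
    (by rw [hp]; exact Ideal.mul_mem_right _ _ (Ideal.mem_span_singleton_self _)) j)
  have h1 : ∀ i, (fun j => G i (Sum.inl j)) = Yᵀ *ᵥ w i := by
    intro i
    refine eq_mulVec_of_adjugate hYt ?_
    funext j
    rw [← adjugate_transpose, mulVec_transpose, ← hw, det_transpose]
    simp [mul_comm]
  have h2 : ∀ i, G i (Sum.inr ()) = z ⬝ᵥ w i := by
    intro i
    have := hp i
    rw [h1, mulVec_transpose, ← Matrix.dotProduct_mulVec, mulVec_mulVec, mul_adjugate, smul_mulVec,
      one_mulVec, dotProduct_smul, dotProduct_comm, smul_eq_mul] at this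
    exact (sub_eq_zero.1 (hY _ (by linear_combination this))).symm
  refine ⟨(of fun i => Sum.elim (w i) 0 : Matrix κ (ι ⊕ Unit) S), ?_⟩
  ext i (j | j)
  · have h3 : G i (Sum.inl j) = (Yᵀ *ᵥ w i) j := congrFun (h1 i) j
    rw [h3, Matrix.mul_apply, Fintype.sum_sum_type]
    simp [mulVec, dotProduct, mul_comm]
  · rw [h2, Matrix.mul_apply, Fintype.sum_sum_type]
    simp [dotProduct, mul_comm]

theorem homFactorsThroughFree_border (hY : ∀ c, c * Y.det = 0 → c = 0)
    (hX : ∀ c, c * (border Y z x t).det = 0 → c = 0) {l : ι}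
    (hl : IsRegularModulo (Ideal.span {Y.det}) ((Y.adjugate *ᵥ z) l))
    (hV : BorderSolvable Y z x t) : HomFactorsThroughFree (border Y z x t) := by
  intro M M' hM
  set X := border Y z x t with hXdef
  set u := lastCol Y z with hu
  have hXt : ∀ c, c * Xᵀ.det = 0 → c = 0 := by rwa [det_transpose]
  have hXu : X *ᵥ u = X.det • Pi.single (Sum.inr ()) 1 := border_mulVec_lastCol hY
  obtain ⟨p, hp⟩ : ∃ p, M'ᵀ *ᵥ u = X.adjugateᵀ *ᵥ p := by
    refine ⟨Mᵀ *ᵥ Pi.single (Sum.inr ()) 1, ?_⟩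
    rw [adjugate_transpose]
    refine eq_adjugate_mulVec hXt ?_
    have : Xᵀ * M'ᵀ = Mᵀ * X := by
      rw [← transpose_mul, ← hM, transpose_mul, transpose_transpose]
    rw [mulVec_mulVec, this, ← mulVec_mulVec, hXu, mulVec_smul, det_transpose]
  obtain ⟨w, hw⟩ := hV p fun i => by rw [← hXdef, ← hp]; exact mulVec_lastCol_mem _ _
  obtain ⟨P, hP⟩ := exists_eq_mulVec_lastCol hw
  rw [← hXdef, sub_eq_iff_eq_add] at hP
  have hG : (M'ᵀ - X.adjugateᵀ * P - vecMulVec w (X (Sum.inr ()))) *ᵥ u = 0 := by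
    have h1 : X (Sum.inr ()) ⬝ᵥ u = X.det := by
      have := congrFun hXu (Sum.inr ())
      simpa [mulVec] using this
    have h2 : vecMulVec w (X (Sum.inr ())) *ᵥ u = X.det • w := by
      rw [vecMulVec_mulVec, h1]
      funext i; simp [mul_comm]
    rw [sub_mulVec, sub_mulVec, hp, hP, h2, mulVec_add, mulVec_mulVec, mulVec_mulVec,
      adjugate_transpose, adjugate_mul, det_transpose, smul_mulVec, one_mulVec]
    abel
  obtain ⟨Q, hQ⟩ := exists_eq_mul_border (x := x) (t := t) hY hl hG
  rw [← hXdef] at hQ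
  have h3 : vecMulVec w (X (Sum.inr ())) = vecMulVec w (Pi.single (Sum.inr ()) 1) * X := by
    rw [vecMulVec_mul]
    congr 1
    funext j; simp
  obtain ⟨Q', hQ'⟩ : ∃ Q' : Matrix (ι ⊕ Unit) (ι ⊕ Unit) S, M'ᵀ = X.adjugateᵀ * P + Q' * X := by
    refine ⟨Q + vecMulVec w (Pi.single (Sum.inr ()) 1), ?_⟩
    rw [Matrix.add_mul, ← h3, ← hQ]; abel
  have h4 : M' = Pᵀ * X.adjugate + Xᵀ * Q'ᵀ := by
    rw [← transpose_transpose M', hQ']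
    simp [transpose_mul]
  refine ⟨Pᵀ, Q'ᵀ, ?_⟩
  have h5 : Xᵀ * M = Xᵀ.det • Pᵀ + Xᵀ * (Q'ᵀ * X) := by
    rw [hM, h4, Matrix.add_mul, Matrix.mul_assoc, adjugate_mul, det_transpose]
    simp [Matrix.mul_assoc]
  rw [← sub_eq_iff_eq_add, ← Matrix.mul_sub] at h5
  have h6 := eq_adjugate_mul hXt h5
  rw [sub_eq_iff_eq_add, ← adjugate_transpose] at h6
  exact h6

theorem hasAlternatingRepresentatives_border (hY : ∀ c, c * Y.det = 0 → c = 0)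
    (hX : ∀ c, c * (border Y z x t).det = 0 → c = 0) {l : ι}
    (hl : IsRegularModulo (Ideal.span {Y.det}) ((Y.adjugate *ᵥ z) l)) {l' : ι}
    (hl' : IsRegularModulo (Ideal.span (Set.range (lastCol Y z))) ((Y.adjugateᵀ *ᵥ x) l'))
    (hZ : HasAlternatingRepresentatives Y) :
    HasAlternatingRepresentatives (border Y z x t) := by
  intro B C hBC
  set X := border Y z x t with hXdef
  set u := lastCol Y z with hu
  set I := Ideal.span (Set.range u) with hI
  have hYt : ∀ c, c * Yᵀ.det = 0 → c = 0 := by rwa [det_transpose]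
  have hdet : Y.det ∈ I := det_mem_span_lastCol
  have hXt : Xᵀ = border Yᵀ x z t := border_transpose ..
  obtain ⟨c', c, hc⟩ : ∃ c' c, B *ᵥ u = Xᵀ *ᵥ Sum.elim c' fun _ : Unit => c := by
    refine ⟨fun i => C (Sum.inl i) (Sum.inr ()), C (Sum.inr ()) (Sum.inr ()), ?_⟩
    have h1 : X.adjugate *ᵥ Pi.single (Sum.inr ()) 1 = u := by
      rw [mulVec_single_one]; funext i; exact adjugate_border_inr hY hX i
    rw [← h1, mulVec_mulVec, hBC, ← mulVec_mulVec, mulVec_single_one]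
    congr 1
    funext i
    rcases i with i | i <;> rfl
  have hc1 : ∀ i, (Yᵀ *ᵥ c' + c • x) i ∈ I := by
    intro i
    have h1 := congrFun hc (Sum.inl i)
    rw [hXt, border_mulVec, Sum.elim_inl] at h1
    rw [← h1]; exact mulVec_lastCol_mem _ _
  have hcI : c ∈ I := by
    refine hl' _ ?_
    have h1 := mulVec_mem Y.adjugateᵀ hc1 l'
    rw [mulVec_add, mulVec_mulVec, adjugate_transpose, adjugate_mul, mulVec_smul, smul_mulVec,
      one_mulVec, det_transpose, ← adjugate_transpose] at h1
    simp only [Pi.add_apply, Pi.smul_apply, smul_eq_mul] at h1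
    exact (I.add_mem_iff_right (I.mul_mem_right _ hdet)).1 h1
  have hc2 : ∀ i, (Yᵀ *ᵥ c') i ∈ I := by
    intro i
    have h1 := hc1 i
    simp only [Pi.add_apply, Pi.smul_apply, smul_eq_mul] at h1
    exact (I.add_mem_iff_left (I.mul_mem_right _ hcI)).1 h1
  obtain ⟨K, h, hK⟩ := exists_eq_mulVec_add_smul hc2
  have hK1 : ∀ i, ((Y.adjugateᵀ * K) *ᵥ (Y.adjugate *ᵥ z)) i ∈ Ideal.span {Y.det} := by
    intro i
    have h1 := congrFun (congrArg (Y.adjugateᵀ *ᵥ ·) hK) i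
    simp only [mulVec_mulVec, adjugate_transpose, adjugate_mul, mulVec_add, mulVec_smul,
      smul_mulVec, one_mulVec, det_transpose, Pi.add_apply, Pi.smul_apply, smul_eq_mul] at h1
    rw [adjugate_transpose, mulVec_mulVec, Matrix.mul_assoc]
    refine Ideal.mem_span_singleton'.2 ⟨c' i - (Yᵀ.adjugate *ᵥ h) i, ?_⟩
    linear_combination h1
  obtain ⟨M₀, hM₀⟩ := exists_mul_adjugate_eq_smul hl hK1
  have hK2 : K * Y.adjugate = Yᵀ * M₀ := by
    refine eq_mul_of_adjugate hYt ?_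
    rw [← adjugate_transpose, ← Matrix.mul_assoc, hM₀, det_transpose]
  obtain ⟨D, hD, M, M', hKD⟩ := hZ _ _ hK2
  obtain ⟨CD, hCD, hDA⟩ := hD.exists_mul_adjugate hY
  rw [sub_eq_iff_eq_add'] at hKD
  set q := h + M' *ᵥ z with hq
  have hc' : c' = CD *ᵥ z + M *ᵥ (Y.adjugate *ᵥ z) + Y.adjugateᵀ *ᵥ q := by
    refine det_smul_cancel hYt ?_
    have h1 : Yᵀ *ᵥ c' = Yᵀ *ᵥ (CD *ᵥ z + M *ᵥ (Y.adjugate *ᵥ z) + Y.adjugateᵀ *ᵥ q) := by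
      rw [hK, hKD, hq]
      simp only [add_mulVec, mulVec_add, mulVec_mulVec, ← hDA, adjugate_transpose,
        mul_adjugate, det_transpose, Matrix.mul_assoc, Matrix.mul_smul, Matrix.mul_one,
        smul_mulVec, one_mulVec, Matrix.add_mul]
      rw [← Matrix.mul_assoc Yᵀ Yᵀ.adjugate, mul_adjugate, det_transpose]
      simp only [Matrix.smul_mul, Matrix.one_mul, smul_mulVec]
      abel
    have h2 := congrArg (Yᵀ.adjugate *ᵥ ·) h1
    simpa only [mulVec_mulVec, adjugate_mul, smul_mulVec, one_mulVec] using h2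
  set D' : Matrix (ι ⊕ Unit) (ι ⊕ Unit) S := border (-D) q (-q) 0 with hD'
  have hD'alt : IsAlternating D' := by
    refine ⟨?_, ?_⟩
    · rw [hD', border_transpose, transpose_neg, hD.1]
      ext (i | i) (j | j) <;> simp
    · rintro (i | i) <;> simp [hD', hD.2]
  have hD'u : D' *ᵥ u = Xᵀ *ᵥ Sum.elim (CD *ᵥ z + Y.adjugateᵀ *ᵥ q) fun _ => 0 := by
    rw [hD', hXt, hu, lastCol, border_mulVec, border_mulVec]
    have h1 : -D *ᵥ -(Y.adjugate *ᵥ z) + Y.det • q =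
        Yᵀ *ᵥ (CD *ᵥ z + Y.adjugateᵀ *ᵥ q) + (0 : S) • x := by
      simp only [neg_mulVec, mulVec_neg, neg_neg, mulVec_mulVec, mulVec_add, hDA, Matrix.neg_mul,
        adjugate_transpose, mul_adjugate, det_transpose, smul_mulVec, one_mulVec, zero_smul,
        add_zero]
    have h2 : -q ⬝ᵥ -(Y.adjugate *ᵥ z) + 0 * Y.det =
        z ⬝ᵥ (CD *ᵥ z + Y.adjugateᵀ *ᵥ q) + t * 0 := by
      rw [dotProduct_add, hCD.dotProduct_mulVec, mulVec_transpose, neg_dotProduct_neg,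
        Matrix.dotProduct_mulVec, dotProduct_comm z]
      ring
    rw [h1, h2]
  have hrem : ∀ i, Sum.elim (M *ᵥ (Y.adjugate *ᵥ z)) (fun _ : Unit => c) i ∈ I := by
    rintro (i | i)
    · exact mulVec_adjugate_mulVec_mem _ _
    · exact hcI
  obtain ⟨P, hP⟩ := exists_eq_mulVec_lastCol hrem
  have hG : (B - D' - Xᵀ * P) *ᵥ u = 0 := by
    rw [sub_mulVec, sub_mulVec, hc, hD'u, ← mulVec_mulVec, ← hP, ← mulVec_sub, ← mulVec_sub]
    convert mulVec_zero Xᵀ using 2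
    funext i
    rcases i with i | i
    · simp [hc']
    · simp
  obtain ⟨Q, hQ⟩ := exists_eq_mul_border (x := x) (t := t) hY hl hG
  exact ⟨D', hD'alt, P, Q, by rw [← hXdef] at hQ; rw [← hQ]; abel⟩

end BorderStep

section BorderPolynomial

open Polynomial

variable {B : Type*} [CommRing B] {ι : Type*} [Fintype ι] [DecidableEq ι]
  {Y : Matrix ι ι B} {z x : ι → B}

theorem adjugate_map_ringHom {S S' : Type*} [CommRing S] [CommRing S'] (f : S →+* S')
    (Y : Matrix ι ι S) : (Y.map f).adjugate = Y.adjugate.map f :=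
  (f.map_adjugate Y).symm

theorem det_map_ringHom {S S' : Type*} [CommRing S] [CommRing S'] (f : S →+* S')
    (Y : Matrix ι ι S) : (Y.map f).det = f Y.det :=
  (f.map_det Y).symm

theorem map_mulVec_comp {S S' : Type*} [CommRing S] [CommRing S'] (f : S →+* S') {κ : Type*}
    (M : Matrix κ ι S) (v : ι → S) : M.map f *ᵥ (f ∘ v) = f ∘ (M *ᵥ v) := by
  funext i
  exact (RingHom.map_mulVec f M v i).symm

theorem lastCol_map {S S' : Type*} [CommRing S] [CommRing S'] (f : S →+* S')
    (Y : Matrix ι ι S) (z : ι → S) : lastCol (Y.map f) (f ∘ z) = f ∘ lastCol Y z := by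
  rw [lastCol, lastCol, adjugate_map_ringHom, det_map_ringHom, map_mulVec_comp]
  funext i
  rcases i with i | i <;> simp

theorem span_lastCol_map {S S' : Type*} [CommRing S] [CommRing S'] (f : S →+* S')
    (Y : Matrix ι ι S) (z : ι → S) : Ideal.span (Set.range (lastCol (Y.map f) (f ∘ z))) =
      (Ideal.span (Set.range (lastCol Y z))).map f := by
  rw [lastCol_map, Ideal.map_span, Set.range_comp]

theorem regular_det_map (hY : ∀ c, c * Y.det = 0 → c = 0) :
    ∀ c, c * (Y.map (C : B →+* B[X])).det = 0 → c = 0 := by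
  rw [← IsRegularModulo.bot_iff, det_map_ringHom]
  have := (IsRegularModulo.bot_iff.2 hY).polynomial_C
  rwa [Ideal.map_bot] at this

theorem det_border_polynomial (hY : ∀ c, c * Y.det = 0 → c = 0) :
    (border (Y.map (C : B →+* B[X])) (C ∘ z) (C ∘ x) X).det =
      C Y.det * X + C (-(x ⬝ᵥ (Y.adjugate *ᵥ z))) := by
  rw [det_border (regular_det_map hY), det_map_ringHom, adjugate_map_ringHom, map_mulVec_comp,
    ← RingHom.map_dotProduct, C_neg]
  ring

theorem regular_det_border_polynomial (hY : ∀ c, c * Y.det = 0 → c = 0) :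
    ∀ c, c * (border (Y.map (C : B →+* B[X])) (C ∘ z) (C ∘ x) X).det = 0 → c = 0 := by
  rw [← IsRegularModulo.bot_iff, det_border_polynomial hY]
  have := (IsRegularModulo.bot_iff.2 hY).polynomial_linear (-(x ⬝ᵥ (Y.adjugate *ᵥ z)))
  rwa [Ideal.map_bot] at this

theorem borderSolvable_polynomial (hY : ∀ c, c * Y.det = 0 → c = 0) {l : ι}
    (hl : IsRegularModulo (Ideal.span {Y.det}) ((Y.adjugate *ᵥ z) l)) {l' : ι}
    (hl' : IsRegularModulo (Ideal.span (Set.range (lastCol Y z))) ((Y.adjugateᵀ *ᵥ x) l'))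
    (hH : HomFactorsThroughFree Y) :
    BorderSolvable (Y.map (C : B →+* B[X])) (C ∘ z) (C ∘ x) X := by
  have hY' := regular_det_map hY
  have hX' := regular_det_border_polynomial (z := z) (x := x) hY
  have hYt : ∀ c, c * (Y.map (C : B →+* B[X]))ᵀ.det = 0 → c = 0 := by rwa [det_transpose]
  unfold BorderSolvable
  rw [span_lastCol_map]
  set I₀ := Ideal.span (Set.range (lastCol Y z)) with hI₀
  set W := border (Y.map (C : B →+* B[X])) (C ∘ z) (C ∘ x) X with hW
  have hdet : W.det ∈ I₀.map (C : B →+* B[X]) := by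
    rw [hW, det_border_polynomial hY]
    refine Ideal.add_mem _ (Ideal.mul_mem_right _ _ (Ideal.mem_map_of_mem _ det_mem_span_lastCol))
      (Ideal.mem_map_of_mem _ (neg_mem ?_))
    exact I₀.sum_mem fun i _ => I₀.mul_mem_left _ (adjugate_mulVec_mem_span_lastCol i)
  have hadj : ∀ p i, ∃ b : ι → B, (W.adjugateᵀ *ᵥ p) (Sum.inl i) =
      ∑ j, (X * C (Y.adjugate j i) + C (b j)) * p (Sum.inl j) -
        C ((Y.adjugateᵀ *ᵥ x) i) * p (Sum.inr ()) := by
    intro p i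
    refine ⟨fun j => (border (Y.updateRow i (Pi.single j 1)) (Function.update z i 0) x 0).det, ?_⟩
    rw [mulVec, dotProduct, Fintype.sum_sum_type, Finset.univ_unique (α := Unit),
      Finset.sum_singleton, PUnit.default_eq_unit, sub_eq_add_neg]
    congr 1
    · refine Finset.sum_congr rfl fun j _ => ?_
      rw [transpose_apply, hW, adjugate_border_inl_inl, ← det_map_ringHom, border_map, adjugate_map_ringHom]
      congr 4
      · ext a c
        by_cases ha : a = i <;> by_cases hc : c = j <;>
          simp [updateRow_apply, ha, hc]
      · funext a
        by_cases ha : a = i <;> simp [ha]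
      · simp
    · rw [transpose_apply, hW]
      erw [adjugate_border_inr_left hY' hX']
      rw [lastCol, Sum.elim_inl, ← adjugate_transpose, adjugate_map_ringHom, ← transpose_map,
        map_mulVec_comp]
      simp
  have hsub : ∀ p w e : ι ⊕ Unit → B[X], (∀ i, e i ∈ I₀.map (C : B →+* B[X])) →
      (∀ i, (W.adjugateᵀ *ᵥ p) (Sum.inl i) ∈ I₀.map (C : B →+* B[X])) →
      ∀ i, (W.adjugateᵀ *ᵥ (p - Wᵀ *ᵥ w - e)) (Sum.inl i) ∈ I₀.map (C : B →+* B[X]) := by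
    intro p w e he hp i
    rw [mulVec_sub, mulVec_sub, mulVec_mulVec, adjugate_transpose, adjugate_mul, smul_mulVec,
      one_mulVec, det_transpose, ← adjugate_transpose]
    exact Ideal.sub_mem _ (Ideal.sub_mem _ (hp i) (Ideal.mul_mem_right _ _ hdet))
      (mulVec_mem _ he _)
  have htop : ∀ d (p : ι ⊕ Unit → B[X]), (∀ j, ∀ m, d < m → (p j).coeff m = 0) →
      (∀ i, (W.adjugateᵀ *ᵥ p) (Sum.inl i) ∈ I₀.map (C : B →+* B[X])) →
      ∃ w : ι → B, ∀ j, (p (Sum.inl j)).coeff d - (Yᵀ *ᵥ w) j ∈ I₀ := by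
    intro d p hd hp
    refine exists_sub_transpose_mulVec_mem (p := fun j => (p (Sum.inl j)).coeff d) hY hl hH ?_
    intro i
    obtain ⟨b, hb⟩ := hadj p i
    have h1 := Ideal.mem_map_C_iff.1 (hp i) (d + 1)
    rw [hb, coeff_sub, coeff_C_mul, hd _ _ (Nat.lt_succ_self d), mul_zero, sub_zero,
      finsetSum_coeff] at h1
    convert h1 using 1
    rw [mulVec, dotProduct]
    refine Finset.sum_congr rfl fun j _ => ?_
    rw [add_mul, coeff_add, coeff_C_mul, hd _ _ (Nat.lt_succ_self d), mul_zero, add_zero,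
      mul_assoc, coeff_X_mul, coeff_C_mul, transpose_apply]
  have main : ∀ d (p : ι ⊕ Unit → B[X]), (∀ j, ∀ m, d < m → (p j).coeff m = 0) →
      (∀ i, (W.adjugateᵀ *ᵥ p) (Sum.inl i) ∈ I₀.map (C : B →+* B[X])) →
      ∃ w, ∀ i, (p - Wᵀ *ᵥ w) i ∈ I₀.map (C : B →+* B[X]) := by
    intro d
    have hWt : Wᵀ = border (Yᵀ.map C) (C ∘ x) (C ∘ z) X := border_transpose ..
    induction d with
    | zero =>
      intro p hd hp
      obtain ⟨w, hw⟩ := htop 0 p hd hp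
      have hpC : ∀ j, p j = C ((p j).coeff 0) := fun j => by
        ext m
        rcases m with _ | m
        · simp
        · rw [hd j _ (Nat.succ_pos m)]; simp
      set w' : ι ⊕ Unit → B[X] := Sum.elim (C ∘ w) (fun _ => 0) with hw'
      have hinl : ∀ j, (p - Wᵀ *ᵥ w') (Sum.inl j) ∈ I₀.map (C : B →+* B[X]) := by
        intro j
        rw [hw', hWt, border_mulVec, map_mulVec_comp, Pi.sub_apply, hpC]
        simpa using Ideal.mem_map_of_mem (C : B →+* B[X]) (hw j)
      have hinr : (p - Wᵀ *ᵥ w') (Sum.inr ()) = C ((p (Sum.inr ())).coeff 0 - z ⬝ᵥ w) := by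
        rw [hw', hWt, border_mulVec, Pi.sub_apply, hpC, Sum.elim_inr, ← RingHom.map_dotProduct]
        simp
      refine ⟨w', ?_⟩
      rintro (j | j)
      · exact hinl j
      · have h1 := hsub p w' 0 (fun i => Ideal.zero_mem _) hp l'
        obtain ⟨b, hb⟩ := hadj (p - Wᵀ *ᵥ w' - 0) l'
        rw [hb, sub_zero] at h1
        have h2 := Ideal.sub_mem _ (Ideal.sum_mem _ fun j (_ : j ∈ Finset.univ) =>
          Ideal.mul_mem_left _ (X * C (Y.adjugate j l') + C (b j)) (hinl j)) h1
        rw [sub_sub_cancel] at h2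
        rw [hinr, ← C_mul] at h2
        have h3 := Ideal.mem_map_C_iff.1 h2 0
        rw [coeff_C_zero, mul_comm] at h3
        show (p - Wᵀ *ᵥ w') (Sum.inr ()) ∈ _
        rw [hinr]
        exact Ideal.mem_map_of_mem _ (hl' _ h3)
    | succ d ih =>
      intro p hd hp
      obtain ⟨w, hw⟩ := htop (d + 1) p hd hp
      set c := (p (Sum.inr ())).coeff (d + 1) - z ⬝ᵥ w with hc
      set w' : ι ⊕ Unit → B[X] := (X ^ d : B[X]) • Sum.elim ((X : B[X]) • (C ∘ w)) (fun _ => C c) with hw'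
      set e : ι ⊕ Unit → B[X] := Sum.elim (fun j => (X : B[X]) ^ (d + 1) *
        C ((p (Sum.inl j)).coeff (d + 1) - (Yᵀ *ᵥ w) j)) (fun _ => 0) with he
      have heI : ∀ i, e i ∈ I₀.map (C : B →+* B[X]) := by
        rintro (j | j)
        · exact Ideal.mul_mem_left _ _ (Ideal.mem_map_of_mem _ (hw j))
        · exact Ideal.zero_mem _
      have hinl : ∀ j, (p - Wᵀ *ᵥ w' - e) (Sum.inl j) =
          p (Sum.inl j) - C ((p (Sum.inl j)).coeff (d + 1)) * X ^ (d + 1) - C (c * x j) * X ^ d := by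
        intro j
        rw [hw', hWt, mulVec_smul, border_mulVec, mulVec_smul, map_mulVec_comp, he]
        simp only [Pi.sub_apply, Pi.smul_apply, Sum.elim_inl, Pi.add_apply, Function.comp_apply,
          C_sub, C_mul]
        simp only [smul_eq_mul]
        ring
      have hinr : (p - Wᵀ *ᵥ w' - e) (Sum.inr ()) =
          p (Sum.inr ()) - C ((p (Sum.inr ())).coeff (d + 1)) * X ^ (d + 1) := by
        rw [hw', hWt, mulVec_smul, border_mulVec, dotProduct_smul, ← RingHom.map_dotProduct, he, hc]
        simp only [Pi.sub_apply, Pi.smul_apply, Sum.elim_inr, C_sub]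
        simp only [smul_eq_mul]
        ring
      obtain ⟨w₃, hw₃⟩ := ih (p - Wᵀ *ᵥ w' - e) (by
        rintro (j | j) m hm
        · rw [hinl, coeff_sub, coeff_sub, coeff_C_mul_X_pow, coeff_C_mul_X_pow, if_neg hm.ne']
          split_ifs with h
          · rw [h]; simp
          · rw [hd _ _ (by omega)]; simp
        · show ((p - Wᵀ *ᵥ w' - e) (Sum.inr ())).coeff m = 0
          rw [hinr, coeff_sub, coeff_C_mul_X_pow]
          split_ifs with h
          · rw [h]; simp
          · rw [hd _ _ (by omega)]; simp) (hsub p w' e heI hp)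
      refine ⟨w' + w₃, fun i => ?_⟩
      have h1 : (p - Wᵀ *ᵥ (w' + w₃)) i = (p - Wᵀ *ᵥ w' - e - Wᵀ *ᵥ w₃) i + e i := by
        rw [mulVec_add]; simp only [Pi.sub_apply, Pi.add_apply]; ring
      rw [h1]
      exact Ideal.add_mem _ (hw₃ i) (heI i)
  intro p hp
  refine main (Finset.univ.sup fun j => (p j).natDegree) p (fun j m hm => ?_) hp
  exact coeff_eq_zero_of_natDegree_lt
    (lt_of_le_of_lt (Finset.le_sup (f := fun j => (p j).natDegree) (Finset.mem_univ j)) hm)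

/-- The inductive step: properties of `Y` pass to the bordered matrix with a new
indeterminate in the corner. -/
theorem border_polynomial_step (hY : ∀ c, c * Y.det = 0 → c = 0) {l : ι}
    (hl : IsRegularModulo (Ideal.span {Y.det}) ((Y.adjugate *ᵥ z) l)) {l' : ι}
    (hl' : IsRegularModulo (Ideal.span (Set.range (lastCol Y z))) ((Y.adjugateᵀ *ᵥ x) l'))
    (hH : HomFactorsThroughFree Y)
    (hZ : HasAlternatingRepresentatives (Y.map (C : B →+* B[X]))) :
    HomFactorsThroughFree (border (Y.map (C : B →+* B[X])) (C ∘ z) (C ∘ x) X) ∧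
    HasAlternatingRepresentatives (border (Y.map (C : B →+* B[X])) (C ∘ z) (C ∘ x) X) := by
  have hY' := regular_det_map hY
  have hX' := regular_det_border_polynomial (z := z) (x := x) hY
  have hlC : IsRegularModulo (Ideal.span {(Y.map (C : B →+* B[X])).det})
      (((Y.map (C : B →+* B[X])).adjugate *ᵥ (C ∘ z)) l) := by
    have := hl.polynomial_C
    rwa [Ideal.map_span, Set.image_singleton, ← det_map_ringHom, ← Function.comp_apply (f := C),
      ← map_mulVec_comp, ← adjugate_map_ringHom] at this
  have hlC' : IsRegularModulo (Ideal.span (Set.range (lastCol (Y.map (C : B →+* B[X])) (C ∘ z))))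
      (((Y.map (C : B →+* B[X])).adjugateᵀ *ᵥ (C ∘ x)) l') := by
    have := hl'.polynomial_C
    rwa [← span_lastCol_map, ← Function.comp_apply (f := C),
      ← map_mulVec_comp, transpose_map, ← adjugate_map_ringHom] at this
  exact ⟨homFactorsThroughFree_border hY' hX' hlC (borderSolvable_polynomial hY hl hl' hH),
    hasAlternatingRepresentatives_border hY' hX' hlC hlC' hZ⟩

end BorderPolynomial

section Transport

variable {S : Type*} [CommRing S] {ι : Type*} [Fintype ι] [DecidableEq ι]

theorem IsBoundary.zero (X : Matrix ι ι S) : IsBoundary X 0 := ⟨0, 0, by simp⟩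

theorem IsBoundary.add {X B B' : Matrix ι ι S} (h : IsBoundary X B) (h' : IsBoundary X B') :
    IsBoundary X (B + B') := by
  obtain ⟨M, N, rfl⟩ := h
  obtain ⟨M', N', rfl⟩ := h'
  exact ⟨M + M', N + N', by rw [Matrix.mul_add, Matrix.add_mul]; abel⟩

theorem IsBoundary.smul {X B : Matrix ι ι S} (h : IsBoundary X B) (a : S) :
    IsBoundary X (a • B) := by
  obtain ⟨M, N, rfl⟩ := h
  exact ⟨a • M, a • N, by rw [smul_add, Matrix.mul_smul, Matrix.smul_mul]⟩

theorem IsBoundary.map {X B : Matrix ι ι S} (h : IsBoundary X B) {S' : Type*} [CommRing S']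
    (f : S →+* S') : IsBoundary (X.map f) (B.map f) := by
  obtain ⟨M, N, rfl⟩ := h
  exact ⟨M.map f, N.map f, by
    rw [Matrix.map_add f (map_add f), Matrix.map_mul, Matrix.map_mul, transpose_map]⟩

theorem IsAlternating.map {D : Matrix ι ι S} (h : IsAlternating D) {S' : Type*} [CommRing S']
    (f : S →+* S') : IsAlternating (D.map f) := by
  refine ⟨?_, fun i => by simp [h.2 i]⟩
  ext i j
  have := congrFun (congrFun h.1 i) j
  simp only [transpose_apply, Matrix.neg_apply] at this
  simp [this]

theorem IsAlternating.zero : IsAlternating (0 : Matrix ι ι S) := ⟨by simp, by simp⟩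

theorem IsAlternating.add {D D' : Matrix ι ι S} (h : IsAlternating D) (h' : IsAlternating D') :
    IsAlternating (D + D') :=
  ⟨by rw [transpose_add, h.1, h'.1, neg_add], fun i => by simp [h.2 i, h'.2 i]⟩

theorem IsAlternating.smul {D : Matrix ι ι S} (h : IsAlternating D) (a : S) :
    IsAlternating (a • D) :=
  ⟨by rw [transpose_smul, h.1, smul_neg], fun i => by simp [h.2 i]⟩

section Basis

variable {S' : Type*} [CommRing S'] [Algebra S S'] {κ : Type*} (b : Module.Basis κ S S')

theorem Module.Basis.map_repr_mul (X : Matrix ι ι S) (M : Matrix ι ι S') (k : κ) :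
    (X.map (algebraMap S S') * M).map (fun a => b.repr a k) = X * M.map (fun a => b.repr a k) := by
  ext i j
  simp only [Matrix.mul_apply, Matrix.map_apply, map_sum, Finsupp.coe_finsetSum, Finset.sum_apply,
    ← Algebra.smul_def, map_smul, Finsupp.smul_apply, smul_eq_mul]

theorem Module.Basis.map_repr_mul' (X : Matrix ι ι S) (M : Matrix ι ι S') (k : κ) :
    (M * X.map (algebraMap S S')).map (fun a => b.repr a k) = M.map (fun a => b.repr a k) * X := by
  ext i j
  simp only [Matrix.mul_apply, Matrix.map_apply, map_sum, Finsupp.coe_finsetSum, Finset.sum_apply,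
    mul_comm _ (algebraMap S S' _), ← Algebra.smul_def, map_smul, Finsupp.smul_apply, smul_eq_mul]
  simp only [mul_comm]

theorem Module.Basis.matrix_induction {p : Matrix ι ι S' → Prop} (h0 : p 0)
    (hadd : ∀ M N, p M → p N → p (M + N)) (hsmul : ∀ (a : S') M, p M → p (a • M))
    (M : Matrix ι ι S') (h : ∀ k, p ((M.map (fun a => b.repr a k)).map (algebraMap S S'))) :
    p M := by
  classical
  have hM : M = ∑ k ∈ Finset.univ.biUnion fun i => Finset.univ.biUnion fun j =>
      (b.repr (M i j)).support,
      b k • (M.map (fun a => b.repr a k)).map (algebraMap S S') := by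
    ext i j
    rw [Matrix.sum_apply]
    simp only [Matrix.smul_apply, Matrix.map_apply, smul_eq_mul]
    conv_lhs => rw [← b.linearCombination_repr (M i j), Finsupp.linearCombination_apply,
      Finsupp.sum]
    simp only [Algebra.smul_def, mul_comm (b _)]
    refine Finset.sum_subset (fun k hk => ?_) fun k _ hk => ?_
    · simp only [Finset.mem_biUnion, Finset.mem_univ, true_and]
      exact ⟨i, j, hk⟩
    · rw [Finsupp.notMem_support_iff.1 hk]; simp
  rw [hM]
  exact Finset.sum_induction _ p hadd h0 fun k _ => hsmul _ _ (h k)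

include b in
theorem HomFactorsThroughFree.map_basis {X : Matrix ι ι S} (h : HomFactorsThroughFree X) :
    HomFactorsThroughFree (X.map (algebraMap S S')) := by
  intro M M' hM
  refine b.matrix_induction
    (p := fun M => ∃ P Q : Matrix ι ι S', M = (X.map (algebraMap S S')).adjugateᵀ * P +
      Q * X.map (algebraMap S S')) ⟨0, 0, by simp⟩ ?_ ?_ M fun k => ?_
  · rintro _ _ ⟨P, Q, rfl⟩ ⟨P', Q', rfl⟩
    exact ⟨P + P', Q + Q', by rw [Matrix.mul_add, Matrix.add_mul]; abel⟩
  · rintro a _ ⟨P, Q, rfl⟩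
    exact ⟨a • P, a • Q, by rw [smul_add, Matrix.mul_smul, Matrix.smul_mul]⟩
  · obtain ⟨P, Q, hPQ⟩ := h (M.map (fun a => b.repr a k)) (M'.map (fun a => b.repr a k)) (by
      rw [← b.map_repr_mul, transpose_map, hM, b.map_repr_mul'])
    refine ⟨P.map (algebraMap S S'), Q.map (algebraMap S S'), ?_⟩
    rw [hPQ, Matrix.map_add _ (map_add _), Matrix.map_mul, Matrix.map_mul, adjugate_map_ringHom,
      transpose_map]

include b in
theorem HasAlternatingRepresentatives.map_basis {X : Matrix ι ι S}
    (h : HasAlternatingRepresentatives X) :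
    HasAlternatingRepresentatives (X.map (algebraMap S S')) := by
  intro B C hBC
  refine b.matrix_induction (p := fun B => ∃ D : Matrix ι ι S', IsAlternating D ∧
    IsBoundary (X.map (algebraMap S S')) (B - D))
    ⟨0, .zero, by simpa using IsBoundary.zero _⟩ ?_ ?_ B fun k => ?_
  · rintro M N ⟨D, hD, hM⟩ ⟨D', hD', hN⟩
    exact ⟨D + D', hD.add hD', by rw [add_sub_add_comm]; exact hM.add hN⟩
  · rintro a M ⟨D, hD, hM⟩
    exact ⟨a • D, hD.smul a, by rw [← smul_sub]; exact hM.smul a⟩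
  · obtain ⟨D, hD, hB⟩ := h (B.map (fun a => b.repr a k)) (C.map (fun a => b.repr a k)) (by
      rw [← b.map_repr_mul, transpose_map, ← hBC, adjugate_map_ringHom, b.map_repr_mul'])
    refine ⟨D.map (algebraMap S S'), hD.map _, ?_⟩
    rw [← Matrix.map_sub _ (map_sub _)]
    exact hB.map _

end Basis

section Equiv

variable {S' : Type*} [CommRing S'] {κ : Type*} [Fintype κ] [DecidableEq κ]

theorem exists_map_submatrix_eq (e : S ≃+* S') (f : κ ≃ ι) (M : Matrix κ κ S') :
    ∃ N : Matrix ι ι S, (N.map e).submatrix f f = M :=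
  ⟨(M.submatrix f.symm f.symm).map e.symm, by ext; simp⟩

theorem map_submatrix_injective (e : S ≃+* S') (f : κ ≃ ι) {M N : Matrix ι ι S}
    (h : (M.map e).submatrix f f = (N.map e).submatrix f f) : M = N := by
  ext i j
  have := congrFun (congrFun h (f.symm i)) (f.symm j)
  simpa using this

theorem map_submatrix_mul (e : S ≃+* S') (f : κ ≃ ι) (M N : Matrix ι ι S) :
    ((M * N).map e).submatrix f f = (M.map e).submatrix f f * (N.map e).submatrix f f := by
  rw [submatrix_mul_equiv]
  congr 1
  exact Matrix.map_mul (f := (e : S →+* S'))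

theorem map_submatrix_adjugate (e : S ≃+* S') (f : κ ≃ ι) (M : Matrix ι ι S) :
    ((M.map e).submatrix f f).adjugate = (M.adjugate.map e).submatrix f f := by
  rw [adjugate_submatrix_equiv_self]
  congr 1
  exact adjugate_map_ringHom (e : S →+* S') M

theorem map_submatrix_add (e : S ≃+* S') (f : κ ≃ ι) (M N : Matrix ι ι S) :
    ((M + N).map e).submatrix f f = (M.map e).submatrix f f + (N.map e).submatrix f f := by
  ext; simp

theorem map_submatrix_sub (e : S ≃+* S') (f : κ ≃ ι) (M N : Matrix ι ι S) :
    ((M - N).map e).submatrix f f = (M.map e).submatrix f f - (N.map e).submatrix f f := by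
  ext; simp

theorem map_submatrix_transpose (e : S ≃+* S') (f : κ ≃ ι) (M : Matrix ι ι S) :
    ((Mᵀ).map e).submatrix f f = ((M.map e).submatrix f f)ᵀ := rfl

theorem map_submatrix_det (e : S ≃+* S') (f : κ ≃ ι) (M : Matrix ι ι S) :
    ((M.map e).submatrix f f).det = e M.det := by
  rw [det_submatrix_equiv_self]
  exact det_map_ringHom (e : S →+* S') M

theorem isBoundary_map_submatrix_iff (e : S ≃+* S') (f : κ ≃ ι) {X B : Matrix ι ι S} :
    IsBoundary ((X.map e).submatrix f f) ((B.map e).submatrix f f) ↔ IsBoundary X B := by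
  constructor
  · rintro ⟨M, N, h⟩
    obtain ⟨M, rfl⟩ := exists_map_submatrix_eq e f M
    obtain ⟨N, rfl⟩ := exists_map_submatrix_eq e f N
    refine ⟨M, N, map_submatrix_injective e f ?_⟩
    rw [h, map_submatrix_add, map_submatrix_mul, map_submatrix_mul, map_submatrix_transpose]
  · rintro ⟨M, N, rfl⟩
    exact ⟨_, _, by
      rw [map_submatrix_add, map_submatrix_mul, map_submatrix_mul, map_submatrix_transpose]⟩

theorem IsAlternating.map_submatrix (e : S ≃+* S') (f : κ ≃ ι) {D : Matrix ι ι S}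
    (h : IsAlternating D) : IsAlternating ((D.map e).submatrix f f) :=
  ⟨by ext i j; exact congrFun (congrFun (h.map (e : S →+* S')).1 (f i)) (f j),
    fun i => (h.map (e : S →+* S')).2 (f i)⟩

theorem HomFactorsThroughFree.map_submatrix (e : S ≃+* S') (f : κ ≃ ι) {X : Matrix ι ι S}
    (h : HomFactorsThroughFree X) : HomFactorsThroughFree ((X.map e).submatrix f f) := by
  intro M M' hM
  obtain ⟨M, rfl⟩ := exists_map_submatrix_eq e f M
  obtain ⟨M', rfl⟩ := exists_map_submatrix_eq e f M'
  rw [← map_submatrix_transpose, ← map_submatrix_mul, ← map_submatrix_mul] at hM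
  obtain ⟨P, Q, rfl⟩ := h M M' (map_submatrix_injective e f hM)
  exact ⟨_, _, by rw [map_submatrix_add, map_submatrix_mul, map_submatrix_mul,
    map_submatrix_transpose, map_submatrix_adjugate]⟩

theorem HasAlternatingRepresentatives.map_submatrix (e : S ≃+* S') (f : κ ≃ ι)
    {X : Matrix ι ι S} (h : HasAlternatingRepresentatives X) :
    HasAlternatingRepresentatives ((X.map e).submatrix f f) := by
  intro B C hB
  obtain ⟨B, rfl⟩ := exists_map_submatrix_eq e f B
  obtain ⟨C, rfl⟩ := exists_map_submatrix_eq e f C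
  rw [map_submatrix_adjugate, ← map_submatrix_transpose, ← map_submatrix_mul,
    ← map_submatrix_mul] at hB
  obtain ⟨D, hD, hBD⟩ := h B C (map_submatrix_injective e f hB)
  exact ⟨_, hD.map_submatrix e f, by
    rw [← map_submatrix_sub]; exact (isBoundary_map_submatrix_iff e f).2 hBD⟩

end Equiv

end Transport

section Regularity

variable {S : Type*} [CommRing S] {ι : Type*} [Fintype ι] [DecidableEq ι]

/-- The entries `(l, l')` and `(q, q')` of the adjugate form, together with the determinant, a
regular sequence (in several orders). -/
structure HasRegularEntries (X : Matrix ι ι S) (l l' q q' : ι) : Prop where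
  det : IsRegularModulo ⊥ X.det
  fst_bot : IsRegularModulo ⊥ (X.adjugate l l')
  fst : IsRegularModulo (Ideal.span {X.det}) (X.adjugate l l')
  snd : IsRegularModulo (Ideal.span {X.det}) (X.adjugate q q')
  snd_fst : IsRegularModulo (Ideal.span {X.det} ⊔ Ideal.span {X.adjugate l l'}) (X.adjugate q q')

theorem HasRegularEntries.map_submatrix {S' : Type*} [CommRing S'] {κ : Type*} [Fintype κ]
    [DecidableEq κ] (e : S ≃+* S') (f : κ ≃ ι) {X : Matrix ι ι S} {l l' q q' : ι}
    (h : HasRegularEntries X l l' q q') :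
    HasRegularEntries ((X.map e).submatrix f f) (f.symm l) (f.symm l') (f.symm q)
      (f.symm q') := by
  have h1 := h.det.map_equiv e
  have h2 := h.fst_bot.map_equiv e
  have h3 := h.fst.map_equiv e
  have h4 := h.snd.map_equiv e
  have h5 := h.snd_fst.map_equiv e
  simp only [Ideal.map_sup, Ideal.map_span, Set.image_singleton, Ideal.map_bot] at h1 h2 h3 h4 h5
  constructor <;> simp only [map_submatrix_det, map_submatrix_adjugate, submatrix_apply,
    Equiv.apply_symm_apply, Matrix.map_apply] <;> assumption

/-- Regularity of an entry of the adjugate modulo the ideal of the last column. -/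
theorem regular_adjugate_lastCol {Y : Matrix ι ι S} {z : ι → S} {l l' q : ι}
    (hY : ∀ c, c * Y.det = 0 → c = 0)
    (ha : IsRegularModulo (Ideal.span {Y.det}) (Y.adjugate l l'))
    (hq : IsRegularModulo (Ideal.span {Y.det} ⊔ Ideal.span {Y.adjugate l l'})
      ((Y.adjugate *ᵥ z) q)) :
    IsRegularModulo (Ideal.span (Set.range (lastCol Y z))) (Y.adjugate l l') := by
  intro c hc
  have hYt : ∀ c, c * Yᵀ.det = 0 → c = 0 := by rwa [det_transpose]
  set I := Ideal.span {Y.det} ⊔ Ideal.span {Y.adjugate l l'} with hI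
  obtain ⟨h, h₀, hh⟩ := mem_span_lastCol_iff.1 hc
  have hb : ∀ m, (h ᵥ* Y.adjugate) m ∈ I := by
    intro m
    refine hq _ ?_
    have h1 : (h ᵥ* Y.adjugate) m * (Y.adjugate *ᵥ z) q - Y.adjugate q m *
        (h ⬝ᵥ (Y.adjugate *ᵥ z)) ∈ Ideal.span {Y.det} := by
      rw [vecMul, dotProduct, dotProduct, Finset.sum_mul, Finset.mul_sum,
        ← Finset.sum_sub_distrib]
      refine Ideal.sum_mem _ fun i _ => ?_
      have := Ideal.mul_mem_left _ (h i) (adjugate_mul_mulVec_sub_mem Y z i m q)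
      convert this using 1; ring
    have h2 : Y.adjugate q m * (h ⬝ᵥ (Y.adjugate *ᵥ z)) ∈ I := by
      have h3 : h ⬝ᵥ (Y.adjugate *ᵥ z) = c * Y.adjugate l l' - Y.det * h₀ := by
        rw [hh]; ring
      rw [h3]
      exact I.mul_mem_left _ (I.sub_mem (I.mul_mem_left _ (Ideal.mem_sup_right
        (Ideal.mem_span_singleton_self _))) (I.mul_mem_right _ (Ideal.mem_sup_left
        (Ideal.mem_span_singleton_self _))))
    have := I.add_mem (Ideal.mem_sup_left h1 : _ ∈ I) h2
    rwa [sub_add_cancel] at this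
  have hb' : ∀ m, ∃ u v, (h ᵥ* Y.adjugate) m = Y.det * u + Y.adjugate l l' * v := by
    intro m
    obtain ⟨a, ha, b, hb, hab⟩ := Submodule.mem_sup.1 (hb m)
    obtain ⟨u, rfl⟩ := Ideal.mem_span_singleton.1 ha
    obtain ⟨v, rfl⟩ := Ideal.mem_span_singleton.1 hb
    exact ⟨u, v, hab.symm⟩
  choose u v huv using hb'
  have huv' : h ᵥ* Y.adjugate = Y.det • u + Y.adjugate l l' • v := funext huv
  have hv : ∀ i, ∃ w, (Yᵀ *ᵥ v) i = Y.det * w := by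
    intro i
    refine Ideal.mem_span_singleton.1 (ha _ ?_)
    have h1 := congrArg (fun p => (p ᵥ* Y) i) huv'
    simp only [vecMul_vecMul, adjugate_mul, vecMul_smul, vecMul_one, add_vecMul, smul_vecMul,
      Pi.add_apply, Pi.smul_apply, smul_eq_mul] at h1
    rw [mulVec_transpose]
    refine Ideal.mem_span_singleton'.2 ⟨h i - (u ᵥ* Y) i, ?_⟩
    linear_combination h1
  choose w hw using hv
  have hvw : v = Yᵀ.adjugate *ᵥ w := eq_adjugate_mulVec hYt (by
    rw [det_transpose]; exact funext hw)
  have h4 : c - v ⬝ᵥ z ∈ Ideal.span {Y.det} := by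
    refine ha _ ?_
    have h5 : h ⬝ᵥ (Y.adjugate *ᵥ z) = Y.det * (u ⬝ᵥ z) + Y.adjugate l l' * (v ⬝ᵥ z) := by
      rw [Matrix.dotProduct_mulVec, huv', add_dotProduct, smul_dotProduct, smul_dotProduct, smul_eq_mul,
        smul_eq_mul]
    refine Ideal.mem_span_singleton'.2 ⟨u ⬝ᵥ z + h₀, ?_⟩
    linear_combination -h5 - hh
  have h6 : v ⬝ᵥ z = w ⬝ᵥ (Y.adjugate *ᵥ z) := by
    rw [hvw, ← adjugate_transpose, mulVec_transpose, Matrix.dotProduct_mulVec]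
  rw [← sub_add_cancel c (v ⬝ᵥ z), h6]
  rw [h6] at h4
  refine Ideal.add_mem _ ((Ideal.span_singleton_le_iff_mem _).2 det_mem_span_lastCol h4) ?_
  exact Ideal.sum_mem _ fun i _ => Ideal.mul_mem_left _ _ (adjugate_mulVec_mem_span_lastCol i)

end Regularity

section GenericStep

variable {k : Type*} [CommRing k] {ι : Type*} [Fintype ι] [DecidableEq ι]

open MvPolynomial in
/-- Homological properties of a matrix bordered by a row of indeterminates and an indeterminate
in the corner. -/
theorem border_generic_row {B : Type*} [CommRing B] {Y : Matrix ι ι B} {v : ι → B} {l l' q : ι}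
    (hY : ∀ c, c * Y.det = 0 → c = 0)
    (hv : IsRegularModulo (Ideal.span {Y.det}) ((Y.adjugate *ᵥ v) q))
    (ha : IsRegularModulo (Ideal.span (Set.range (lastCol Y v))) (Y.adjugate l l'))
    (hH : HomFactorsThroughFree Y) (hZ : HasAlternatingRepresentatives Y) :
    HomFactorsThroughFree (border ((Y.map (C : B →+* MvPolynomial ι B)).map Polynomial.C)
      (Polynomial.C ∘ C ∘ v) (Polynomial.C ∘ X) Polynomial.X) ∧
    HasAlternatingRepresentatives (border ((Y.map (C : B →+* MvPolynomial ι B)).map Polynomial.C)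
      (Polynomial.C ∘ C ∘ v) (Polynomial.C ∘ X) Polynomial.X) := by
  have hY₂ : ∀ c, c * (Y.map (C : B →+* MvPolynomial ι B)).det = 0 → c = 0 := by
    rw [← IsRegularModulo.bot_iff, det_map_ringHom]
    have := (IsRegularModulo.bot_iff.2 hY).mvPolynomial_C (σ := ι)
    rwa [Ideal.map_bot] at this
  refine border_polynomial_step hY₂ (l := q) ?_ (l' := l') ?_ ?_ ?_
  · have := hv.mvPolynomial_C (σ := ι)
    rwa [Ideal.map_span, Set.image_singleton, ← det_map_ringHom, ← Function.comp_apply (f := C),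
      ← map_mulVec_comp, ← adjugate_map_ringHom] at this
  · rw [span_lastCol_map]
    convert ha.mvPolynomial_linear (a := fun i => Y.adjugate i l') (j := l) using 1
    rw [adjugate_map_ringHom]
    rfl
  · exact hH.map_basis (basisMonomials ι B)
  · exact (hZ.map_basis (basisMonomials ι B)).map_basis (Polynomial.basisMonomials _)

open MvPolynomial in
theorem exists_towerEquiv (k : Type*) [CommRing k] (ι : Type*) :
    ∃ e : Polynomial (MvPolynomial ι (MvPolynomial ι (MvPolynomial (ι × ι) k))) ≃+*
      MvPolynomial ((ι ⊕ Unit) × (ι ⊕ Unit)) k,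
      (border ((((mvPolynomialX ι ι k).map C).map C).map Polynomial.C)
        (Polynomial.C ∘ C ∘ X) (Polynomial.C ∘ X) Polynomial.X).map e =
        mvPolynomialX (ι ⊕ Unit) (ι ⊕ Unit) k := by
  let F : Polynomial (MvPolynomial ι (MvPolynomial ι (MvPolynomial (ι × ι) k))) →+*
      MvPolynomial ((ι ⊕ Unit) × (ι ⊕ Unit)) k :=
    Polynomial.eval₂RingHom (eval₂Hom (eval₂Hom (eval₂Hom C
      (fun p => X (Sum.inl p.1, Sum.inl p.2))) (fun i => X (Sum.inl i, Sum.inr ())))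
      (fun i => X (Sum.inr (), Sum.inl i))) (X (Sum.inr (), Sum.inr ()))
  let G : MvPolynomial ((ι ⊕ Unit) × (ι ⊕ Unit)) k →+*
      Polynomial (MvPolynomial ι (MvPolynomial ι (MvPolynomial (ι × ι) k))) :=
    eval₂Hom (Polynomial.C.comp (C.comp (C.comp C))) fun p =>
      border ((((mvPolynomialX ι ι k).map C).map C).map Polynomial.C)
        (Polynomial.C ∘ C ∘ X) (Polynomial.C ∘ X) Polynomial.X p.1 p.2
  refine ⟨RingEquiv.ofRingHom F G ?_ ?_, ?_⟩
  · refine MvPolynomial.ringHom_ext (fun r => ?_) ?_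
    · simp [F, G]
    · rintro ⟨i | i, j | j⟩ <;> simp [F, G]
  · refine Polynomial.ringHom_ext' (MvPolynomial.ringHom_ext' (MvPolynomial.ringHom_ext'
      (MvPolynomial.ringHom_ext' ?_ ?_) ?_) ?_) ?_
    · ext; simp [F, G]
    all_goals intros; simp [F, G]
  · ext1 i j
    rcases i with i | i <;> rcases j with j | j <;> simp [F]

open Polynomial in
theorem exists_adjugate_border_polynomial {B : Type*} [CommRing B] (Y : Matrix ι ι B)
    (z x : ι → B) (l l' : ι) :
    ∃ b, (border (Y.map C) (C ∘ z) (C ∘ x) X).adjugate (Sum.inl l) (Sum.inl l') =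
      C (Y.adjugate l l') * X + C b := by
  refine ⟨(border (Y.updateRow l' (Pi.single l 1)) (Function.update z l' 0) x 0).det, ?_⟩
  rw [adjugate_border_inl_inl, ← det_map_ringHom, border_map, adjugate_map_ringHom, mul_comm]
  congr 3
  · ext a c
    by_cases ha : a = l' <;> by_cases hc : c = l <;> simp [updateRow_apply, ha, hc]
  · funext a
    by_cases ha : a = l' <;> simp [ha]
  · simp

open Polynomial in
theorem hasRegularEntries_border_polynomial {B : Type*} [CommRing B] {Y : Matrix ι ι B}
    {z x : ι → B} {l l' : ι} (hY : IsRegularModulo ⊥ Y.det)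
    (hz₀ : IsRegularModulo ⊥ ((Y.adjugate *ᵥ z) l))
    (hz₁ : IsRegularModulo (Ideal.span {Y.det}) ((Y.adjugate *ᵥ z) l))
    (hx₀ : IsRegularModulo ⊥ ((Y.adjugateᵀ *ᵥ x) l'))
    (hx₁ : IsRegularModulo (Ideal.span {Y.det}) ((Y.adjugateᵀ *ᵥ x) l'))
    (hρ : IsRegularModulo (Ideal.span {Y.det}) (x ⬝ᵥ (Y.adjugate *ᵥ z)))
    (ha : IsRegularModulo (Ideal.span {Y.det} ⊔ Ideal.span {x ⬝ᵥ (Y.adjugate *ᵥ z)})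
      (Y.adjugate l l')) :
    HasRegularEntries (border (Y.map C) (C ∘ z) (C ∘ x) X) (Sum.inr ()) (Sum.inr ())
      (Sum.inl l) (Sum.inl l') := by
  set ρ := x ⬝ᵥ (Y.adjugate *ᵥ z) with hρdef
  set W := border (Y.map C) (C ∘ z) (C ∘ x) X with hW
  have hY' := IsRegularModulo.bot_iff.1 hY
  have hD : W.det = C Y.det * X + C (-ρ) := det_border_polynomial hY'
  have hWreg : IsRegularModulo ⊥ W.det :=
    IsRegularModulo.bot_iff.2 (regular_det_border_polynomial hY')
  have hWreg' := IsRegularModulo.bot_iff.1 hWreg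
  have hdC : (Y.map C).det = C Y.det := det_map_ringHom _ _
  have hcorner : W.adjugate (Sum.inr ()) (Sum.inr ()) = C Y.det := by
    rw [hW, adjugate_border_inr (regular_det_map hY') hWreg', ← hdC]; rfl
  have hcol : W.adjugate (Sum.inl l) (Sum.inr ()) = C (-((Y.adjugate *ᵥ z) l)) := by
    rw [hW, adjugate_border_inr (regular_det_map hY') hWreg', lastCol_map, lastCol]; rfl
  have hrow : W.adjugate (Sum.inr ()) (Sum.inl l') = C (-((Y.adjugateᵀ *ᵥ x) l')) := by
    rw [hW, adjugate_border_inr_left (regular_det_map hY') hWreg', ← transpose_map, lastCol_map,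
      lastCol, ← adjugate_transpose]; rfl
  obtain ⟨b, hb⟩ : ∃ b, W.adjugate (Sum.inl l) (Sum.inl l') = C (Y.adjugate l l') * X + C b :=
    exists_adjugate_border_polynomial _ _ _ _ _
  have hleadD : ∀ {I : Ideal B}, IsRegularModulo I Y.det →
      IsRegularModulo (I.map C) W.det := fun hI => by
    rw [hD]; exact hI.polynomial_linear _
  have hsingle : ∀ {u : B}, IsRegularModulo ⊥ u → IsRegularModulo (Ideal.span {Y.det}) u →
      IsRegularModulo (Ideal.span {W.det}) (C (-u)) := by
    intro u h0 h1
    have h2 : IsRegularModulo (Ideal.span {u}) Y.det := by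
      have := IsRegularModulo.swap (I := ⊥) hY (a := u) (by rwa [bot_sup_eq])
      rwa [bot_sup_eq] at this
    have h3 := hleadD h2
    rw [Ideal.map_span, Set.image_singleton] at h3
    have h4 := h0.polynomial_C
    rw [Ideal.map_bot] at h4
    have := IsRegularModulo.swap (I := ⊥) h4 (a := W.det) (by rwa [bot_sup_eq])
    rw [bot_sup_eq] at this
    rw [C_neg]
    exact this.neg
  have hcorner₀ : IsRegularModulo ⊥ (C Y.det) := by
    have := hY.polynomial_C; rwa [Ideal.map_bot] at this
  have hDρ : Ideal.span {W.det} ⊔ Ideal.span {C Y.det} =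
      (Ideal.span {Y.det} ⊔ Ideal.span {ρ}).map C := by
    rw [Ideal.map_sup, Ideal.map_span, Ideal.map_span, Set.image_singleton, Set.image_singleton]
    have hmem : ∀ u v w : B[X], w * u - v ∈ Ideal.span {u} ⊔ Ideal.span {v} := fun u v w =>
      Ideal.sub_mem _ (Ideal.mul_mem_left _ _ (Ideal.mem_sup_left
        (Ideal.mem_span_singleton_self _)))
        (Ideal.mem_sup_right (Ideal.mem_span_singleton_self _))
    refine le_antisymm (sup_le ?_ le_sup_left) (sup_le le_sup_right ?_)
    · rw [Ideal.span_singleton_le_iff_mem, hD, mul_comm, C_neg, ← sub_eq_add_neg]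
      exact hmem _ _ _
    · rw [Ideal.span_singleton_le_iff_mem, sup_comm]
      have := hmem (C Y.det) W.det X
      convert this using 1
      rw [hD, C_neg]; ring
  refine ⟨hWreg, by rwa [hcorner], ?_, ?_, ?_⟩
  · rw [hcorner]
    have := IsRegularModulo.swap (I := ⊥) hcorner₀ (a := W.det) (by
      rw [bot_sup_eq]
      have := hρ.polynomial_C.neg
      rw [Ideal.map_span, Set.image_singleton] at this
      refine this.congr ?_
      rw [hD, C_neg, Ideal.mem_span_singleton]
      exact ⟨-X, by ring⟩)
    rwa [bot_sup_eq] at this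
  · obtain ⟨c, hc⟩ := adjugate_rank_one W (Sum.inr ()) (Sum.inl l) (Sum.inr ()) (Sum.inl l')
    have h1 : IsRegularModulo (Ideal.span {W.det})
        (W.adjugate (Sum.inl l) (Sum.inr ()) * W.adjugate (Sum.inr ()) (Sum.inl l')) := by
      rw [hcol, hrow]
      exact (hsingle hz₀ hz₁).mul (hsingle hx₀ hx₁)
    refine (h1.congr (b := W.adjugate (Sum.inl l) (Sum.inl l') *
      W.adjugate (Sum.inr ()) (Sum.inr ())) ?_).of_mul_left
    exact Ideal.mem_span_singleton'.2 ⟨-c, by linear_combination hc⟩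
  · rw [hcorner, hDρ, hb]
    exact ha.polynomial_linear _

open MvPolynomial in
/-- The entries `(inr, inr)` and `(l, l')` of the adjugate of the bordered generic matrix form a
regular sequence together with the determinant. -/
theorem HasRegularEntries.border_generic {Y : Matrix ι ι k} {l l' q q' : ι}
    (h : HasRegularEntries Y l l' q q') :
    HasRegularEntries (border (((Y.map (C : k →+* MvPolynomial ι k)).map
      (C : _ →+* MvPolynomial ι (MvPolynomial ι k))).map Polynomial.C)
        (Polynomial.C ∘ C ∘ X) (Polynomial.C ∘ X) Polynomial.X)
      (Sum.inr ()) (Sum.inr ()) (Sum.inl l) (Sum.inl l') := by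
  set Y₁ := Y.map (C : k →+* MvPolynomial ι k) with hY₁
  set Y₂ := Y₁.map (C : _ →+* MvPolynomial ι (MvPolynomial ι k)) with hY₂
  set ζ := Y₁.adjugate *ᵥ X with hζ
  set ξ := Y₂.adjugateᵀ *ᵥ X with hξ
  set ρ := X ⬝ᵥ (Y₂.adjugate *ᵥ (C ∘ X)) with hρ
  have hd₁ : Y₁.det = C Y.det := det_map_ringHom _ _
  have hd₂ : Y₂.det = C Y₁.det := det_map_ringHom _ _
  have ha₁ : ∀ i j, Y₁.adjugate i j = C (Y.adjugate i j) := fun i j => by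
    rw [hY₁, adjugate_map_ringHom]; rfl
  have ha₂ : ∀ i j, Y₂.adjugate i j = C (Y₁.adjugate i j) := fun i j => by
    rw [hY₂, adjugate_map_ringHom]; rfl
  have hζreg : ∀ {I : Ideal k} {i j}, IsRegularModulo I (Y.adjugate i j) →
      IsRegularModulo (I.map (C : k →+* MvPolynomial ι k)) (ζ i) := fun {I i j} hI => by
    convert hI.mvPolynomial_linear (a := fun j => Y.adjugate i j) (j := j) using 1
    simp only [hζ, mulVec, dotProduct, ha₁]
  have hξreg : ∀ {I : Ideal (MvPolynomial ι k)} {i j}, IsRegularModulo I (Y₁.adjugate i j) →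
      IsRegularModulo (I.map (C : _ →+* MvPolynomial ι (MvPolynomial ι k))) (ξ j) :=
    fun {I i j} hI => by
      convert hI.mvPolynomial_linear (a := fun i => Y₁.adjugate i j) (j := i) using 1
      simp only [hξ, mulVec, dotProduct, ha₂, transpose_apply]
  have hζC : Y₂.adjugate *ᵥ (C ∘ X) = C ∘ ζ := by
    rw [hY₂, adjugate_map_ringHom, map_mulVec_comp]
  have hρreg : ∀ {I : Ideal (MvPolynomial ι k)} {i}, IsRegularModulo I (ζ i) →
      IsRegularModulo (I.map (C : _ →+* MvPolynomial ι (MvPolynomial ι k))) ρ :=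
    fun {I i} hI => by
      convert hI.mvPolynomial_linear (a := ζ) (j := i) using 1
      simp only [hρ, hζC, dotProduct, Function.comp_apply, mul_comm]
  have hreg₁ : IsRegularModulo ⊥ Y₁.det := by
    have := h.det.mvPolynomial_C (σ := ι)
    rwa [Ideal.map_bot, ← hd₁] at this
  have hreg₂ : IsRegularModulo ⊥ Y₂.det := by
    have := hreg₁.mvPolynomial_C (σ := ι)
    rwa [Ideal.map_bot, ← hd₂] at this
  have hspan₁ : (Ideal.span {Y.det}).map (C : k →+* MvPolynomial ι k) = Ideal.span {Y₁.det} := by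
    rw [Ideal.map_span, Set.image_singleton, hd₁]
  have hspan₂ : (Ideal.span {Y₁.det}).map (C : _ →+* MvPolynomial ι (MvPolynomial ι k)) =
      Ideal.span {Y₂.det} := by
    rw [Ideal.map_span, Set.image_singleton, hd₂]
  have hζ₀ : IsRegularModulo ⊥ (ζ l) := by
    have := hζreg h.fst_bot; rwa [Ideal.map_bot] at this
  have hζ₁ : IsRegularModulo (Ideal.span {Y₁.det}) (ζ l) := by
    have := hζreg h.fst; rwa [hspan₁] at this
  have ha₁₀ : IsRegularModulo ⊥ (Y₁.adjugate l l') := by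
    have := h.fst_bot.mvPolynomial_C (σ := ι)
    rwa [Ideal.map_bot, ← ha₁] at this
  have ha₁₁ : IsRegularModulo (Ideal.span {Y₁.det}) (Y₁.adjugate l l') := by
    have := h.fst.mvPolynomial_C (σ := ι)
    rwa [hspan₁, ← ha₁] at this
  have ha₂₁ : IsRegularModulo (Ideal.span {Y₂.det}) (Y₂.adjugate l l') := by
    have := ha₁₁.mvPolynomial_C (σ := ι)
    rwa [hspan₂, ← ha₂] at this
  have hρ₁ : IsRegularModulo (Ideal.span {Y₂.det}) ρ := by
    have := hρreg hζ₁; rwa [hspan₂] at this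
  have hζl : (Y₂.adjugate *ᵥ (C ∘ X)) l = C (ζ l) := congrFun hζC l
  refine hasRegularEntries_border_polynomial hreg₂ ?_ ?_ ?_ ?_ hρ₁ ?_
  · rw [hζl]
    have := hζ₀.mvPolynomial_C (σ := ι); rwa [Ideal.map_bot] at this
  · rw [hζl]
    have := hζ₁.mvPolynomial_C (σ := ι); rwa [hspan₂] at this
  · have := hξreg ha₁₀; rwa [Ideal.map_bot] at this
  · have := hξreg ha₁₁; rwa [hspan₂] at this
  · refine ha₂₁.swap ?_
    have h1 := hρreg (hζreg h.snd_fst)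
    simpa only [Ideal.map_sup, hspan₁, hspan₂, Ideal.map_span, Set.image_singleton, ← ha₁, ← ha₂]
      using h1

/-- The properties of the generic matrix used below. -/
structure IsGood {S : Type*} [CommRing S] (X : Matrix ι ι S) : Prop where
  regular : ∃ l l' q q', HasRegularEntries X l l' q q' ∧ (Nontrivial ι → l' ≠ q')
  homFactors : HomFactorsThroughFree X
  alternating : HasAlternatingRepresentatives X

theorem IsGood.map_submatrix {S S' : Type*} [CommRing S] [CommRing S'] {κ : Type*} [Fintype κ]
    [DecidableEq κ] (e : S ≃+* S') (f : κ ≃ ι) {X : Matrix ι ι S} (h : IsGood X) :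
    IsGood ((X.map e).submatrix f f) := by
  obtain ⟨l, l', q, q', hr, hne⟩ := h.regular
  refine ⟨⟨_, _, _, _, hr.map_submatrix e f, fun hn => ?_⟩, h.2.map_submatrix e f,
    h.3.map_submatrix e f⟩
  exact fun h => hne f.symm.nontrivial (f.symm.injective h)

open MvPolynomial in
/-- Regularity of the entries of `adj(Y) z` for a vector of indeterminates `z`, some of which may
be specialized to `0`. -/
theorem HasRegularEntries.mulVec_update {Y : Matrix ι ι k} {l l' q q' : ι}
    (h : HasRegularEntries Y l l' q q') {v : ι → MvPolynomial ι k} {s : Finset ι} (hq : q' ∈ s)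
    (hv : ∀ i, v i = if i ∈ s then X i else 0) :
    (∀ c, c * (Y.map (C : k →+* MvPolynomial ι k)).det = 0 → c = 0) ∧
    IsRegularModulo (Ideal.span {(Y.map (C : k →+* MvPolynomial ι k)).det})
      (((Y.map (C : k →+* MvPolynomial ι k)).adjugate *ᵥ v) q) ∧
    IsRegularModulo (Ideal.span (Set.range (lastCol (Y.map (C : k →+* MvPolynomial ι k)) v)))
      ((Y.map (C : k →+* MvPolynomial ι k)).adjugate l l') := by
  set Y₁ := Y.map (C : k →+* MvPolynomial ι k) with hY₁
  have hd₁ : Y₁.det = C Y.det := det_map_ringHom _ _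
  have ha₁ : ∀ i j, Y₁.adjugate i j = C (Y.adjugate i j) := fun i j => by
    rw [hY₁, adjugate_map_ringHom]; rfl
  have hspan₁ : (Ideal.span {Y.det}).map (C : k →+* MvPolynomial ι k) = Ideal.span {Y₁.det} := by
    rw [Ideal.map_span, Set.image_singleton, hd₁]
  have hvreg : ∀ {I : Ideal k}, IsRegularModulo I (Y.adjugate q q') →
      IsRegularModulo (I.map (C : k →+* MvPolynomial ι k)) ((Y₁.adjugate *ᵥ v) q) :=
    fun {I} hI => by
      convert IsRegularModulo.mvPolynomial_linear (I := I)
        (a := fun j => if j ∈ s then Y.adjugate q j else 0) (j := q') (by simpa [hq]) using 1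
      simp only [mulVec, dotProduct, ha₁, hv]
      exact Finset.sum_congr rfl fun i _ => by split_ifs <;> simp
  have hreg₁ : IsRegularModulo ⊥ Y₁.det := by
    have := h.det.mvPolynomial_C (σ := ι)
    rwa [Ideal.map_bot, ← hd₁] at this
  have ha₁₁ : IsRegularModulo (Ideal.span {Y₁.det}) (Y₁.adjugate l l') := by
    have := h.fst.mvPolynomial_C (σ := ι)
    rwa [hspan₁, ← ha₁] at this
  have h₁ := hvreg h.snd
  have h₂ := hvreg h.snd_fst
  rw [hspan₁] at h₁
  rw [Ideal.map_sup, hspan₁, Ideal.map_span, Set.image_singleton, ← ha₁] at h₂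
  exact ⟨IsRegularModulo.bot_iff.1 hreg₁, h₁,
    regular_adjugate_lastCol (IsRegularModulo.bot_iff.1 hreg₁) ha₁₁ h₂⟩

open MvPolynomial in
theorem IsGood.border_generic {Y : Matrix ι ι k} (h : IsGood Y) :
    IsGood (border (((Y.map (C : k →+* MvPolynomial ι k)).map
      (C : _ →+* MvPolynomial ι (MvPolynomial ι k))).map Polynomial.C)
        (Polynomial.C ∘ C ∘ X) (Polynomial.C ∘ X) Polynomial.X) := by
  obtain ⟨l, l', q, q', hr, -⟩ := h.regular
  obtain ⟨h1, h2, h3⟩ := hr.mulVec_update (v := X) (Finset.mem_univ q') (by simp)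
  obtain ⟨hH, hZ⟩ := border_generic_row h1 h2 h3 (h.homFactors.map_basis (basisMonomials ι k))
    (h.alternating.map_basis (basisMonomials ι k))
  exact ⟨⟨_, _, _, _, hr.border_generic, fun _ => by simp⟩, hH, hZ⟩

end GenericStep

section Generic

variable (k : Type*) [CommRing k]

open MvPolynomial

theorem isGood_mvPolynomialX_unit : IsGood (mvPolynomialX Unit Unit k) := by
  have hadj : (mvPolynomialX Unit Unit k).adjugate = 1 := adjugate_subsingleton _
  have hdet : ∀ c, c * (mvPolynomialX Unit Unit k).det = 0 → c = 0 := by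
    intro c hc
    rw [det_unique, mvPolynomialX_apply] at hc
    exact (isRegular_X (R := k) (n := ((), ()))).right (by simpa using hc)
  refine ⟨⟨(), (), (), (), ?_, fun h => (not_nontrivial Unit h).elim⟩, ?_, ?_⟩
  · constructor
    · exact IsRegularModulo.bot_iff.2 hdet
    all_goals rw [hadj]; exact .one _
  · intro M M' _
    exact ⟨M, 0, by simp [hadj]⟩
  · intro B C hBC
    refine ⟨0, .zero, C, 0, ?_⟩
    rw [hadj, Matrix.mul_one] at hBC
    simp [hBC]

theorem isGood_mvPolynomialX_sum {ι : Type*} [Fintype ι] [DecidableEq ι]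
    (h : IsGood (mvPolynomialX ι ι k)) : IsGood (mvPolynomialX (ι ⊕ Unit) (ι ⊕ Unit) k) := by
  obtain ⟨e, he⟩ := exists_towerEquiv k ι
  rw [← he]
  exact h.border_generic.map_submatrix e (Equiv.refl _)

variable {k} in
theorem map_submatrix_mvPolynomialX {ι κ : Type*} (f : κ ≃ ι) :
    ((mvPolynomialX ι ι k).map (renameEquiv k (f.symm.prodCongr f.symm)).toRingEquiv).submatrix f f
      = mvPolynomialX κ κ k := by
  ext1 i j
  simp

theorem isGood_mvPolynomialX (ι : Type*) [Fintype ι] [DecidableEq ι] [Nonempty ι] :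
    IsGood (mvPolynomialX ι ι k) := by
  have hFin : ∀ m : ℕ, IsGood (mvPolynomialX (Fin (m + 1)) (Fin (m + 1)) k) := by
    intro m
    induction m with
    | zero =>
      rw [← map_submatrix_mvPolynomialX (Equiv.ofUnique (Fin 1) Unit)]
      exact (isGood_mvPolynomialX_unit k).map_submatrix _ _
    | succ m ih =>
      rw [← map_submatrix_mvPolynomialX
        ((finSumFinEquiv (m := m + 1) (n := 1)).symm.trans
          (Equiv.sumCongr (Equiv.refl _) (Equiv.ofUnique (Fin 1) Unit)))]
      exact (isGood_mvPolynomialX_sum k ih).map_submatrix _ _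
  obtain ⟨m, hm⟩ := Nat.exists_eq_succ_of_ne_zero (Fintype.card_ne_zero (α := ι))
  rw [← map_submatrix_mvPolynomialX (Fintype.equivFinOfCardEq hm)]
  exact (hFin m).map_submatrix _ _

end Generic

section Torsion

variable {S : Type*} [CommRing S] {ι : Type*} [Fintype ι] [DecidableEq ι]

theorem Matrix.exists_eq_smul_of_dvd {κ μ : Type*} {x : S} {M : Matrix κ μ S}
    (h : ∀ i j, x ∣ M i j) : ∃ N : Matrix κ μ S, M = x • N := by
  choose N hN using h
  exact ⟨of N, by ext i j; exact hN i j⟩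

/-- `x` is regular on the cokernel of `(M, M') ↦ Xᵀ M + M' X` if the specialization of `X` at
`x = 0` still has the factorization property. -/
theorem IsBoundary.of_smul {X : Matrix ι ι S} {x : S} {ε : S →+* S}
    (hx : ∀ c, x * c = 0 → c = 0) (hε : ∀ y, x ∣ y - ε y) (hεx : ε x = 0)
    (hdet : ∀ c, c * (X.map ε).det = 0 → c = 0) (hH : HomFactorsThroughFree (X.map ε))
    {B : Matrix ι ι S} (hB : IsBoundary X (x • B)) : IsBoundary X B := by
  obtain ⟨M, M', h⟩ := hB
  have hdvd : ∀ {y}, ε y = 0 → x ∣ y := fun {y} hy => by simpa [hy] using hε y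
  have hεB : (x • B).map ε = 0 := by ext; simp [hεx]
  have h1 : (X.map ε)ᵀ * M.map ε = -(M'.map ε) * X.map ε := by
    have := congrArg (fun N => N.map ε) h
    simp only [hεB, Matrix.map_add ε (map_add ε), Matrix.map_mul] at this
    rw [← transpose_map, Matrix.neg_mul, eq_neg_iff_add_eq_zero, ← this]
  obtain ⟨P, Q, hPQ⟩ := hH _ _ h1
  obtain ⟨M₂, hM₂⟩ : ∃ M₂ : Matrix ι ι S, M - (X.adjugateᵀ * P + Q * X) = x • M₂ := by
    refine Matrix.exists_eq_smul_of_dvd fun i j => ?_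
    have h2 : M.map ε - (X.adjugateᵀ.map ε * P + Q * X.map ε) = 0 := by
      rw [hPQ, adjugate_map_ringHom, transpose_map, sub_self]
    have h3 : (M - (X.adjugateᵀ * P + Q * X)) i j = (M i j - ε (M i j)) -
        ((∑ t, (X.adjugateᵀ i t - ε (X.adjugateᵀ i t)) * P t j) +
          ∑ t, Q i t * (X t j - ε (X t j))) := by
      have h4 := congrFun (congrFun h2 i) j
      simp only [Matrix.sub_apply, Matrix.add_apply, Matrix.mul_apply, Matrix.map_apply,
        Matrix.zero_apply, sub_mul, mul_sub, Finset.sum_sub_distrib] at h4 ⊢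
      linear_combination h4
    rw [h3]
    exact dvd_sub (hε _) (dvd_add (Finset.dvd_sum fun t _ => (hε _).mul_right _)
      (Finset.dvd_sum fun t _ => (hε _).mul_left _))
  set W := P * X.adjugate + Xᵀ * Q + M' with hW
  have hWX : W * X = x • (B - Xᵀ * M₂) := by
    have h5 : Xᵀ * X.adjugateᵀ = X.det • 1 := by
      rw [adjugate_transpose, mul_adjugate, det_transpose]
    rw [smul_sub, h, ← Matrix.mul_smul, ← hM₂, hW, Matrix.add_mul, Matrix.add_mul, Matrix.mul_sub,
      Matrix.mul_add, ← Matrix.mul_assoc Xᵀ X.adjugateᵀ, h5, Matrix.mul_assoc P, adjugate_mul]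
    simp only [Matrix.mul_smul, Matrix.smul_mul, Matrix.mul_one, Matrix.one_mul, Matrix.mul_assoc]
    abel
  have hW0 : W.map ε = 0 := by
    have h6 : W.map ε * X.map ε = 0 := by
      rw [← Matrix.map_mul, hWX]; ext; simp [hεx]
    have h7 : (X.map ε).det • W.map ε = 0 := by
      rw [← Matrix.mul_one (W.map ε), ← Matrix.mul_smul, ← mul_adjugate, ← Matrix.mul_assoc, h6,
        Matrix.zero_mul]
    exact det_smul_cancel_matrix hdet (by rw [h7, smul_zero])
  obtain ⟨W', hW'⟩ := Matrix.exists_eq_smul_of_dvd (x := x) (M := W)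
    fun i j => hdvd (congrFun (congrFun hW0 i) j)
  refine ⟨M₂, W', ?_⟩
  rw [← sub_eq_iff_eq_add']
  ext i j
  rw [← sub_eq_zero]
  refine hx _ ?_
  rw [hW', Matrix.smul_mul] at hWX
  have := congrFun (congrFun hWX i) j
  simp only [Matrix.smul_apply, smul_eq_mul] at this
  rw [mul_sub, this, sub_self]

theorem IsBoundary.map_submatrix {S' : Type*} [CommRing S'] {κ : Type*} [Fintype κ]
    [DecidableEq κ] {X B : Matrix ι ι S} (h : IsBoundary X B) (e : S →+* S') (f g : κ ≃ ι) :
    IsBoundary ((X.map e).submatrix f g) ((B.map e).submatrix g g) := by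
  obtain ⟨M, M', rfl⟩ := h
  refine ⟨(M.map e).submatrix f g, (M'.map e).submatrix g f, ?_⟩
  rw [transpose_submatrix, submatrix_mul_equiv, submatrix_mul_equiv, ← transpose_map,
    ← Matrix.map_mul, ← Matrix.map_mul, Matrix.map_add e (map_add e)]
  rfl

theorem IsBoundary.of_map_submatrix {S' : Type*} [CommRing S'] {κ : Type*} [Fintype κ]
    [DecidableEq κ] {X B : Matrix ι ι S} (e : S ≃+* S') (f g : κ ≃ ι)
    (h : IsBoundary ((X.map e).submatrix f g) ((B.map e).submatrix g g)) : IsBoundary X B := by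
  have := h.map_submatrix (e.symm : S' →+* S) f.symm g.symm
  convert this <;> ext <;> simp

/-- The element `x` is regular on the cokernel of `(M, M') ↦ Xᵀ M + M' X`. -/
def IsRegularOnBoundaries (X : Matrix ι ι S) (x : S) : Prop :=
  ∀ B, IsBoundary X (x • B) → IsBoundary X B

theorem IsRegularOnBoundaries.map_submatrix {S' : Type*} [CommRing S'] {κ : Type*} [Fintype κ]
    [DecidableEq κ] {X : Matrix ι ι S} {x : S} (h : IsRegularOnBoundaries X x) (e : S ≃+* S')
    (f g : κ ≃ ι) : IsRegularOnBoundaries ((X.map e).submatrix f g) (e x) := by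
  intro B hB
  have hB' : B = (((B.submatrix g.symm g.symm).map e.symm).map e).submatrix g g := by ext; simp
  rw [hB']
  refine IsBoundary.map_submatrix (h _ (IsBoundary.of_map_submatrix e f g ?_)) (e : S →+* S') f g
  convert hB
  ext; simp

open MvPolynomial in
theorem IsGood.isRegularOnBoundaries_border {k : Type*} [CommRing k] [Nontrivial ι]
    {Y : Matrix ι ι k} (h : IsGood Y) :
    ∃ i : ι, IsRegularOnBoundaries (border (((Y.map (C : k →+* MvPolynomial ι k)).map
      (C : _ →+* MvPolynomial ι (MvPolynomial ι k))).map Polynomial.C)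
        (Polynomial.C ∘ C ∘ X) (Polynomial.C ∘ X) Polynomial.X) (Polynomial.C (C (X i))) := by
  obtain ⟨l, l', q, q', hr, hne⟩ := h.regular
  refine ⟨l', ?_⟩
  obtain ⟨h1, h2, h3⟩ := hr.mulVec_update (v := fun i => if i ∈ Finset.univ.erase l' then X i else 0)
    (Finset.mem_erase.2 ⟨(hne inferInstance).symm, Finset.mem_univ q'⟩) (fun i => rfl)
  obtain ⟨hH, -⟩ := border_generic_row h1 h2 h3 (h.homFactors.map_basis (basisMonomials ι k))
    (h.alternating.map_basis (basisMonomials ι k))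
  set ε₁ : MvPolynomial ι k →+* MvPolynomial ι k :=
    eval₂Hom C (fun i => if i ∈ Finset.univ.erase l' then X i else 0) with hε₁
  set ε : Polynomial (MvPolynomial ι (MvPolynomial ι k)) →+*
    Polynomial (MvPolynomial ι (MvPolynomial ι k)) := Polynomial.mapRingHom (map ε₁) with hε
  have hmap : (border (((Y.map (C : k →+* MvPolynomial ι k)).map
      (C : _ →+* MvPolynomial ι (MvPolynomial ι k))).map Polynomial.C)
        (Polynomial.C ∘ C ∘ X) (Polynomial.C ∘ X) Polynomial.X).map ε =
      border (((Y.map (C : k →+* MvPolynomial ι k)).map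
      (C : _ →+* MvPolynomial ι (MvPolynomial ι k))).map Polynomial.C)
        (Polynomial.C ∘ C ∘ fun i => if i ∈ Finset.univ.erase l' then X i else 0)
        (Polynomial.C ∘ X) Polynomial.X := by
    ext1 i j
    rcases i with i | i <;> rcases j with j | j <;> simp [hε, hε₁]
  have hdvd₁ : ∀ y, X l' ∣ y - ε₁ y := by
    intro y
    induction y using MvPolynomial.induction_on with
    | C a => simp [hε₁]
    | add p q hp hq => rw [map_add, add_sub_add_comm]; exact dvd_add hp hq
    | mul_X p i hp =>
      have : p * X i - ε₁ (p * X i) = (p - ε₁ p) * X i + ε₁ p * (X i - ε₁ (X i)) := by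
        rw [map_mul]; ring
      rw [this]
      refine dvd_add (hp.mul_right _) (Dvd.dvd.mul_left ?_ _)
      by_cases hi : i = l' <;> simp [hε₁, hi]
  have hdvd₂ : ∀ y, C (X l') ∣ y - map (σ := ι) ε₁ y := by
    intro y
    rw [C_dvd_iff_dvd_coeff]
    intro m
    rw [coeff_sub, coeff_map]
    exact hdvd₁ _
  intro B hB
  refine hB.of_smul (ε := ε) ?_ ?_ ?_ ?_ ?_
  · have h4 : IsRegularModulo (⊥ : Ideal (MvPolynomial ι k)) (X l') :=
      IsRegularModulo.bot_iff.2 fun c hc => (isRegular_X (R := k) (n := l')).right (by simpa using hc)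
    have h5 := (h4.mvPolynomial_C (σ := ι)).polynomial_C
    rw [Ideal.map_bot, Ideal.map_bot] at h5
    intro c hc
    exact IsRegularModulo.bot_iff.1 h5 c (by rw [mul_comm, hc])
  · intro y
    rw [Polynomial.C_dvd_iff_dvd_coeff]
    intro m
    rw [Polynomial.coeff_sub, hε, Polynomial.coe_mapRingHom, Polynomial.coeff_map]
    exact hdvd₂ _
  · simp [hε, hε₁]
  · rw [hmap]
    refine regular_det_border_polynomial ?_
    rw [← IsRegularModulo.bot_iff, det_map_ringHom]
    have := (IsRegularModulo.bot_iff.2 h1).mvPolynomial_C (σ := ι)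
    rwa [Ideal.map_bot] at this
  · rw [hmap]; exact hH

open MvPolynomial in
theorem map_submatrix_mvPolynomialX' {k : Type*} [CommRing k] {ι κ : Type*} (f g : κ ≃ ι) :
    ((mvPolynomialX ι ι k).map (renameEquiv k (f.symm.prodCongr g.symm)).toRingEquiv).submatrix f g
      = mvPolynomialX κ κ k := by
  ext1 i j
  simp

theorem Equiv.exists_apply_eq {α β : Type*} [DecidableEq β] (f : α ≃ β) (a : α) (b : β) :
    ∃ g : α ≃ β, g a = b :=
  ⟨f.trans (Equiv.swap (f a) b), by simp⟩

open MvPolynomial in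
theorem isRegularOnBoundaries_X (k : Type*) [CommRing k] {κ : Type*} [Fintype κ] [DecidableEq κ]
    (hκ : 3 ≤ Fintype.card κ) (i j : κ) :
    IsRegularOnBoundaries (mvPolynomialX κ κ k) (X (i, j)) := by
  obtain ⟨m, hm⟩ := Nat.exists_eq_add_of_le hκ
  have hcard : Fintype.card κ = Fintype.card (Fin (m + 2) ⊕ Unit) := by
    simp [hm]; omega
  let f₀ := Fintype.equivOfCardEq hcard
  obtain ⟨e, he⟩ := exists_towerEquiv k (Fin (m + 2))
  obtain ⟨t, ht⟩ := (isGood_mvPolynomialX k (Fin (m + 2))).isRegularOnBoundaries_border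
  have h1 := ht.map_submatrix e (Equiv.refl _) (Equiv.refl _)
  rw [he] at h1
  have h2 : e (Polynomial.C (C (X t))) = X (Sum.inl t, Sum.inr ()) := by
    have := congrFun (congrFun he (Sum.inl t)) (Sum.inr ())
    simpa using this
  rw [h2] at h1
  obtain ⟨f, hf⟩ := Equiv.exists_apply_eq f₀ i (Sum.inl t)
  obtain ⟨g, hg⟩ := Equiv.exists_apply_eq f₀ j (Sum.inr ())
  have h3 := h1.map_submatrix (renameEquiv k (f.symm.prodCongr g.symm)).toRingEquiv f g
  have h4 : (renameEquiv k (f.symm.prodCongr g.symm)).toRingEquiv (X (Sum.inl t, Sum.inr ())) =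
      X (i, j) := by
    simp [← hf, ← hg]
  rw [h4] at h3
  have h5 := map_submatrix_mvPolynomialX' (k := k) f g
  rw [← h5]
  exact h3

end Torsion

section Faithful

variable {S : Type*} [CommRing S] {ι : Type*} [Fintype ι] [DecidableEq ι]

/-- The ideal generated by the entries of the adjugate. -/
def adjugateIdeal (X : Matrix ι ι S) : Ideal S :=
  Ideal.span (Set.range fun p : ι × ι => X.adjugate p.1 p.2)

theorem adjugate_mem_adjugateIdeal (X : Matrix ι ι S) (i j : ι) :
    X.adjugate i j ∈ adjugateIdeal X :=
  Ideal.subset_span ⟨(i, j), rfl⟩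

theorem mul_adjugate_mem_adjugateIdeal {κ : Type*} (X : Matrix ι ι S) (M : Matrix κ ι S) (i : κ)
    (j : ι) : (M * X.adjugate) i j ∈ adjugateIdeal X :=
  Ideal.sum_mem _ fun _ _ => Ideal.mul_mem_left _ _ (adjugate_mem_adjugateIdeal X _ _)

theorem adjugate_mul_mem_adjugateIdeal {κ : Type*} (X : Matrix ι ι S) (M : Matrix ι κ S) (i : ι)
    (j : κ) : (X.adjugate * M) i j ∈ adjugateIdeal X :=
  Ideal.sum_mem _ fun _ _ => Ideal.mul_mem_right _ _ (adjugate_mem_adjugateIdeal X _ _)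

theorem det_mem_adjugateIdeal [Nonempty ι] (X : Matrix ι ι S) : X.det ∈ adjugateIdeal X := by
  obtain ⟨i⟩ := ‹Nonempty ι›
  have := mul_adjugate_mem_adjugateIdeal X X i i
  rwa [mul_adjugate, Matrix.smul_apply, one_apply_eq, smul_eq_mul, mul_one] at this

theorem adjugateIdeal_transpose (X : Matrix ι ι S) : adjugateIdeal Xᵀ = adjugateIdeal X := by
  unfold adjugateIdeal
  rw [← (Equiv.prodComm ι ι).surjective.range_comp]
  congr 1
  ext a
  simp [← adjugate_transpose]

/-- A cocycle `B`, with `B adj(X) = Xᵀ C`, is a boundary as soon as the `(r, s)` entry of `C`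
lies in the ideal generated by the entries of the adjugate. -/
def IsFaithfulEntry (X : Matrix ι ι S) (r s : ι) : Prop :=
  ∀ B C, B * X.adjugate = Xᵀ * C → C r s ∈ adjugateIdeal X → IsBoundary X B

theorem IsFaithfulEntry.map_submatrix {S' : Type*} [CommRing S'] {κ : Type*} [Fintype κ]
    [DecidableEq κ] (e : S ≃+* S') (f : κ ≃ ι) {X : Matrix ι ι S} {r s : ι}
    (h : IsFaithfulEntry X r s) :
    IsFaithfulEntry ((X.map e).submatrix f f) (f.symm r) (f.symm s) := by
  intro B C hB hC
  obtain ⟨B, rfl⟩ := exists_map_submatrix_eq e f B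
  obtain ⟨C, rfl⟩ := exists_map_submatrix_eq e f C
  rw [map_submatrix_adjugate, ← map_submatrix_transpose, ← map_submatrix_mul,
    ← map_submatrix_mul] at hB
  refine (isBoundary_map_submatrix_iff e f).2 (h B C (map_submatrix_injective e f hB) ?_)
  have h1 : adjugateIdeal ((X.map e).submatrix f f) = (adjugateIdeal X).map (e : S →+* S') := by
    rw [adjugateIdeal, adjugateIdeal, Ideal.map_span, ← Set.range_comp,
      ← (Equiv.prodCongr f f).surjective.range_comp, map_submatrix_adjugate]
    rfl
  rw [h1] at hC
  have h2 : e (C r s) ∈ (adjugateIdeal X).map (e : S →+* S') := by simpa using hC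
  have h3 := Ideal.mem_map_of_mem (e.symm : S' →+* S) h2
  rw [Ideal.map_map] at h3
  simpa using h3

/-! ### Elimination of a variable -/

variable {X₀ : Matrix ι ι S} {c r : ι → S} {x : S}

theorem border_zero_zero (Y : Matrix ι ι S) (t : S) :
    border Y 0 0 t = fromBlocks Y 0 0 (t • 1) := by
  ext (i | i) (j | j) <;> simp

theorem border_mul_elim : border X₀ c r x * border (x • 1) 0 (-r) 1 =
    border 1 c 0 x * border (x • X₀ - vecMulVec c r) 0 0 1 := by
  ext (i | i) (j | j) <;>
    simp [Matrix.mul_apply, Fintype.sum_sum_type, vecMulVec_apply, Matrix.one_apply, mul_comm,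
      sub_eq_add_neg]

theorem elim_mul_border : border (x • 1) (-c) 0 1 * border X₀ c r x =
    border (x • X₀ - vecMulVec c r) 0 0 1 * border 1 0 r x := by
  ext (i | i) (j | j) <;>
    simp [Matrix.mul_apply, Fintype.sum_sum_type, vecMulVec_apply, Matrix.one_apply, mul_comm,
      sub_eq_add_neg]

theorem elim_mul_inverse : border (x • 1) 0 (-r) 1 * border (1 : Matrix ι ι S) 0 r x = x • 1 := by
  ext (i | i) (j | j) <;>
    simp [Matrix.mul_apply, Fintype.sum_sum_type, Matrix.one_apply, mul_comm]

theorem inverse_mul_elim : border (1 : Matrix ι ι S) c 0 x * border (x • 1) (-c) 0 1 = x • 1 := by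
  ext (i | i) (j | j) <;>
    simp [Matrix.mul_apply, Fintype.sum_sum_type, Matrix.one_apply, mul_comm]

theorem det_border_zero_left (Y : Matrix ι ι S) (r : ι → S) (t : S) :
    (border Y 0 r t).det = Y.det * t := by
  have : (of fun (i : ι) (_ : Unit) => (0 : ι → S) i) = 0 := rfl
  rw [border, this, det_fromBlocks_zero₁₂]
  simp

theorem det_border_elim : x ^ Fintype.card ι * (border X₀ c r x).det =
    x * (x • X₀ - vecMulVec c r).det := by
  have h := congrArg det (border_mul_elim (X₀ := X₀) (c := c) (r := r) (x := x))
  rw [det_mul, det_mul, det_border_zero_left, det_border_zero_left, det_smul, det_one,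
    ← det_transpose (border 1 c 0 x), border_transpose, det_border_zero_left] at h
  rw [transpose_one, det_one] at h
  linear_combination h

theorem toBlocks_cocycle (hX : ∀ d, d * (border X₀ c r x).det = 0 → d = 0)
    {B C : Matrix (ι ⊕ Unit) (ι ⊕ Unit) S}
    (h : B * (border X₀ c r x).adjugate = (border X₀ c r x)ᵀ * C) :
    (x • X₀ - vecMulVec c r).det • (x • ((border (x • 1) 0 (-r) 1)ᵀ * B *
      border (x • 1) 0 (-r) 1).toBlocks₁₁) =
    (x • X₀ - vecMulVec c r)ᵀ * (x ^ Fintype.card ι • C.toBlocks₁₁) *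
      (x • X₀ - vecMulVec c r) := by
  set X := border X₀ c r x with hXd
  set Y := x • X₀ - vecMulVec c r with hY
  set V := border (x • 1) 0 (-r) 1 with hV
  have h1 : X.det • B = Xᵀ * C * X := by
    rw [← h, Matrix.mul_assoc, adjugate_mul, Matrix.mul_smul, Matrix.mul_one]
  have h2 : X.det • (Vᵀ * B * V) = (border Y 0 0 1)ᵀ * ((border 1 c 0 x)ᵀ * C * border 1 c 0 x) *
      border Y 0 0 1 := by
    calc _ = (X * V)ᵀ * C * (X * V) := by
          rw [← Matrix.smul_mul, ← Matrix.mul_smul, h1]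
          simp only [transpose_mul, Matrix.mul_assoc]
      _ = _ := by
          rw [border_mul_elim, ← hY]
          simp only [transpose_mul, Matrix.mul_assoc]
  have h3 : X.det • (Vᵀ * B * V).toBlocks₁₁ = Yᵀ * C.toBlocks₁₁ * Y := by
    have h4 : (border 1 c 0 x)ᵀ * C * border 1 c 0 x = fromBlocks C.toBlocks₁₁
        ((border 1 c 0 x)ᵀ * C * border 1 c 0 x).toBlocks₁₂
        ((border 1 c 0 x)ᵀ * C * border 1 c 0 x).toBlocks₂₁
        ((border 1 c 0 x)ᵀ * C * border 1 c 0 x).toBlocks₂₂ := by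
      ext (i | i) (j | j) <;>
        simp [Matrix.mul_apply, Fintype.sum_sum_type, Matrix.one_apply, toBlocks₁₁, toBlocks₁₂,
          toBlocks₂₁, toBlocks₂₂]
    have h5 := congrArg toBlocks₁₁ h2
    rw [h4, border_zero_zero, fromBlocks_transpose, fromBlocks_multiply,
      fromBlocks_multiply, toBlocks_fromBlocks₁₁] at h5
    have h6 : (X.det • (Vᵀ * B * V)).toBlocks₁₁ = Yᵀ * C.toBlocks₁₁ * Y := by simpa using h5
    exact h6
  rw [smul_smul, mul_comm, ← det_border_elim, ← hXd, mul_smul, h3, Matrix.mul_smul,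
    Matrix.smul_mul]

theorem pow_mul_mem_adjugateIdeal [Nonempty ι]
    (hX : ∀ d, d * (border X₀ c r x).det = 0 → d = 0) {a : S}
    (ha : a ∈ adjugateIdeal (border X₀ c r x)) :
    x ^ Fintype.card ι * a ∈ adjugateIdeal (x • X₀ - vecMulVec c r) := by
  set X := border X₀ c r x with hXd
  set Y := x • X₀ - vecMulVec c r with hY
  set E := border Y.adjugate 0 0 Y.det with hE
  have hWE : border Y 0 0 1 * E = Y.det • 1 := by
    rw [hE, border_zero_zero, border_zero_zero, fromBlocks_multiply, ← fromBlocks_one,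
      fromBlocks_smul]
    simp [mul_adjugate]
  have h1 : border (x • 1) 0 (-r) 1 * E * border (x • 1) (-c) 0 1 =
      X.adjugate * (x ^ Fintype.card ι • 1) := by
    refine eq_adjugate_mul hX ?_
    rw [← Matrix.mul_assoc, ← Matrix.mul_assoc, border_mul_elim, Matrix.mul_assoc _ _ E, hWE,
      Matrix.mul_smul, Matrix.mul_one, Matrix.smul_mul, inverse_mul_elim, smul_smul, smul_smul,
      mul_comm, ← det_border_elim, mul_comm]
  have hEmem : ∀ i j, E i j ∈ adjugateIdeal Y := by
    rintro (i | i) (j | j)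
    · exact adjugate_mem_adjugateIdeal Y i j
    · exact Ideal.zero_mem _
    · exact Ideal.zero_mem _
    · exact det_mem_adjugateIdeal Y
  have h2 : ∀ i j, x ^ Fintype.card ι * X.adjugate i j ∈ adjugateIdeal Y := by
    intro i j
    have h3 := congrFun (congrFun h1 i) j
    rw [Matrix.mul_smul, Matrix.mul_one, Matrix.smul_apply, smul_eq_mul] at h3
    rw [← h3]
    refine Ideal.sum_mem _ fun l _ => Ideal.mul_mem_right _ _ (Ideal.sum_mem _ fun m _ =>
      Ideal.mul_mem_left _ _ (hEmem _ _))
  rw [← smul_eq_mul]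
  induction ha using Submodule.span_induction with
  | mem a ha => obtain ⟨p, rfl⟩ := ha; exact h2 _ _
  | zero => simp
  | add a b _ _ h h' => rw [smul_add]; exact Ideal.add_mem _ h h'
  | smul a b _ h => rw [smul_comm]; exact Ideal.mul_mem_left _ _ h

theorem isBoundary_border_of_elim {B : Matrix (ι ⊕ Unit) (ι ⊕ Unit) S} {a : S}
    (h : IsBoundary (x • X₀ - vecMulVec c r) (a • ((border (x • 1) 0 (-r) 1)ᵀ * B *
      border (x • 1) 0 (-r) 1).toBlocks₁₁)) :
    IsBoundary (border X₀ c r x) ((a * x ^ 2) • B) := by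
  set X := border X₀ c r x with hXd
  set Y := x • X₀ - vecMulVec c r with hY
  set V := border (x • 1) 0 (-r) 1 with hV
  have h1 : IsBoundary (border Y 0 0 1) (a • (Vᵀ * B * V)) := by
    obtain ⟨M, M', h⟩ := h
    set B' := a • (Vᵀ * B * V) with hB'
    refine ⟨fromBlocks M 0 B'.toBlocks₂₁ B'.toBlocks₂₂, fromBlocks M' B'.toBlocks₁₂ 0 0, ?_⟩
    have h' : B'.toBlocks₁₁ = Yᵀ * M + M' * Y := h
    rw [border_transpose, border_zero_zero, border_zero_zero, fromBlocks_multiply, fromBlocks_multiply,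
      fromBlocks_add]
    conv_lhs => rw [← fromBlocks_toBlocks B', h']
    simp
  obtain ⟨M, M', h2⟩ := h1
  have h3 : (a * x ^ 2) • B = (border 1 0 r x)ᵀ * (a • (Vᵀ * B * V)) * border 1 0 r x := by
    have h4 : (border 1 0 r x)ᵀ * (a • (Vᵀ * B * V)) * border 1 0 r x =
        a • ((V * border 1 0 r x)ᵀ * B * (V * border 1 0 r x)) := by
      simp only [transpose_mul, Matrix.mul_assoc, Matrix.mul_smul, Matrix.smul_mul]
    rw [h4, elim_mul_inverse]
    simp [smul_smul, pow_two]
  refine ⟨(border (x • 1) (-c) 0 1)ᵀ * M * border 1 0 r x,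
    (border 1 0 r x)ᵀ * M' * border (x • 1) (-c) 0 1, ?_⟩
  have h5 := elim_mul_border (X₀ := X₀) (c := c) (r := r) (x := x)
  rw [h3, h2, Matrix.mul_assoc _ _ X, h5, ← Matrix.mul_assoc Xᵀ, ← Matrix.mul_assoc Xᵀ,
    ← transpose_mul, h5, ← hY]
  simp only [transpose_mul, Matrix.mul_assoc, Matrix.mul_add, Matrix.add_mul]

end Faithful

section Descent

variable {S S' : Type*} [CommRing S] [CommRing S'] {ι : Type*} [Fintype ι] [DecidableEq ι]

theorem exists_pow_smul_eq_map {φ : S' →+* S} {x : S} {x' : S'} (hx : φ x' = x)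
    (hφ : ∀ g, ∃ N h, x ^ N * g = φ h) {α : Type*} [Finite α] (v : α → S) :
    ∃ N, ∃ w : α → S', ∀ a, x ^ N * v a = φ (w a) := by
  have := Fintype.ofFinite α
  choose N h hN using hφ
  refine ⟨∑ a, N (v a), fun a => x' ^ (∑ b, N (v b) - N (v a)) * h (v a), fun a => ?_⟩
  rw [map_mul, map_pow, hx, ← hN, ← mul_assoc, ← pow_add, Nat.sub_add_cancel]
  exact Finset.single_le_sum (f := fun a => N (v a)) (fun _ _ => Nat.zero_le _) (Finset.mem_univ a)

theorem exists_pow_mul_mem_adjugateIdeal {φ : S' →+* S} (hinj : Function.Injective φ) {x : S}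
    {x' : S'} (hx : φ x' = x) (hφ : ∀ g, ∃ N h, x ^ N * g = φ h) {Y : Matrix ι ι S'} {a : S'}
    (ha : φ a ∈ adjugateIdeal (Y.map φ)) : ∃ N, x' ^ N * a ∈ adjugateIdeal Y := by
  obtain ⟨c, hc⟩ := Ideal.mem_span_range_iff_exists_fun.1 ha
  obtain ⟨N, w, hw⟩ := exists_pow_smul_eq_map hx hφ c
  refine ⟨N, ?_⟩
  have : x' ^ N * a = ∑ p, w p * Y.adjugate p.1 p.2 := by
    refine hinj ?_
    rw [map_mul, map_pow, hx, ← hc, Finset.mul_sum, map_sum]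
    refine Finset.sum_congr rfl fun p _ => ?_
    rw [← mul_assoc, hw, map_mul, adjugate_map_ringHom]
    rfl
  rw [this]
  exact Ideal.sum_mem _ fun p _ => Ideal.mul_mem_left _ _ (adjugate_mem_adjugateIdeal Y _ _)

theorem IsRegularOnBoundaries.pow {X : Matrix ι ι S} {x : S} (h : IsRegularOnBoundaries X x)
    (N : ℕ) : IsRegularOnBoundaries X (x ^ N) := by
  induction N with
  | zero => intro B hB; simpa using hB
  | succ N ih => intro B hB; exact h _ (ih _ (by rwa [pow_succ, mul_smul] at hB))

theorem IsFaithfulEntry.border [Nonempty ι] {φ : S' →+* S} (hinj : Function.Injective φ) {x : S}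
    {x' : S'} (hx : φ x' = x) (hφ : ∀ g, ∃ N h, x ^ N * g = φ h) {Y : Matrix ι ι S'}
    {X₀ : Matrix ι ι S} {c r : ι → S} (hY : Y.map φ = x • X₀ - vecMulVec c r)
    (hdet' : ∀ d, d * Y.det = 0 → d = 0)
    (hdet : ∀ d, d * (border X₀ c r x).det = 0 → d = 0)
    (hreg : IsRegularOnBoundaries (_root_.border X₀ c r x) x) {p q : ι}
    (h : IsFaithfulEntry Y p q) :
    IsFaithfulEntry (_root_.border X₀ c r x) (Sum.inl p) (Sum.inl q) := by
  intro B C hB hC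
  have h1 := toBlocks_cocycle hdet hB
  have h2 := pow_mul_mem_adjugateIdeal hdet hC
  set b := ((_root_.border (x • 1) 0 (-r) 1)ᵀ * B * _root_.border (x • 1) 0 (-r) 1).toBlocks₁₁
    with hb
  rw [← hY] at h1 h2
  obtain ⟨N₁, v, hv⟩ := exists_pow_smul_eq_map hx hφ
    (Sum.elim (fun p : ι × ι => x * b p.1 p.2)
      (fun p : ι × ι => x ^ Fintype.card ι * C.toBlocks₁₁ p.1 p.2))
  have hvb : (of fun i j => v (Sum.inl (i, j))).map φ = x ^ N₁ • (x • b) := by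
    ext i j; exact (hv (Sum.inl (i, j))).symm
  have hvc : (of fun i j => v (Sum.inr (i, j))).map φ =
      x ^ N₁ • (x ^ Fintype.card ι • C.toBlocks₁₁) := by
    ext i j; exact (hv (Sum.inr (i, j))).symm
  set b' : Matrix ι ι S' := of fun i j => v (Sum.inl (i, j))
  set c' : Matrix ι ι S' := of fun i j => v (Sum.inr (i, j))
  have h3 : Y.det • b' = Yᵀ * c' * Y := by
    refine Matrix.map_injective hinj ?_
    have e1 : (Y.det • b').map φ = (Y.map φ).det • b'.map φ := by
      ext; simp [det_map_ringHom]
    dsimp only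
    rw [e1, Matrix.map_mul, Matrix.map_mul, hvb, hvc, smul_comm, h1, ← transpose_map]
    simp only [Matrix.mul_smul, Matrix.smul_mul]
  have h4 : b' * Y.adjugate = Yᵀ * c' := by
    refine det_smul_cancel_matrix hdet' ?_
    rw [← Matrix.smul_mul, h3, Matrix.mul_assoc, mul_adjugate, Matrix.mul_smul, Matrix.mul_one]
  obtain ⟨N₂, hN₂⟩ := exists_pow_mul_mem_adjugateIdeal hinj hx hφ (Y := Y) (a := c' p q) (by
    have := congrFun (congrFun hvc p) q
    rw [Matrix.map_apply] at this
    rw [this, Matrix.smul_apply, Matrix.smul_apply, smul_eq_mul, smul_eq_mul]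
    exact Ideal.mul_mem_left _ _ h2)
  have h5 := h (x' ^ N₂ • b') (x' ^ N₂ • c') (by rw [Matrix.smul_mul, h4, Matrix.mul_smul])
    (by simpa using hN₂)
  have h6 := h5.map φ
  have e2 : (x' ^ N₂ • b').map φ = (x ^ N₂ * x ^ N₁ * x) • b := by
    rw [mul_smul, mul_smul, ← hvb]
    ext; simp [hx]
  rw [e2, hY, hb] at h6
  have h7 := isBoundary_border_of_elim h6
  refine hreg.pow (N₂ + N₁ + 1 + 2) _ ?_
  convert h7 using 2
  ring

theorem isFaithfulEntry_fin_two {X : Matrix (Fin 2) (Fin 2) S} (hX : ∀ d, d * X.det = 0 → d = 0)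
    (hZ : HasAlternatingRepresentatives X) {r s : Fin 2} (hrs : r ≠ s) :
    IsFaithfulEntry X r s := by
  have hXt : ∀ c, c * Xᵀ.det = 0 → c = 0 := by rwa [det_transpose]
  intro B C hB hC
  obtain ⟨D, hD, M, M', hBD⟩ := hZ B C hB
  obtain ⟨C', hC', hDC⟩ := hD.exists_mul_adjugate hX
  set J : Matrix (Fin 2) (Fin 2) S := !![0, 1; -1, 0] with hJ
  have hDJ : D = D 0 1 • J := by
    have h1 := congrFun (congrFun hD.1 0) 1
    simp only [transpose_apply, Matrix.neg_apply] at h1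
    ext i j
    fin_cases i <;> fin_cases j <;> simp [hJ, hD.2, h1]
  have hJA : J * X.adjugate = Xᵀ * J := by
    rw [adjugate_fin_two, hJ]
    ext i j
    fin_cases i <;> fin_cases j <;> simp [Matrix.mul_apply, Fin.sum_univ_two]
  have hC'' : C = D 0 1 • J + M * X.adjugate + X.adjugateᵀ * M' := by
    refine det_smul_cancel_matrix hXt ?_
    have h2 : Xᵀ * C = Xᵀ * (D 0 1 • J + M * X.adjugate + X.adjugateᵀ * M') := by
      rw [← hB, eq_add_of_sub_eq hBD, Matrix.add_mul, Matrix.add_mul, Matrix.mul_assoc M',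
        mul_adjugate]
      conv_lhs => rw [hDJ]
      rw [Matrix.smul_mul, hJA, adjugate_transpose, Matrix.mul_add, Matrix.mul_add,
        ← Matrix.mul_assoc _ _ M', mul_adjugate, det_transpose]
      simp only [Matrix.mul_smul, Matrix.mul_one, Matrix.smul_mul, Matrix.one_mul,
        Matrix.mul_assoc]
      abel
    have h3 := congrArg (Xᵀ.adjugate * ·) h2
    simpa only [← Matrix.mul_assoc, adjugate_mul, Matrix.smul_mul, Matrix.one_mul] using h3
  have hD01 : D 0 1 ∈ adjugateIdeal X := by
    have h4 : (D 0 1 • J) r s ∈ adjugateIdeal X := by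
      have h5 : (D 0 1 • J) r s = C r s - (M * X.adjugate) r s - (X.adjugateᵀ * M') r s := by
        rw [hC'']; simp only [Matrix.add_apply]; ring
      rw [h5]
      refine Ideal.sub_mem _ (Ideal.sub_mem _ hC (mul_adjugate_mem_adjugateIdeal X M r s)) ?_
      rw [adjugate_transpose, ← adjugateIdeal_transpose]
      exact adjugate_mul_mem_adjugateIdeal _ _ _ _
    fin_cases r <;> fin_cases s <;> simp [hJ] at hrs h4 ⊢ <;> exact h4
  have hDN : IsBoundary X (D 0 1 • J) := by
    generalize D 0 1 = a at hD01
    induction hD01 using Submodule.span_induction with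
    | mem a ha =>
      obtain ⟨⟨i, j⟩, rfl⟩ := ha
      rw [adjugate_fin_two, hJ]
      fin_cases i <;> fin_cases j
      · refine ⟨!![0, 0; -1, 0], !![0, 1; 0, 0], ?_⟩
        ext i j; fin_cases i <;> fin_cases j <;>
          simp [Matrix.mul_apply, Fin.sum_univ_two, vecMul, dotProduct]
      · refine ⟨!![1, 0; 0, 0], !![-1, 0; 0, 0], ?_⟩
        ext i j; fin_cases i <;> fin_cases j <;>
          simp [Matrix.mul_apply, Fin.sum_univ_two, vecMul, dotProduct]
      · refine ⟨!![0, 0; 0, -1], !![0, 0; 0, 1], ?_⟩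
        ext i j; fin_cases i <;> fin_cases j <;>
          simp [Matrix.mul_apply, Fin.sum_univ_two, vecMul, dotProduct]
      · refine ⟨!![0, 1; 0, 0], !![0, 0; -1, 0], ?_⟩
        ext i j; fin_cases i <;> fin_cases j <;>
          simp [Matrix.mul_apply, Fin.sum_univ_two, vecMul, dotProduct]
    | zero => rw [zero_smul]; exact .zero X
    | add a b _ _ h h' => rw [add_smul]; exact h.add h'
    | smul a b _ h => rw [smul_eq_mul, mul_smul]; exact h.smul a
  rw [eq_add_of_sub_eq hBD]
  conv => arg 2; rw [hDJ]
  exact IsBoundary.add ⟨M, M', rfl⟩ hDN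

end Descent

section GenericFaithful

open MvPolynomial

theorem coeff_eval₂Hom_C_mul_X {σ k : Type*} [CommRing k] (x : k) (p : MvPolynomial σ k)
    (m : σ →₀ ℕ) : coeff m (eval₂Hom C (fun i => C x * X i) p) = x ^ m.degree * coeff m p := by
  classical
  induction p using MvPolynomial.induction_on' with
  | monomial u a =>
    have : eval₂Hom C (fun i => C x * X i) (monomial u a) = monomial u (x ^ u.degree * a) := by
      rw [eval₂Hom_monomial, monomial_eq, map_mul, Finsupp.prod, Finsupp.prod]
      have h : u.degree = ∑ i ∈ u.support, u i := rfl
      simp only [mul_pow, Finset.prod_mul_distrib, ← map_pow, ← map_prod, Finset.prod_pow_eq_pow_sum,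
        h]
      ring
    rw [this, coeff_monomial, coeff_monomial]
    split_ifs with h
    · rw [h]
    · simp
  | add p q hp hq => rw [map_add, coeff_add, hp, hq, coeff_add, mul_add]

theorem eval₂Hom_affine_injective {σ k : Type*} [CommRing k] {x : k}
    (hx : ∀ d, x * d = 0 → d = 0) (a : σ → k) :
    Function.Injective (eval₂Hom (C : k →+* MvPolynomial σ k) fun i => C x * X i - C (a i)) := by
  rw [injective_iff_map_eq_zero]
  intro y hy
  have hpow : ∀ n d, x ^ n * d = 0 → d = 0 := by
    intro n
    induction n with
    | zero => simp
    | succ n ih => intro d hd; exact hx _ (ih _ (by rw [← hd]; ring))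
  let τ : MvPolynomial σ k →+* MvPolynomial σ k := eval₂Hom C fun i => X i - C (a i)
  let ρ : MvPolynomial σ k →+* MvPolynomial σ k := eval₂Hom C fun i => X i + C (a i)
  have hρτ : ρ.comp τ = RingHom.id _ := by
    ext <;> simp [ρ, τ]
  have hcomp : eval₂Hom (C : k →+* MvPolynomial σ k) (fun i => C x * X i - C (a i)) =
      (eval₂Hom C fun i => C x * X i).comp τ := by
    ext <;> simp [τ]
  rw [hcomp, RingHom.comp_apply] at hy
  have hτ : τ y = 0 := by
    ext m
    refine hpow m.degree _ ?_
    rw [← coeff_eval₂Hom_C_mul_X, hy, coeff_zero]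
  have := congrArg ρ hτ
  rwa [← RingHom.comp_apply, hρτ, map_zero] at this

theorem exists_pow_mul_eq_eval₂Hom_affine {σ k : Type*} [CommRing k] (x : k) (a : σ → k)
    (g : MvPolynomial σ k) :
    ∃ N h, C x ^ N * g = eval₂Hom (C : k →+* MvPolynomial σ k)
      (fun i => C x * X i - C (a i)) h := by
  induction g using MvPolynomial.induction_on with
  | C b => exact ⟨0, C b, by simp⟩
  | add p q hp hq =>
    obtain ⟨N, h, hN⟩ := hp
    obtain ⟨N', h', hN'⟩ := hq
    refine ⟨N + N', C x ^ N' * h + C x ^ N * h', ?_⟩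
    simp only [map_add, map_mul, map_pow, ← hN, ← hN', eval₂Hom_C]
    ring
  | mul_X p i hp =>
    obtain ⟨N, h, hN⟩ := hp
    refine ⟨N + 1, h * (X i + C (a i)), ?_⟩
    simp only [map_add, map_mul, ← hN, eval₂Hom_C, eval₂Hom_X', sub_add_cancel]
    ring

theorem exists_blockEquiv (k : Type*) [CommRing k] (ι : Type*) :
    ∃ e : MvPolynomial (ι × ι) (MvPolynomial ((ι ⊕ ι) ⊕ Unit) k) ≃+*
      MvPolynomial ((ι ⊕ Unit) × (ι ⊕ Unit)) k,
      (border (mvPolynomialX ι ι _) (fun i => C (X (Sum.inl (Sum.inl i))))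
        (fun i => C (X (Sum.inl (Sum.inr i)))) (C (X (Sum.inr ())))).map e =
        mvPolynomialX (ι ⊕ Unit) (ι ⊕ Unit) k := by
  let F : MvPolynomial (ι × ι) (MvPolynomial ((ι ⊕ ι) ⊕ Unit) k) →+*
      MvPolynomial ((ι ⊕ Unit) × (ι ⊕ Unit)) k :=
    eval₂Hom (eval₂Hom C (Sum.elim (Sum.elim (fun i => X (Sum.inl i, Sum.inr ()))
      (fun i => X (Sum.inr (), Sum.inl i))) (fun _ => X (Sum.inr (), Sum.inr ()))))
      (fun p => X (Sum.inl p.1, Sum.inl p.2))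
  let G : MvPolynomial ((ι ⊕ Unit) × (ι ⊕ Unit)) k →+*
      MvPolynomial (ι × ι) (MvPolynomial ((ι ⊕ ι) ⊕ Unit) k) :=
    eval₂Hom (C.comp C) fun p =>
      border (mvPolynomialX ι ι _) (fun i => C (X (Sum.inl (Sum.inl i))))
        (fun i => C (X (Sum.inl (Sum.inr i)))) (C (X (Sum.inr ()))) p.1 p.2
  refine ⟨RingEquiv.ofRingHom F G ?_ ?_, ?_⟩
  · refine MvPolynomial.ringHom_ext (fun r => ?_) ?_
    · simp [F, G]
    · rintro ⟨i | i, j | j⟩ <;> simp [F, G]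
  · refine MvPolynomial.ringHom_ext' (MvPolynomial.ringHom_ext' ?_ ?_) ?_
    · ext; simp [F, G]
    · rintro ((i | i) | i) <;> simp [F, G]
    · intro i; simp [F, G]
  · ext1 i j
    rcases i with i | i <;> rcases j with j | j <;> simp [F]

theorem isFaithfulEntry_mvPolynomialX_sum {k : Type*} [CommRing k] {ι : Type*} [Fintype ι]
    [DecidableEq ι] (hι : 2 ≤ Fintype.card ι) {p q : ι}
    (h : IsFaithfulEntry (mvPolynomialX ι ι (MvPolynomial ((ι ⊕ ι) ⊕ Unit) k)) p q) :
    IsFaithfulEntry (mvPolynomialX (ι ⊕ Unit) (ι ⊕ Unit) k) (Sum.inl p) (Sum.inl q) := by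
  have : Nonempty ι := ⟨p⟩
  obtain ⟨e, he⟩ := exists_blockEquiv k ι
  have hreg : IsRegularOnBoundaries (border (mvPolynomialX ι ι _)
      (fun i => C (X (Sum.inl (Sum.inl i)))) (fun i => C (X (Sum.inl (Sum.inr i))))
      (C (X (Sum.inr ())))) (C (X (R := k) (Sum.inr () : (ι ⊕ ι) ⊕ Unit))) := by
    have h1 := (isRegularOnBoundaries_X k (κ := ι ⊕ Unit) (by simpa using hι) (Sum.inr ())
      (Sum.inr ())).map_submatrix e.symm (Equiv.refl _) (Equiv.refl _)
    have h2 := congrFun (congrFun he (Sum.inr ())) (Sum.inr ())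
    simp only [Matrix.map_apply, border_inr_inr, mvPolynomialX_apply] at h2
    rw [← h2, RingEquiv.symm_apply_apply, ← he] at h1
    convert h1
    ext1 i j
    simp
  obtain ⟨l, l', q₁, q', hr, -⟩ :=
    (isGood_mvPolynomialX (MvPolynomial ((ι ⊕ ι) ⊕ Unit) k) ι).regular
  obtain ⟨m, m', t, t', hr', -⟩ := (isGood_mvPolynomialX k (ι ⊕ Unit)).regular
  have hr'' := hr'.map_submatrix e.symm (Equiv.refl _)
  have hdet := hr''.det
  have hX : ((mvPolynomialX (ι ⊕ Unit) (ι ⊕ Unit) k).map e.symm).submatrix (Equiv.refl _)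
      (Equiv.refl _) = border (mvPolynomialX ι ι _)
      (fun i => C (X (Sum.inl (Sum.inl i)))) (fun i => C (X (Sum.inl (Sum.inr i))))
      (C (X (Sum.inr ()))) := by
    rw [← he]; ext1 i j; simp
  rw [hX] at hdet
  have h3 := IsFaithfulEntry.border
    (φ := eval₂Hom C (fun p : ι × ι => C (X (R := k) (Sum.inr () : (ι ⊕ ι) ⊕ Unit)) * X p -
      C (X (Sum.inl (Sum.inl p.1)) * X (Sum.inl (Sum.inr p.2)))))
    (eval₂Hom_affine_injective (fun d hd => 
      (isRegular_X (R := k) (n := (Sum.inr () : (ι ⊕ ι) ⊕ Unit))).left (hd.trans (mul_zero _).symm)) _)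
    (x' := C (X (Sum.inr ()))) (eval₂Hom_C _ _ _)
    (exists_pow_mul_eq_eval₂Hom_affine _ _) (Y := mvPolynomialX ι ι _)
    (X₀ := mvPolynomialX ι ι _) (by ext1 i j; simp [vecMulVec_apply])
    (IsRegularModulo.bot_iff.1 hr.det) (IsRegularModulo.bot_iff.1 hdet) hreg h
  have h4 := h3.map_submatrix e (Equiv.refl _)
  rw [he] at h4
  exact h4

theorem isFaithfulEntry_mvPolynomialX_fin (m : ℕ) : ∀ (k : Type*) [CommRing k] {r s : Fin (m + 2)},
    r ≠ s → IsFaithfulEntry (mvPolynomialX (Fin (m + 2)) (Fin (m + 2)) k) r s := by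
  induction m with
  | zero =>
    intro k _ r s hrs
    have hG := isGood_mvPolynomialX k (Fin 2)
    obtain ⟨l, l', q₁, q', hr, -⟩ := hG.regular
    exact isFaithfulEntry_fin_two (IsRegularModulo.bot_iff.1 hr.det) hG.alternating hrs
  | succ m ih =>
    intro k _ r s hrs
    obtain ⟨i, hi⟩ : ∃ i, i ∉ ({r, s} : Finset (Fin (m + 3))) := by
      by_contra! h
      have h1 := Finset.card_le_card (fun i _ => h i : Finset.univ ⊆ _)
      have h2 := h1.trans Finset.card_le_two
      simp at h2
    simp only [Finset.mem_insert, Finset.mem_singleton, not_or] at hi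
    obtain ⟨f, hf⟩ := Equiv.exists_apply_eq ((finSumFinEquiv (m := m + 2) (n := 1)).symm.trans
          (Equiv.sumCongr (Equiv.refl _) (Equiv.ofUnique (Fin 1) Unit))) i (Sum.inr ())
    have hinl : ∀ t, i ≠ t → ∃ p, f t = Sum.inl p := by
      intro t ht
      rcases hft : f t with p | p
      · exact ⟨p, rfl⟩
      · exact absurd (f.injective (hf.trans hft.symm)) ht
    obtain ⟨p, hp⟩ := hinl r hi.1
    obtain ⟨q, hq⟩ := hinl s hi.2
    have hpq : p ≠ q := fun h => hrs (f.injective (by rw [hp, hq, h]))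
    have h1 := isFaithfulEntry_mvPolynomialX_sum (k := k) (by simp) (ih _ hpq)
    have h2 := h1.map_submatrix (renameEquiv k (f.symm.prodCongr f.symm)).toRingEquiv f
    rw [map_submatrix_mvPolynomialX, ← hp, ← hq, f.symm_apply_apply, f.symm_apply_apply] at h2
    exact h2

end GenericFaithful

section Minors

variable {S : Type*} [CommRing S]

/-- A strictly monotone map `Fin (m + 1) → Fin (m + 2)` omits exactly one value. -/
lemma StrictMono.exists_eq_succAbove {m : ℕ} {f : Fin (m + 1) → Fin (m + 2)}
    (hf : StrictMono f) : ∃ p : Fin (m + 2), f = p.succAbove := by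
  have hcard : ((Finset.univ.image f)ᶜ).card = 1 := by
    rw [Finset.card_compl, Finset.card_image_of_injective _ hf.injective]
    simp
  obtain ⟨p, hp⟩ := Finset.card_eq_one.1 hcard
  refine ⟨p, (hf.range_inj (Fin.strictMono_succAbove p)).1 ?_⟩
  rw [Fin.range_succAbove]
  have := congrArg (fun s : Finset (Fin (m + 2)) => (s : Set (Fin (m + 2)))ᶜ) hp
  simpa using this

lemma span_minors_eq_adjugateIdeal {m : ℕ} (X : Matrix (Fin (m + 2)) (Fin (m + 2)) S) :
    Ideal.span { d | ∃ f g : Fin (m + 1) → Fin (m + 2), StrictMono f ∧ StrictMono g ∧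
      d = (X.submatrix f g).det } = adjugateIdeal X := by
  refine le_antisymm (Ideal.span_le.2 ?_) (Ideal.span_le.2 ?_)
  · rintro _ ⟨f, g, hf, hg, rfl⟩
    obtain ⟨p, rfl⟩ := hf.exists_eq_succAbove
    obtain ⟨q, rfl⟩ := hg.exists_eq_succAbove
    have h : (X.submatrix p.succAbove q.succAbove).det
        = (-1) ^ (p + q : ℕ) * X.adjugate q p := by
      rw [adjugate_fin_succ_eq_det_submatrix, ← mul_assoc, ← mul_pow]
      simp
    rw [SetLike.mem_coe, h]
    exact Ideal.mul_mem_left _ _ (adjugate_mem_adjugateIdeal X q p)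
  · rintro _ ⟨⟨q, p⟩, rfl⟩
    change X.adjugate q p ∈ Ideal.span _
    rw [adjugate_fin_succ_eq_det_submatrix]
    exact Ideal.mul_mem_left _ _ (Ideal.subset_span
      ⟨_, _, Fin.strictMono_succAbove p, Fin.strictMono_succAbove q, rfl⟩)

/-- The signed minor of `X` complementary to the rows `r, s` and the columns `k, l`. -/
def complementaryMinor {ι : Type*} [Fintype ι] [DecidableEq ι] (X : Matrix ι ι S)
    (r s k l : ι) : S :=
  (X.updateCol k (Pi.single r 1)).adjugate l s

lemma complementaryMinor_eq_det {ι : Type*} [Fintype ι] [DecidableEq ι] (X : Matrix ι ι S)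
    (r s k l : ι) : complementaryMinor X r s k l =
      ((X.updateCol k (Pi.single r 1)).updateCol l (Pi.single s 1)).det := by
  rw [det_updateCol_eq, Matrix.mulVec_single_one]
  rfl

lemma complementaryMinor_swap {ι : Type*} [Fintype ι] [DecidableEq ι] {X : Matrix ι ι S}
    (hX : ∀ c, c * X.det = 0 → c = 0) {k l : ι} (hkl : k ≠ l) (r s : ι) :
    complementaryMinor X r s l k = -complementaryMinor X r s k l := by
  have h₁ := adjugate_mul_adjugate_sub X hkl r s
  have h₂ := adjugate_mul_adjugate_sub X hkl.symm r s
  have := hX (complementaryMinor X r s l k + complementaryMinor X r s k l) (by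
    simp only [complementaryMinor]
    linear_combination -h₁ - h₂)
  exact eq_neg_of_add_eq_zero_left this

/-- The equivalence onto `Fin (m + 2)` given by an injection of `Fin m` and the two remaining
elements. -/
lemma exists_equiv_of_range_eq_compl {m : ℕ} {f : Fin m → Fin (m + 2)} (hf : StrictMono f)
    {r s : Fin (m + 2)} (hrs : r ≠ s) (hr : Set.range f = ({r, s} : Set (Fin (m + 2)))ᶜ) :
    ∃ ρ : Fin m ⊕ Fin 2 ≃ Fin (m + 2), (ρ : Fin m ⊕ Fin 2 → Fin (m + 2)) = Sum.elim f ![r, s] := by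
  have hf' : ∀ i, f i ≠ r ∧ f i ≠ s := fun i => by
    have : f i ∈ ({r, s} : Set (Fin (m + 2)))ᶜ := hr ▸ Set.mem_range_self i
    simpa using this
  have hinj : Function.Injective (Sum.elim f ![r, s]) := by
    refine Function.Injective.sumElim hf.injective ?_ ?_
    · intro a b h
      fin_cases a <;> fin_cases b <;> simp_all [eq_comm]
    · intro i j
      fin_cases j
      exacts [(hf' i).1, (hf' i).2]
  exact ⟨Equiv.ofBijective _ ((Fintype.bijective_iff_injective_and_card _).2
    ⟨hinj, by simp⟩), rfl⟩

lemma det_submatrix_eq_complementaryMinor {m : ℕ} (X : Matrix (Fin (m + 2)) (Fin (m + 2)) S)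
    {f g : Fin m → Fin (m + 2)} (hf : StrictMono f) (hg : StrictMono g)
    {r s k l : Fin (m + 2)} (hrs : r ≠ s) (hkl : k ≠ l)
    (hfr : Set.range f = ({r, s} : Set (Fin (m + 2)))ᶜ)
    (hgr : Set.range g = ({k, l} : Set (Fin (m + 2)))ᶜ) :
    ∃ ε : ℤˣ, (X.submatrix f g).det = ((ε : ℤ) : S) * complementaryMinor X r s k l := by
  obtain ⟨ρ, hρ⟩ := exists_equiv_of_range_eq_compl hf hrs hfr
  obtain ⟨γ, hγ⟩ := exists_equiv_of_range_eq_compl hg hkl hgr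
  have hf' : ∀ i, f i ≠ r ∧ f i ≠ s := fun i => by
    have : f i ∈ ({r, s} : Set (Fin (m + 2)))ᶜ := hfr ▸ Set.mem_range_self i
    simpa using this
  have hg' : ∀ i, g i ≠ k ∧ g i ≠ l := fun i => by
    have : g i ∈ ({k, l} : Set (Fin (m + 2)))ᶜ := hgr ▸ Set.mem_range_self i
    simpa using this
  set M := (X.updateCol k (Pi.single r 1)).updateCol l (Pi.single s 1) with hM
  have hblock : M.submatrix ρ γ = fromBlocks (X.submatrix f g) 0
      (M.submatrix ![r, s] g) (1 : Matrix (Fin 2) (Fin 2) S) := by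
    rw [hρ, hγ]
    ext (i | i) (j | j)
    · simp only [submatrix_apply, Sum.elim_inl, fromBlocks_apply₁₁]
      simp [hM, (hg' j).1, (hg' j).2]
    · simp only [submatrix_apply, Sum.elim_inl, Sum.elim_inr, fromBlocks_apply₁₂]
      fin_cases j <;> simp [hM, hkl, (hf' i).1, (hf' i).2]
    · simp only [submatrix_apply, Sum.elim_inl, Sum.elim_inr, fromBlocks_apply₂₁]
    · simp only [submatrix_apply, Sum.elim_inr, fromBlocks_apply₂₂]
      fin_cases i <;> fin_cases j <;> simp [hM, hkl, hrs, hrs.symm]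
  have hdet : (X.submatrix f g).det = (M.submatrix ρ γ).det := by
    rw [hblock, det_fromBlocks_zero₁₂, det_one, mul_one]
  refine ⟨Equiv.Perm.sign (ρ.symm.trans γ), ?_⟩
  have h : M.submatrix ρ γ = (M.submatrix id (ρ.symm.trans γ)).submatrix ρ ρ := by
    ext i j
    simp
  rw [hdet, complementaryMinor_eq_det, ← hM, h, det_submatrix_equiv_self, det_permute']

lemma exists_strictMono_range_eq_compl {m : ℕ} {k l : Fin (m + 2)} (hkl : k ≠ l) :
    ∃ g : Fin m → Fin (m + 2), StrictMono g ∧ Set.range g = ({k, l} : Set (Fin (m + 2)))ᶜ := by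
  have hcard : (({k, l} : Finset (Fin (m + 2)))ᶜ).card = m := by
    rw [Finset.card_compl, Finset.card_pair hkl]
    simp
  refine ⟨_, (Finset.orderEmbOfFin _ hcard).strictMono, ?_⟩
  rw [Finset.range_orderEmbOfFin, Finset.coe_compl, Finset.coe_pair]

/-- The minors complementary to the rows `r, s` generate the same ideal as the complementary
minors with their signs. -/
lemma span_rowMinors_eq {m : ℕ} {X : Matrix (Fin (m + 2)) (Fin (m + 2)) S}
    (hX : ∀ c, c * X.det = 0 → c = 0) {r s : Fin (m + 2)} (hrs : r ≠ s) :
    Ideal.span { d | ∃ k l : Fin (m + 2), k < l ∧ ∃ f g : Fin m → Fin (m + 2),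
      StrictMono f ∧ StrictMono g ∧ Set.range f = ({r, s} : Set (Fin (m + 2)))ᶜ ∧
      Set.range g = ({k, l} : Set (Fin (m + 2)))ᶜ ∧ d = (X.submatrix f g).det } =
    Ideal.span { d | ∃ k l : Fin (m + 2), k ≠ l ∧ d = complementaryMinor X r s k l } := by
  refine le_antisymm (Ideal.span_le.2 ?_) (Ideal.span_le.2 ?_)
  · rintro _ ⟨k, l, hkl, f, g, hf, hg, hfr, hgr, rfl⟩
    obtain ⟨ε, hε⟩ := det_submatrix_eq_complementaryMinor X hf hg hrs hkl.ne hfr hgr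
    rw [SetLike.mem_coe, hε]
    exact Ideal.mul_mem_left _ _ (Ideal.subset_span ⟨k, l, hkl.ne, rfl⟩)
  · suffices h : ∀ k l : Fin (m + 2), k < l → complementaryMinor X r s k l ∈
        Ideal.span { d | ∃ k l : Fin (m + 2), k < l ∧ ∃ f g : Fin m → Fin (m + 2),
          StrictMono f ∧ StrictMono g ∧ Set.range f = ({r, s} : Set (Fin (m + 2)))ᶜ ∧
          Set.range g = ({k, l} : Set (Fin (m + 2)))ᶜ ∧ d = (X.submatrix f g).det } by
      rintro _ ⟨k, l, hkl, rfl⟩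
      rcases hkl.lt_or_gt with hlt | hlt
      · exact h k l hlt
      · rw [SetLike.mem_coe, complementaryMinor_swap hX hkl.symm]
        exact neg_mem (h l k hlt)
    intro k l hkl
    obtain ⟨f, hf, hfr⟩ := exists_strictMono_range_eq_compl hrs
    obtain ⟨g, hg, hgr⟩ := exists_strictMono_range_eq_compl hkl.ne
    obtain ⟨ε, hε⟩ := det_submatrix_eq_complementaryMinor X hf hg hrs hkl.ne hfr hgr
    have hε' : complementaryMinor X r s k l = ((ε : ℤ) : S) * (X.submatrix f g).det := by
      rw [hε, ← mul_assoc, ← Int.cast_mul, ← Units.val_mul, Int.units_mul_self]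
      simp
    rw [hε']
    exact Ideal.mul_mem_left _ _ (Ideal.subset_span ⟨k, l, hkl, f, g, hf, hg, hfr, hgr, rfl⟩)

end Minors

section CocyclePairs

variable {S : Type*} [CommRing S] {ι : Type*} [Fintype ι] [DecidableEq ι]

/-- The pairs `(B, C)` with `B * adj X = Xᵀ * C`.  The first components represent the classes
in `Ext¹(L, L^∨)`. -/
def cocyclePairs (X : Matrix ι ι S) : Submodule S (Matrix ι ι S × Matrix ι ι S) where
  carrier := {p | p.1 * X.adjugate = Xᵀ * p.2}
  add_mem' {p q} hp hq := by
    simp only [Set.mem_ofPred_eq] at hp hq ⊢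
    rw [Prod.fst_add, Prod.snd_add, Matrix.add_mul, Matrix.mul_add, hp, hq]
  zero_mem' := by simp
  smul_mem' c p hp := by
    simp only [Set.mem_ofPred_eq] at hp ⊢
    rw [Prod.smul_fst, Prod.smul_snd, Matrix.smul_mul, Matrix.mul_smul, hp]

/-- The `(r, s)` entry of the second component, modulo the ideal `I`. -/
def cocycleEntry (X : Matrix ι ι S) (I : Ideal S) (r s : ι) : cocyclePairs X →ₗ[S] S ⧸ I :=
  I.mkQ.comp ((LinearMap.proj s).comp ((LinearMap.proj r).comp
    ((LinearMap.snd S (Matrix ι ι S) (Matrix ι ι S)).comp (cocyclePairs X).subtype)))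

lemma cocycleEntry_apply (X : Matrix ι ι S) (I : Ideal S) (r s : ι) (p : cocyclePairs X) :
    cocycleEntry X I r s p = Ideal.Quotient.mk I (p.1.2 r s) := rfl

variable {X : Matrix ι ι S} (hX : ∀ c, c * X.det = 0 → c = 0)
include hX

lemma cocyclePairs_snd_unique {B C C' : Matrix ι ι S} (h : B * X.adjugate = Xᵀ * C)
    (h' : B * X.adjugate = Xᵀ * C') : C = C' := by
  refine det_smul_cancel_matrix hX ?_
  rw [← Matrix.one_mul C, ← Matrix.one_mul C', ← Matrix.smul_mul, ← Matrix.smul_mul,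
    ← det_transpose, ← adjugate_mul, Matrix.mul_assoc, Matrix.mul_assoc, ← h, ← h']

lemma IsBoundary.mem_adjugateIdeal {B C : Matrix ι ι S} (hB : IsBoundary X B)
    (h : B * X.adjugate = Xᵀ * C) (r s : ι) : C r s ∈ adjugateIdeal X := by
  obtain ⟨M, M', rfl⟩ := hB
  have h' : (Xᵀ * M + M' * X) * X.adjugate
      = Xᵀ * (M * X.adjugate + X.adjugateᵀ * M') := by
    rw [Matrix.add_mul, Matrix.mul_assoc, Matrix.mul_assoc, mul_adjugate, Matrix.mul_add,
      ← Matrix.mul_assoc Xᵀ, ← Matrix.mul_assoc Xᵀ, adjugate_transpose, mul_adjugate,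
      det_transpose, Matrix.smul_mul, Matrix.mul_smul, Matrix.one_mul, Matrix.mul_one]
  rw [cocyclePairs_snd_unique hX h h', Matrix.add_apply]
  refine add_mem (mul_adjugate_mem_adjugateIdeal X M r s) ?_
  rw [adjugate_transpose, ← adjugateIdeal_transpose]
  exact adjugate_mul_mem_adjugateIdeal Xᵀ M' r s

lemma cocycleEntry_eq_zero_iff {r s : ι} (hF : IsFaithfulEntry X r s) (p : cocyclePairs X) :
    cocycleEntry X (adjugateIdeal X) r s p = 0 ↔ IsBoundary X p.1.1 := by
  rw [cocycleEntry_apply, Ideal.Quotient.eq_zero_iff_mem]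
  exact ⟨hF _ _ p.2, fun h => h.mem_adjugateIdeal hX p.2 r s⟩

/-- The entries of the second component of an alternating cocycle. -/
lemma entry_eq_sum_complementaryMinor {U C : Matrix ι ι S}
    (h : (U - Uᵀ) * X.adjugate = Xᵀ * C) (r s : ι) :
    C r s = ∑ k, ∑ l, if k = l then 0 else U k l * complementaryMinor X r s k l := by
  refine sub_eq_zero.1 (hX _ ?_)
  have h₁ : X.det • C = X.adjugateᵀ * (U - Uᵀ) * X.adjugate := by
    rw [Matrix.mul_assoc, h, ← Matrix.mul_assoc, adjugate_transpose, adjugate_mul,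
      det_transpose, Matrix.smul_mul, Matrix.one_mul]
  have h₂ := congrFun (congrFun h₁ r) s
  rw [transpose_mul_sub_transpose_mul_apply, Matrix.smul_apply, smul_eq_mul] at h₂
  rw [sub_mul, mul_comm, h₂, sub_eq_zero, Finset.sum_mul]
  refine Finset.sum_congr rfl fun k _ => ?_
  rw [Finset.sum_mul]
  refine Finset.sum_congr rfl fun l _ => ?_
  split_ifs with hkl
  · subst hkl
    ring
  · rw [adjugate_mul_adjugate_sub X hkl, complementaryMinor]
    ring

lemma map_cocycleEntry_range {r s : ι} (hA : HasAlternatingRepresentatives X) :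
    Set.range (cocycleEntry X (adjugateIdeal X) r s) =
      (Ideal.span { d | ∃ k l : ι, k ≠ l ∧ d = complementaryMinor X r s k l }).map
        (Ideal.Quotient.mk (adjugateIdeal X)) := by
  set J := Ideal.span { d | ∃ k l : ι, k ≠ l ∧ d = complementaryMinor X r s k l } with hJ
  refine Set.Subset.antisymm ?_ ?_
  · rintro _ ⟨⟨⟨B, C⟩, hBC⟩, rfl⟩
    change B * X.adjugate = Xᵀ * C at hBC
    obtain ⟨D, hD, hb⟩ := hA B C hBC
    obtain ⟨C', -, hC'⟩ := hD.exists_mul_adjugate hX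
    have hdiff : (B - D) * X.adjugate = Xᵀ * (C - C') := by
      rw [Matrix.sub_mul, Matrix.mul_sub, hBC, hC']
    have hmem := hb.mem_adjugateIdeal hX hdiff r s
    obtain ⟨U, rfl⟩ := hD.exists_eq_sub
    have hC'J : C' r s ∈ J := by
      rw [entry_eq_sum_complementaryMinor hX hC' r s]
      refine Ideal.sum_mem _ fun k _ => Ideal.sum_mem _ fun l _ => ?_
      split_ifs with hkl
      · exact zero_mem _
      · exact Ideal.mul_mem_left _ _ (Ideal.subset_span ⟨k, l, hkl, rfl⟩)
    have heq : Ideal.Quotient.mk (adjugateIdeal X) (C r s)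
        = Ideal.Quotient.mk (adjugateIdeal X) (C' r s) := Ideal.Quotient.eq.2 hmem
    rw [cocycleEntry_apply]
    simp only [heq]
    exact Ideal.mem_map_of_mem _ hC'J
  · intro x hx
    obtain ⟨y, hy, rfl⟩ := (Ideal.mem_map_iff_of_surjective _ Ideal.Quotient.mk_surjective).1 hx
    suffices h : J ≤ (LinearMap.range (cocycleEntry X (adjugateIdeal X) r s)).comap
        (adjugateIdeal X).mkQ from h hy
    refine Ideal.span_le.2 ?_
    rintro _ ⟨k, l, hkl, rfl⟩
    set U : Matrix ι ι S := Matrix.single k l 1 with hU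
    have hD : IsAlternating (U - Uᵀ) := by
      refine ⟨?_, fun i => ?_⟩
      · rw [transpose_sub, transpose_transpose, neg_sub]
      · rw [Matrix.sub_apply, transpose_apply, sub_self]
    obtain ⟨C, -, hC⟩ := hD.exists_mul_adjugate hX
    refine ⟨⟨(U - Uᵀ, C), hC⟩, ?_⟩
    rw [cocycleEntry_apply]
    simp only
    rw [entry_eq_sum_complementaryMinor hX hC r s, Finset.sum_eq_single k, Finset.sum_eq_single l,
      if_neg hkl, hU, single_apply_same, one_mul]
    · rfl
    · intro l' _ hl'
      rw [hU, single_apply_of_col_ne _ _ hl'.symm, zero_mul, ite_self]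
    · simp
    · intro k' _ hk'
      refine Finset.sum_eq_zero fun l' _ => ?_
      rw [hU, single_apply_of_row_ne hk'.symm, zero_mul, ite_self]
    · simp

end CocyclePairs

/-- Two surjective additive maps with the same kernel have isomorphic targets. -/
lemma exists_addEquiv_of_ker_eq {W E J : Type*} [AddCommGroup W] [AddCommGroup E]
    [AddCommGroup J] (π : W →+ E) (ψ : W →+ J) (hπ : Function.Surjective π)
    (hψ : Function.Surjective ψ) (h : ∀ w, π w = 0 ↔ ψ w = 0) :
    ∃ e : E ≃+ J, ∀ w, e (π w) = ψ w := by
  have hker : π.ker = ψ.ker := by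
    ext w
    exact h w
  let eπ := QuotientAddGroup.quotientKerEquivOfSurjective π hπ
  refine ⟨eπ.symm.trans ((QuotientAddGroup.quotientAddEquivOfEq hker).trans
    (QuotientAddGroup.quotientKerEquivOfSurjective ψ hψ)), fun w => ?_⟩
  have : eπ.symm (π w) = (w : W ⧸ π.ker) := eπ.symm_apply_eq.2 rfl
  simp only [AddEquiv.trans_apply, this]
  rfl

section PeriodicResolution

universe u

open Limits

variable {R : Type u} [CommRing R] {F : Type u} [AddCommGroup F] [Module R F]

/-- The `2`-periodic complex `⋯ → F → F → F → 0`, with differentials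
alternating between `f` and `g` and ending in `f`. -/
def periodicComplex (f g : F →ₗ[R] F) (hfg : f ∘ₗ g = 0) (hgf : g ∘ₗ f = 0) :
    ChainComplex (ModuleCat.{u} R) ℕ :=
  HomologicalComplex.alternatingConst (ModuleCat.of R F) (φ := ModuleCat.ofHom g)
    (ψ := ModuleCat.ofHom f) (by rw [← ModuleCat.ofHom_comp, hfg]; rfl)
    (by rw [← ModuleCat.ofHom_comp, hgf]; rfl) fun _ _ => ComplexShape.down_nat_odd_add

variable {f g : F →ₗ[R] F} (hfg : f ∘ₗ g = 0) (hgf : g ∘ₗ f = 0)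

lemma periodicComplex_d_odd (m : ℕ) (hm : Even m) :
    (periodicComplex f g hfg hgf).d (m + 1) m = ModuleCat.ofHom f := by
  have h : ¬ Even (m + 1) := by simpa [Nat.even_add_one] using hm
  simp [periodicComplex, HomologicalComplex.alternatingConst, h]

lemma periodicComplex_d_even (m : ℕ) (hm : Odd m) :
    (periodicComplex f g hfg hgf).d (m + 1) m = ModuleCat.ofHom g := by
  have h : Even (m + 1) := by simpa [Nat.even_add_one] using hm
  simp [periodicComplex, HomologicalComplex.alternatingConst, h]

def periodicComplexπ : periodicComplex f g hfg hgf ⟶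
    (ChainComplex.single₀ (ModuleCat.{u} R)).obj (ModuleCat.of R (F ⧸ LinearMap.range f)) :=
  ((periodicComplex f g hfg hgf).toSingle₀Equiv _).symm
    ⟨ModuleCat.ofHom (LinearMap.range f).mkQ, by
      rw [periodicComplex_d_odd hfg hgf 0 (by simp)]
      ext x
      exact (Submodule.Quotient.mk_eq_zero _).2 ⟨x, rfl⟩⟩

lemma periodicComplexπ_f_zero : (periodicComplexπ hfg hgf).f 0 =
    ModuleCat.ofHom (LinearMap.range f).mkQ :=
  ChainComplex.toSingle₀Equiv_symm_apply_f_zero _ _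

lemma quasiIso_periodicComplexπ (hf : LinearMap.range g = LinearMap.ker f)
    (hg : LinearMap.range f = LinearMap.ker g) : QuasiIso (periodicComplexπ hfg hgf) where
  quasiIsoAt m := by
    induction m with
    | zero =>
      rw [ChainComplex.quasiIsoAt₀_iff, ShortComplex.quasiIso_iff_of_zeros' _ rfl rfl rfl]
      constructor
      · rw [ShortComplex.moduleCat_exact_iff_range_eq_ker]
        change LinearMap.range ((periodicComplex f g hfg hgf).d 1 0).hom
          = LinearMap.ker ((periodicComplexπ hfg hgf).f 0).hom
        rw [periodicComplexπ_f_zero, periodicComplex_d_odd hfg hgf 0 (by simp)]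
        exact (Submodule.ker_mkQ _).symm
      · rw [ModuleCat.epi_iff_surjective]
        change Function.Surjective ((periodicComplexπ hfg hgf).f 0)
        rw [periodicComplexπ_f_zero]
        exact Submodule.mkQ_surjective _
    | succ m _ =>
      rw [quasiIsoAt_iff_exactAt' (hL := ChainComplex.exactAt_succ_single_obj ..),
          HomologicalComplex.exactAt_iff' _ (m + 2) (m + 1) m (by simp) (by simp),
          ShortComplex.moduleCat_exact_iff_range_eq_ker]
      change LinearMap.range ((periodicComplex f g hfg hgf).d (m + 2) (m + 1)).hom
        = LinearMap.ker ((periodicComplex f g hfg hgf).d (m + 1) m).hom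
      by_cases hm : Even m
      · rw [periodicComplex_d_odd hfg hgf m hm, periodicComplex_d_even hfg hgf (m + 1) hm.add_one]
        exact hf
      · rw [Nat.not_even_iff_odd] at hm
        rw [periodicComplex_d_even hfg hgf m hm, periodicComplex_d_odd hfg hgf (m + 1) hm.add_one]
        exact hg

def periodicResolution [Module.Free R F] (hf : LinearMap.range g = LinearMap.ker f)
    (hg : LinearMap.range f = LinearMap.ker g) :
    ProjectiveResolution (ModuleCat.of R (F ⧸ LinearMap.range f)) where
  complex := periodicComplex f g hfg hgf
  projective _ := ModuleCat.projective_of_free (Module.Free.chooseBasis R F)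
  π := periodicComplexπ hfg hgf
  quasiIso := quasiIso_periodicComplexπ hfg hgf hf hg

/-- The homology of a short complex of modules is its cycles modulo its boundaries. -/
lemma exists_cycles_surjection (T : ShortComplex (ModuleCat.{u} R)) {E : ModuleCat.{u} R}
    (i : E ≅ T.homology) : ∃ π : LinearMap.ker T.g.hom →ₗ[R] E, Function.Surjective π ∧
      ∀ x, π x = 0 ↔ ∃ y, T.f.hom y = x := by
  let j : (LinearMap.ker T.g.hom ⧸ LinearMap.range T.moduleCatToCycles) ≃ₗ[R] E :=
    (i ≪≫ T.moduleCatHomologyIso).symm.toLinearEquiv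
  refine ⟨j.toLinearMap ∘ₗ (LinearMap.range T.moduleCatToCycles).mkQ,
    j.surjective.comp (Submodule.mkQ_surjective _), fun x => ?_⟩
  rw [LinearMap.comp_apply, LinearEquiv.coe_coe, j.map_eq_zero_iff, Submodule.mkQ_apply,
    Submodule.Quotient.mk_eq_zero, LinearMap.mem_range]
  simp only [Subtype.ext_iff]
  rfl

/-- `Ext¹(coker f, N)` is the module of maps `F → N` vanishing on `range g`, modulo those which
extend along `f`. -/
lemma exists_ext_surjection [Module.Free R F] (hf : LinearMap.range g = LinearMap.ker f)
    (hg : LinearMap.range f = LinearMap.ker g) (N : Type u) [AddCommGroup N] [Module R N] :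
    ∃ π : LinearMap.ker (LinearMap.lcomp R N g) →ₗ[R] (((Ext R (ModuleCat.{u} R) 1).obj
        (Opposite.op (ModuleCat.of R (F ⧸ LinearMap.range f)))).obj (ModuleCat.of R N)),
      Function.Surjective π ∧ ∀ h, π h = 0 ↔ ∃ h', h.1 = h' ∘ₗ f := by
  have hfg : f ∘ₗ g = 0 := LinearMap.range_le_ker_iff.1 hf.le
  have hgf : g ∘ₗ f = 0 := LinearMap.range_le_ker_iff.1 hg.le
  let P := periodicResolution hfg hgf hf hg
  let Q := P.complex.linearYonedaObj R (ModuleCat.of R N)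
  obtain ⟨π, hπ, hπ₀⟩ := exists_cycles_surjection (Q.sc' 0 1 2)
    (P.isoExt 1 (ModuleCat.of R N) ≪≫ ShortComplex.homologyMapIso (Q.isoSc' 0 1 2
      (by simp) (by simp)))
  have hd₁ : P.complex.d 1 0 = ModuleCat.ofHom f := periodicComplex_d_odd hfg hgf 0 (by simp)
  have hd₂ : P.complex.d 2 1 = ModuleCat.ofHom g := periodicComplex_d_even hfg hgf 1 (by simp)
  have hQ₁ : ∀ y : F →ₗ[R] N, (Q.sc' 0 1 2).f.hom (ModuleCat.ofHom y : ModuleCat.of R F ⟶ _) =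
      (ModuleCat.ofHom (y ∘ₗ f) : ModuleCat.of R F ⟶ _) := fun y => by
    change P.complex.d 1 0 ≫ (ModuleCat.ofHom y : ModuleCat.of R F ⟶ _) = _
    rw [hd₁]
    rfl
  have hQ₂ : ∀ y : F →ₗ[R] N, (Q.sc' 0 1 2).g.hom (ModuleCat.ofHom y : ModuleCat.of R F ⟶ _) =
      (ModuleCat.ofHom (y ∘ₗ g) : ModuleCat.of R F ⟶ _) := fun y => by
    change P.complex.d 2 1 ≫ (ModuleCat.ofHom y : ModuleCat.of R F ⟶ _) = _
    rw [hd₂]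
    rfl
  let θ : LinearMap.ker (LinearMap.lcomp R N g) →ₗ[R] LinearMap.ker (Q.sc' 0 1 2).g.hom :=
    { toFun := fun h => ⟨(ModuleCat.ofHom h.1 : ModuleCat.of R F ⟶ _),
        LinearMap.mem_ker.2 ((hQ₂ h.1).trans
          (congrArg ModuleCat.ofHom (LinearMap.mem_ker.1 h.2)))⟩
      map_add' := fun h h' => Subtype.ext (ModuleCat.ofHom_add h.1 h'.1)
      map_smul' := fun _ _ => Subtype.ext rfl }
  refine ⟨π ∘ₗ θ, fun x => ?_, fun h => ?_⟩
  · obtain ⟨⟨y, hy⟩, rfl⟩ := hπ x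
    let y' : ModuleCat.of R F ⟶ ModuleCat.of R N := y
    refine ⟨⟨y'.hom, ?_⟩, rfl⟩
    exact congrArg (fun z : ModuleCat.of R F ⟶ ModuleCat.of R N => z.hom)
      ((hQ₂ y'.hom).symm.trans hy)
  · rw [LinearMap.comp_apply, hπ₀]
    constructor
    · rintro ⟨y, hy⟩
      let y' : ModuleCat.of R F ⟶ ModuleCat.of R N := y
      exact ⟨y'.hom, congrArg (fun z : ModuleCat.of R F ⟶ ModuleCat.of R N => z.hom)
        (hy.symm.trans (hQ₁ y'.hom))⟩
    · rintro ⟨h', hh⟩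
      exact ⟨(ModuleCat.ofHom h' : ModuleCat.of R F ⟶ _),
        (hQ₁ h').trans (congrArg ModuleCat.ofHom hh.symm)⟩

end PeriodicResolution

section ExtPresentation

universe u

variable {S : Type u} [CommRing S] {ι : Type} [Fintype ι] [DecidableEq ι]

/-- A matrix over `S` lifting a family of vectors over a quotient of `S`. -/
lemma exists_matrix_map_mk_eq {κ : Type*} (I : Ideal S) (v : κ → ι → S ⧸ I) :
    ∃ C : Matrix ι κ S, ∀ i j, (C.map (Ideal.Quotient.mk I)) i j = v j i := by
  choose C hC using fun (i : ι) (j : κ) => Ideal.Quotient.mk_surjective (v j i)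
  exact ⟨of C, hC⟩

lemma forall_mulVec_mem_range_iff {I : Ideal S} {Y : Matrix ι ι S} (hI : I = Ideal.span {Y.det})
    (P : Matrix ι ι S) :
    (∀ v, P.map (Ideal.Quotient.mk I) *ᵥ v ∈
      LinearMap.range (Y.map (Ideal.Quotient.mk I)).mulVecLin) ↔ ∃ C, P = Y * C := by
  constructor
  · intro h
    choose c hc using fun j : ι => h (Pi.single j 1)
    obtain ⟨C, hC⟩ := exists_matrix_map_mk_eq I c
    have hmem : ∀ i j, Y.det ∣ P i j - (Y * C) i j := fun i j => by
      rw [← Ideal.mem_span_singleton, ← hI, ← Ideal.Quotient.eq]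
      have h₁ := congrFun (hc j) i
      rw [Matrix.mulVec_single_one, mulVecLin_apply] at h₁
      change Ideal.Quotient.mk I (P i j) = _
      rw [show Ideal.Quotient.mk I (P i j) = _ from h₁.symm, Matrix.mul_apply, map_sum]
      refine Finset.sum_congr rfl fun k _ => ?_
      rw [map_mul, ← hC k j]
      rfl
    choose W hW using hmem
    refine ⟨C + Y.adjugate * of W, ?_⟩
    rw [Matrix.mul_add, ← Matrix.mul_assoc, mul_adjugate, Matrix.smul_mul, Matrix.one_mul]
    ext i j
    rw [Matrix.add_apply, Matrix.smul_apply, of_apply, smul_eq_mul, ← hW]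
    ring
  · rintro ⟨C, rfl⟩ v
    rw [Matrix.map_mul, ← mulVec_mulVec]
    exact ⟨_, rfl⟩

/-- A matrix factorization of a regular element gives an exact sequence over the quotient. -/
lemma range_eq_ker_of_mul_eq_smul_one {c : S} (hc : ∀ a, a * c = 0 → a = 0) {I : Ideal S}
    (hI : I = Ideal.span {c}) {Y Z : Matrix ι ι S} (hYZ : Y * Z = c • 1) (hZY : Z * Y = c • 1) :
    LinearMap.range (Z.map (Ideal.Quotient.mk I)).mulVecLin =
      LinearMap.ker (Y.map (Ideal.Quotient.mk I)).mulVecLin := by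
  have hcI : Ideal.Quotient.mk I c = 0 := by
    rw [Ideal.Quotient.eq_zero_iff_mem, hI]
    exact Ideal.mem_span_singleton_self c
  refine le_antisymm ?_ fun v hv => ?_
  · rw [LinearMap.range_le_ker_iff, ← mulVecLin_mul, ← Matrix.map_mul, hYZ]
    refine LinearMap.ext fun v => funext fun i => ?_
    have : (c • (1 : Matrix ι ι S)).map (Ideal.Quotient.mk I) = 0 := by
      ext i j
      rw [Matrix.map_apply, Matrix.smul_apply, smul_eq_mul, map_mul, hcI, zero_mul]
      rfl
    rw [this, mulVecLin_apply, Matrix.zero_mulVec]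
    rfl
  · choose w hw using fun i => Ideal.Quotient.mk_surjective (I := I) (v i)
    obtain rfl : (fun i => Ideal.Quotient.mk I (w i)) = v := funext hw
    have h₁ : ∀ i, c ∣ (Y *ᵥ w) i := fun i => by
      rw [← Ideal.mem_span_singleton, ← hI, ← Ideal.Quotient.eq_zero_iff_mem,
        RingHom.map_mulVec]
      exact congrFun hv i
    choose u hu using h₁
    have h₂ : w = Z *ᵥ u := by
      have h₃ : c • w = c • (Z *ᵥ u) := by
        rw [← mulVec_smul, show c • u = Y *ᵥ w from (funext hu).symm, mulVec_mulVec, hZY,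
          smul_mulVec, one_mulVec]
      refine funext fun i => sub_eq_zero.1 (hc _ ?_)
      have := congrFun h₃ i
      simp only [Pi.smul_apply, smul_eq_mul] at this
      linear_combination this
    refine ⟨fun i => Ideal.Quotient.mk I (u i), funext fun i => ?_⟩
    conv_rhs => rw [h₂, RingHom.map_mulVec]
    rfl

/-- Every map out of a free module into the cokernel of a matrix is given by a matrix. -/
lemma exists_eq_mkQ_comp_mulVecLin (I : Ideal S) (q : (ι → S ⧸ I) →ₗ[S ⧸ I] ι → S ⧸ I)
    (h : (ι → S ⧸ I) →ₗ[S ⧸ I] (ι → S ⧸ I) ⧸ LinearMap.range q) :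
    ∃ B : Matrix ι ι S,
      h = (LinearMap.range q).mkQ ∘ₗ (B.map (Ideal.Quotient.mk I)).mulVecLin := by
  choose b hb using fun j : ι => (LinearMap.range q).mkQ_surjective (h (Pi.single j 1))
  obtain ⟨B, hB⟩ := exists_matrix_map_mk_eq I b
  refine ⟨B, LinearMap.pi_ext' fun j => LinearMap.ext_ring ?_⟩
  have : (B.map (Ideal.Quotient.mk I)).col j = b j := funext fun i => hB i j
  rw [LinearMap.comp_apply, LinearMap.comp_apply, LinearMap.comp_apply, LinearMap.single_apply,
    mulVecLin_apply, Matrix.mulVec_single_one, this, hb]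

/-- `Ext¹(L, L^∨)` is the module of cocycle pairs modulo boundaries. -/
lemma exists_ext_surjection_of_matrix {X : Matrix ι ι S} (hX : ∀ c, c * X.det = 0 → c = 0)
    {I : Ideal S} (hI : I = Ideal.span {X.det}) :
    ∃ π : cocyclePairs X →+ (((Ext (S ⧸ I) (ModuleCat.{u} (S ⧸ I)) 1).obj
        (Opposite.op (ModuleCat.of (S ⧸ I) ((ι → S ⧸ I) ⧸
          LinearMap.range (X.map (Ideal.Quotient.mk I)).mulVecLin)))).obj
        (ModuleCat.of (S ⧸ I) ((ι → S ⧸ I) ⧸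
          LinearMap.range (Xᵀ.map (Ideal.Quotient.mk I)).mulVecLin))),
      Function.Surjective π ∧ (∀ (t : S) p, π (t • p) = Ideal.Quotient.mk I t • π p) ∧
      ∀ p, π p = 0 ↔ IsBoundary X p.1.1 := by
  have hIt : I = Ideal.span {Xᵀ.det} := by rw [det_transpose, hI]
  set q := (Xᵀ.map (Ideal.Quotient.mk I)).mulVecLin with hq
  obtain ⟨π, hπ, hπ₀⟩ := exists_ext_surjection (range_eq_ker_of_mul_eq_smul_one hX hI
    (mul_adjugate X) (adjugate_mul X))
    (range_eq_ker_of_mul_eq_smul_one hX hI (adjugate_mul X) (mul_adjugate X))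
    ((ι → S ⧸ I) ⧸ LinearMap.range q)
  have hker : ∀ B : Matrix ι ι S, (LinearMap.range q).mkQ ∘ₗ
      (B.map (Ideal.Quotient.mk I)).mulVecLin ∈
        LinearMap.ker (LinearMap.lcomp (S ⧸ I) ((ι → S ⧸ I) ⧸ LinearMap.range q)
          (X.adjugate.map (Ideal.Quotient.mk I)).mulVecLin) ↔
      ∃ C, B * X.adjugate = Xᵀ * C := fun B => by
    rw [← forall_mulVec_mem_range_iff hIt, LinearMap.mem_ker, LinearMap.lcomp_apply',
      LinearMap.comp_assoc, ← mulVecLin_mul, ← Matrix.map_mul, LinearMap.ext_iff]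
    refine forall_congr' fun v => ?_
    exact Submodule.Quotient.mk_eq_zero _
  let θ : cocyclePairs X →+ LinearMap.ker (LinearMap.lcomp (S ⧸ I)
      ((ι → S ⧸ I) ⧸ LinearMap.range q) (X.adjugate.map (Ideal.Quotient.mk I)).mulVecLin) :=
    { toFun := fun p => ⟨_, (hker p.1.1).2 ⟨_, p.2⟩⟩
      map_zero' := Subtype.ext (by
        change _ ∘ₗ ((0 : Matrix ι ι S).map (Ideal.Quotient.mk I)).mulVecLin = 0
        rw [Matrix.map_zero _ (map_zero _), mulVecLin_zero, LinearMap.comp_zero])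
      map_add' := fun p p' => Subtype.ext (by
        change _ ∘ₗ ((p.1.1 + p'.1.1).map (Ideal.Quotient.mk I)).mulVecLin = _
        rw [Matrix.map_add _ (map_add _), mulVecLin_add, LinearMap.comp_add]
        rfl) }
  have hθ : ∀ (t : S) p, θ (t • p) = Ideal.Quotient.mk I t • θ p := fun t p =>
    Subtype.ext (by
      change _ ∘ₗ ((t • p.1.1).map (Ideal.Quotient.mk I)).mulVecLin =
        Ideal.Quotient.mk I t • (_ ∘ₗ _)
      have : (t • p.1.1).map (Ideal.Quotient.mk I) =
          Ideal.Quotient.mk I t • p.1.1.map (Ideal.Quotient.mk I) := by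
        ext i j
        exact map_mul (Ideal.Quotient.mk I) _ _
      rw [this]
      refine LinearMap.ext fun v => ?_
      rw [LinearMap.smul_apply, LinearMap.comp_apply, LinearMap.comp_apply, mulVecLin_apply,
        mulVecLin_apply, Matrix.smul_mulVec, map_smul])
  refine ⟨π.toAddMonoidHom.comp θ, fun x => ?_, fun t p => ?_, fun p => ?_⟩
  · obtain ⟨⟨h, hh⟩, rfl⟩ := hπ x
    obtain ⟨B, rfl⟩ := exists_eq_mkQ_comp_mulVecLin I q h
    obtain ⟨C, hC⟩ := (hker B).1 hh
    exact ⟨⟨(B, C), hC⟩, rfl⟩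
  · exact (congrArg π (hθ t p)).trans (map_smul π _ _)
  · refine (hπ₀ (θ p)).trans ?_
    have key : ∀ M' : Matrix ι ι S, (LinearMap.range q).mkQ ∘ₗ
          (p.1.1.map (Ideal.Quotient.mk I)).mulVecLin =
        ((LinearMap.range q).mkQ ∘ₗ (M'.map (Ideal.Quotient.mk I)).mulVecLin) ∘ₗ
          (X.map (Ideal.Quotient.mk I)).mulVecLin ↔
        ∃ M, p.1.1 - M' * X = Xᵀ * M := fun M' => by
      rw [← forall_mulVec_mem_range_iff hIt, LinearMap.comp_assoc, ← mulVecLin_mul,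
        ← Matrix.map_mul, LinearMap.ext_iff]
      refine forall_congr' fun v => ?_
      rw [Matrix.map_sub _ (map_sub _), Matrix.sub_mulVec]
      exact Submodule.Quotient.eq _
    constructor
    · rintro ⟨h', hh'⟩
      obtain ⟨M', rfl⟩ := exists_eq_mkQ_comp_mulVecLin I q h'
      obtain ⟨M, hM⟩ := (key M').1 hh'
      exact ⟨M, M', by rw [← hM, sub_add_cancel]⟩
    · rintro ⟨M, M', hM⟩
      exact ⟨_, (key M').2 ⟨M, by rw [hM, add_sub_cancel_right]⟩⟩

end ExtPresentation

set_option synthInstance.maxHeartbeats 1000000 in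
set_option maxHeartbeats 1000000 in
/-- Let `K` be a field, `n ≥ 2`, `R = S/(det X)`, `L = coker(X̄ : Rⁿ → Rⁿ)`
and `L^∨ = coker(X̄ᵀ : Rⁿ → Rⁿ)`.  Fix `r < s`.  Then `Ext¹_R(L, L^∨)` is isomorphic, as an
`S`-module, to the ideal of `S/I_{n-1}(X)` generated by the images of the `(n-2) × (n-2)`
minors of `X` obtained by deleting rows `r, s` and columns `k, l`, for all `k < l`.  The
isomorphism is an additive equivalence compatible with the `S`-scalar actions on both
sides. -/
theorem statement19 (K : Type*) [Field K] (n : ℕ) (hn : 2 ≤ n) (r s : Fin n) (hrs : r < s) :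
    letI R := genericDetRing K n
    letI L := (Fin n → R) ⧸ LinearMap.range (Matrix.mulVecLin (matBar (genericMatrix K n)))
    letI Ldual := (Fin n → R) ⧸ LinearMap.range (Matrix.mulVecLin (matBar (genericMatrix K n)ᵀ))
    letI E := (((Ext R (ModuleCat R) 1).obj
        (Opposite.op (ModuleCat.of R L))).obj (ModuleCat.of R Ldual))
    letI J := Ideal.span
        (Ideal.Quotient.mk (minorsIdeal K n) '' rowMinorsSet K n r s)
    ∃ e : E ≃+ J,
      ∀ (t : MvPolynomial (Fin n × Fin n) K) (x : E),
        e ((Ideal.Quotient.mk (Ideal.span {(genericMatrix K n).det}) t) • x)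
          = (Ideal.Quotient.mk (minorsIdeal K n) t) • e x := by
  obtain ⟨m, rfl⟩ := Nat.exists_eq_add_of_le' hn
  have hG := isGood_mvPolynomialX K (Fin (m + 2))
  have hX : ∀ c, c * (genericMatrix K (m + 2)).det = 0 → c = 0 := by
    obtain ⟨l, l', q, q', hr, -⟩ := hG.regular
    exact IsRegularModulo.bot_iff.1 hr.det
  have hI : minorsIdeal K (m + 2) = adjugateIdeal (genericMatrix K (m + 2)) :=
    span_minors_eq_adjugateIdeal _
  have hF : IsFaithfulEntry (genericMatrix K (m + 2)) r s :=
    isFaithfulEntry_mvPolynomialX_fin m K hrs.ne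
  obtain ⟨π, hπ, hπs, hπ₀⟩ := exists_ext_surjection_of_matrix hX rfl
  have hrange : Set.range (cocycleEntry (genericMatrix K (m + 2)) (minorsIdeal K (m + 2)) r s) =
      Ideal.span (Ideal.Quotient.mk (minorsIdeal K (m + 2)) '' rowMinorsSet K (m + 2) r s) := by
    rw [← Ideal.map_span, hI]
    refine (map_cocycleEntry_range hX hG.alternating).trans ?_
    rw [← span_rowMinors_eq hX hrs.ne]
    rfl
  let ψ := cocycleEntry (genericMatrix K (m + 2)) (minorsIdeal K (m + 2)) r s
  let ψ' : cocyclePairs (genericMatrix K (m + 2)) →+ Ideal.span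
      (Ideal.Quotient.mk (minorsIdeal K (m + 2)) '' rowMinorsSet K (m + 2) r s) :=
    { toFun := fun p => ⟨ψ p, hrange.le ⟨p, rfl⟩⟩
      map_zero' := Subtype.ext (map_zero ψ)
      map_add' := fun p q => Subtype.ext (map_add ψ p q) }
  have hψ' : Function.Surjective ψ' := fun x => by
    obtain ⟨p, hp⟩ := hrange.ge x.2
    exact ⟨p, Subtype.ext hp⟩
  have hker : ∀ p, π p = 0 ↔ ψ' p = 0 := fun p => by
    have := cocycleEntry_eq_zero_iff hX hF p
    rw [← hI] at this
    rw [hπ₀, ← this]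
    exact ⟨fun h => Subtype.ext h, fun h => congrArg Subtype.val h⟩
  obtain ⟨e, he⟩ := exists_addEquiv_of_ker_eq π ψ' hπ hψ' hker
  refine ⟨e, fun t x => ?_⟩
  obtain ⟨p, rfl⟩ := hπ x
  refine (congrArg e (hπs t p)).symm.trans ?_
  refine (he _).trans (Subtype.ext ?_)
  refine (map_smul ψ t p).trans ?_
  refine Eq.trans ?_ (congrArg (fun y => Ideal.Quotient.mk (minorsIdeal K (m + 2)) t * y)
    (congrArg Subtype.val (he p)).symm)
  rfl

end
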